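/- Let g ≥ 1, n ≥ 1, and let d_1,…,d_n ≥ 1 be integers with Σ_{j=1}^n (d_j−1) = g−1. Then Σ_{j=0}^{2g} (−1)^j ⟨τ_{2g−j} τ_j Π_{i=1}^n τ_{d_i}⟩_g = (2g+n−1)!/(4^g (2g+1)! Π_{j=1}^n (2d_j−1)!!). -/

import Mathlib

open MvPolynomial Finset

noncomputable section

/-- The polynomial ring `ℚ[x_1,…,x_n]`. -/
abbrev R (n : ℕ) : Type := MvPolynomial (Fin n) ℚ

/-- The field of rational functions `ℚ(x_1,…,x_n)`. -/
abbrev K (n : ℕ) : Type := FractionRing (R n)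

/-- `x_1 + ⋯ + x_n` as an element of `K n`. -/
def SX (n : ℕ) : K n := algebraMap (R n) (K n) (∑ j, X j)

/-- `x_1^3 + ⋯ + x_n^3` as an element of `K n`. -/
def SX3 (n : ℕ) : K n := algebraMap (R n) (K n) (∑ j, (X j)^3)

/-- `Δ(x_1,…,x_n) = ((Σ x_j)^3 − Σ x_j^3)/3`. -/
def Dlt (n : ℕ) : K n := ((SX n)^3 - SX3 n) / 3

/-- The ring homomorphism `ℚ[x_1,…,x_{|I|}] → ℚ(x_1,…,x_n)` substituting the variables
of the subset `I` (in increasing order). -/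
def embRH {n : ℕ} (I : Finset (Fin n)) : R I.card →+* K n :=
  (algebraMap (R n) (K n)).comp
    (MvPolynomial.rename (fun i : Fin I.card => ((I.orderIsoOfFin rfl) i : Fin n))).toRingHom

lemma embRH_inj {n : ℕ} (I : Finset (Fin n)) : Function.Injective (embRH I) := by
  have h1 : Function.Injective (fun i : Fin I.card => ((I.orderIsoOfFin rfl) i : Fin n)) := by
    intro i j hij
    exact (I.orderIsoOfFin rfl).injective (Subtype.val_injective hij)
  have h2 := (IsFractionRing.injective (R n) (K n)).comp (MvPolynomial.rename_injective _ h1)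
  simpa [embRH, RingHom.coe_comp] using h2

/-- The field embedding `ℚ(x_1,…,x_{|I|}) → ℚ(x_1,…,x_n)` substituting the variables
of the subset `I` (in increasing order).  Used for expressions like `G_{r'}(x_I)`. -/
def emb {n : ℕ} (I : Finset (Fin n)) : K I.card →+* K n :=
  IsFractionRing.lift (embRH_inj I)

/-- The normalized `n`-point functions `G_g(x_1,…,x_n)`, defined with a fuel parameter
(first argument) for structural recursion; for `fuel ≥ n` this computes the recursively
defined normalized `n`-point function:  `G_0(x) = x^{-2}`, `G_g(x) = 0` for `g ≥ 1`, and
for `n ≥ 2`,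
`G_g = Σ_{r+s=g} ((2r+n−3)!!/(4^s(2r+2s+n−1)!!)) P_r Δ^s` where
`P_r = (1/(2Σx_j)) Σ_{I⊔J={1..n}, I,J≠∅} (Σ_I x)²(Σ_J x)² Σ_{r'≤r} G_{r'}(x_I)G_{r−r'}(x_J)`. -/
def Gf : (fuel : ℕ) → (n : ℕ) → ℕ → K n
  | _, 0, _ => 0
  | _, 1, 0 => (algebraMap (R 1) (K 1) (X 0)) ^ (-2 : ℤ)
  | _, 1, _+1 => 0
  | 0, _+2, _ => 0
  | fuel+1, n+2, g =>
      ∑ s ∈ Finset.range (g+1),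
        (((Nat.doubleFactorial (2*(g-s)+(n+2)-3) : ℚ) /
          (4^s * (Nat.doubleFactorial (2*g+(n+2)-1) : ℚ))) : K (n+2)) *
        ((2 * SX (n+2))⁻¹ *
          ∑ I : Finset (Fin (n+2)),
            if I ≠ ∅ ∧ I ≠ univ then
              (algebraMap (R (n+2)) (K (n+2)) (∑ i ∈ I, X i))^2 *
              (algebraMap (R (n+2)) (K (n+2)) (∑ i ∈ Iᶜ, X i))^2 *
              ∑ r' ∈ Finset.range ((g-s)+1),
                emb I (Gf fuel I.card r') * emb Iᶜ (Gf fuel Iᶜ.card ((g-s) - r'))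
            else 0) *
        (Dlt (n+2))^s

/-- The normalized `n`-point function `G_g(x_1,…,x_n)` as an element of `ℚ(x_1,…,x_n)`. -/
def Gnpt (n g : ℕ) : K n := Gf n n g

/-- `P_r(x_1,…,x_n)`. -/
def Ppoly (n r : ℕ) : K n :=
  (2 * SX n)⁻¹ *
    ∑ I : Finset (Fin n),
      if I ≠ ∅ ∧ I ≠ univ then
        (algebraMap (R n) (K n) (∑ i ∈ I, X i))^2 *
        (algebraMap (R n) (K n) (∑ i ∈ Iᶜ, X i))^2 *
        ∑ r' ∈ Finset.range (r+1), emb I (Gnpt I.card r') * emb Iᶜ (Gnpt Iᶜ.card (r - r'))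
      else 0

/-- The `n`-point function `F_g(x_1,…,x_n) = Σ_{h+d=g} (1/d!)((Σx_j^3)/24)^d G_h(x_1,…,x_n)`. -/
def Fnpt (n g : ℕ) : K n :=
  ∑ d ∈ Finset.range (g+1),
    ((1 / (Nat.factorial d : ℚ)) : K n) * (SX3 n / 24)^d * Gnpt n (g-d)

open Classical in
/-- The coefficient of the monomial `Π x_j^{d_j}` of an element of `ℚ(x_1,…,x_n)` which is
a polynomial (junk value `0` otherwise). -/
def coeffK {n : ℕ} (f : K n) (d : Fin n → ℕ) : ℚ :=
  if h : ∃ p : R n, algebraMap (R n) (K n) p = f then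
    MvPolynomial.coeff (Finsupp.equivFunOnFinite.symm d) h.choose
  else 0

/-- The intersection index `⟨τ_{d_1} ⋯ τ_{d_n}⟩_g`, i.e. the coefficient of `Π x_j^{d_j}`
in `F_g(x_1,…,x_n)`.  For `(g,n) = (0,1), (0,2)` and nonnegative `d_j` the value is `0`
(the conventional values `⟨τ_{-2}⟩_0 = 1`, `⟨τ_k τ_{-1-k}⟩_0 = (-1)^k` have a negative index). -/
def bracket (g : ℕ) {n : ℕ} (d : Fin n → ℕ) : ℚ :=
  if g = 0 ∧ n ≤ 2 then 0 else coeffK (Fnpt n g) d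

/-- `⟨τ_j Π_{i ∈ I} τ_{d_i}⟩_g` for a subset `I ⊆ {1,…,n}`. -/
def bracketI (g : ℕ) {n : ℕ} (j : ℕ) (I : Finset (Fin n)) (d : Fin n → ℕ) : ℚ :=
  bracket g (Fin.cons j (fun i : Fin I.card => d ((I.orderIsoOfFin rfl) i)))


/-! ### Laurent expansions in `y` (formal series in `ℚ[x_1,…,x_n][[y,y⁻¹]]` of bounded
`y`-degree, realized as Hahn/Laurent series in the variable `t = y⁻¹`, so that the
coefficient of `y^k` is the Hahn coefficient at `-k`). -/

/-- Laurent series in `t = y⁻¹` with coefficients in `ℚ[x_1,…,x_n]`. -/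
abbrev Lau (n : ℕ) : Type := LaurentSeries (R n)

/-- The generalized binomial coefficient `C(p,k) = p(p−1)⋯(p−k+1)/k!` for `p : ℤ`, `k : ℕ`. -/
def binomZ (p : ℤ) (k : ℕ) : ℚ := (∏ i ∈ Finset.range k, ((p : ℚ) - i)) / (Nat.factorial k)

/-- The expansion of `(y + c)^m = Σ_{k≥0} C(m,k) c^k y^{m−k}` as a Laurent series
in `t = y⁻¹` (for `m ≥ 0` this is the usual binomial expansion of the polynomial). -/
def yExpAdd {n : ℕ} (c : R n) (m : ℤ) : Lau n :=
  (HahnSeries.single (-m) (1 : R n)) *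
    HahnSeries.ofPowerSeries ℤ (R n)
      (PowerSeries.mk fun k => MvPolynomial.C (binomZ m k) * c^k)

/-- The expansion of `(±y + c)^m`, where the sign is `+` if `σ = true` and `−` otherwise;
it is computed as `(±1)^m (y ± c)^m`. -/
def LExp {n : ℕ} (σ : Bool) (c : R n) (m : ℤ) : Lau n :=
  (if σ then 1 else if Even m then 1 else -1 : Lau n) *
    yExpAdd ((if σ then 1 else -1 : R n) * c) m

open Classical in
/-- The polynomial representing an element of `ℚ(x_1,…,x_n)` lying in `ℚ[x_1,…,x_n]`
(junk value `0` otherwise). -/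
def polyOf {n : ℕ} (f : K n) : R n :=
  if h : ∃ p : R n, algebraMap (R n) (K n) p = f then h.choose else 0

/-- `±y` as a Laurent series in `t = y⁻¹`. -/
def yLau (n : ℕ) (σ : Bool) : Lau n :=
  (if σ then 1 else -1 : Lau n) * HahnSeries.single (-1 : ℤ) (1 : R n)

/-- The expansion of `F_g(±y, x_I)` as a Laurent series in `t = y⁻¹` with coefficients in
`ℚ[x_1,…,x_n]`: for `(g,|I|+1) = (0,1)` it is `(±y)^{-2} = y^{-2}`, for `(g,|I|+1) = (0,2)`
it is `1/(±y + x_i) = Σ_{k≥0} (−1)^k x_i^k (±y)^{−k−1}`, and otherwise it is obtained by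
substituting `±y` and the variables of `I` into the polynomial `F_g`. -/
def FExp {n : ℕ} (σ : Bool) (g : ℕ) (I : Finset (Fin n)) : Lau n :=
  if g = 0 ∧ I.card = 0 then HahnSeries.single (2 : ℤ) (1 : R n)
  else if g = 0 ∧ I.card = 1 then LExp σ (∑ i ∈ I, X i) (-1)
  else
    MvPolynomial.eval₂ ((HahnSeries.C).comp (algebraMap ℚ (R n)))
      (Fin.cons (yLau n σ)
        (fun i : Fin I.card => HahnSeries.C (X ((I.orderIsoOfFin rfl) i : Fin n))))
      (polyOf (Fnpt (I.card + 1) g))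

/-- `L_g^{a,b}(y, x_1,…,x_n) = Σ_{g'=0}^{g} Σ_{I⊔J={1,…,n}} (y+Σ_I x)^a (−y+Σ_J x)^b
F_{g'}(y,x_I) F_{g−g'}(−y,x_J)` as a Laurent series in `t = y⁻¹`. -/
def LL (g n : ℕ) (a b : ℤ) : Lau n :=
  ∑ gp ∈ Finset.range (g+1), ∑ I : Finset (Fin n),
    LExp true (∑ i ∈ I, X i) a * LExp false (∑ i ∈ Iᶜ, X i) b *
      FExp true gp I * FExp false (g - gp) Iᶜ

/-- The coefficient of `y^k Π_j x_j^{d_j}` in a Laurent series in `t = y⁻¹` with coefficients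
in `ℚ[x_1,…,x_n]`. -/
def coeffL {n : ℕ} (f : Lau n) (k : ℤ) (d : Fin n → ℕ) : ℚ :=
  MvPolynomial.coeff (Finsupp.equivFunOnFinite.symm d) (f.coeff (-k))

/-- The index of the variable `z_i` among the `a + b + n` variables `z, w, x`. -/
def zIdx (a b n : ℕ) (i : Fin a) : Fin (a+b+n) := ⟨i.1, by have := i.2; omega⟩

/-- The index of the variable `w_i` among the `a + b + n` variables `z, w, x`. -/
def wIdx (a b n : ℕ) (i : Fin b) : Fin (a+b+n) := ⟨a + i.1, by have := i.2; omega⟩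

/-- The index of the variable `x_i` among the `a + b + n` variables `z, w, x`. -/
def xIdx (a b n : ℕ) (i : Fin n) : Fin (a+b+n) := ⟨a + b + i.1, by have := i.2; omega⟩

/-- `L_g(y; z_1,…,z_a; w_1,…,w_b; x_1,…,x_n)
 = Σ_{g'=0}^{g} Σ_{I⊔J={1,…,n}} F_{g'}(y, z, x_I) F_{g−g'}(−y, w, x_J)`,
as a Laurent series in `t = y⁻¹` with coefficients in `ℚ[z,w,x]`. -/
def LLm (g n a b : ℕ) : Lau (a+b+n) :=
  ∑ gp ∈ Finset.range (g+1), ∑ I : Finset (Fin n),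
    FExp true gp ((univ.image (zIdx a b n)) ∪ I.image (xIdx a b n)) *
    FExp false (g - gp) ((univ.image (wIdx a b n)) ∪ Iᶜ.image (xIdx a b n))

/-- The exponent vector of the monomial `Π z_j^{r_j} Π w_j^{s_j} Π x_j^{d_j}`. -/
def expVec (a b n : ℕ) (r : Fin a → ℕ) (s : Fin b → ℕ) (d : Fin n → ℕ) :
    Fin (a+b+n) → ℕ :=
  fun v =>
    if h : v.1 < a then r ⟨v.1, h⟩
    else if h2 : v.1 < a + b then s ⟨v.1 - a, by omega⟩
    else d ⟨v.1 - (a+b), by have := v.2; omega⟩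


/-- Functions on finite subsets of `ι`, with the product that sums over all ways to split a set
into two disjoint parts. -/
def SetFun (ι B : Type) : Type := Finset ι → B

namespace SetFun

variable {ι B : Type}

section Ring

variable [DecidableEq ι] [CommRing B]

instance : AddCommGroup (SetFun ι B) := inferInstanceAs (AddCommGroup (Finset ι → B))

instance : Mul (SetFun ι B) := ⟨fun f g N => ∑ I ∈ N.powerset, f I * g (N \ I)⟩

/-- The set function supported on the empty set. -/
def single (c : B) : SetFun ι B := fun N => if N = ∅ then c else 0

instance : One (SetFun ι B) := ⟨single 1⟩

omit [DecidableEq ι] [CommRing B] in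
@[ext] lemma ext {f g : SetFun ι B} (h : ∀ N, f N = g N) : f = g := funext h

lemma mul_apply (f g : SetFun ι B) (N : Finset ι) :
    (f * g) N = ∑ I ∈ N.powerset, f I * g (N \ I) := rfl

lemma one_apply (N : Finset ι) : (1 : SetFun ι B) N = if N = ∅ then 1 else 0 := rfl

lemma single_apply (c : B) (N : Finset ι) :
    (single c : SetFun ι B) N = if N = ∅ then c else 0 := rfl

omit [DecidableEq ι] in
@[simp] lemma add_apply (f g : SetFun ι B) (N : Finset ι) : (f + g) N = f N + g N := rfl
omit [DecidableEq ι] in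
@[simp] lemma sub_apply (f g : SetFun ι B) (N : Finset ι) : (f - g) N = f N - g N := rfl
omit [DecidableEq ι] in
@[simp] lemma neg_apply (f : SetFun ι B) (N : Finset ι) : (-f) N = -f N := rfl
omit [DecidableEq ι] in
@[simp] lemma zero_apply (N : Finset ι) : (0 : SetFun ι B) N = 0 := rfl

lemma mul_comm' (f g : SetFun ι B) : f * g = g * f := by
  ext N
  rw [mul_apply, mul_apply]
  refine Finset.sum_nbij' (fun I => N \ I) (fun I => N \ I) ?_ ?_ ?_ ?_ ?_
  · intro I _; simp
  · intro I _; simp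
  · intro I hI; simpa using (Finset.mem_powerset.1 hI)
  · intro I hI; simpa using (Finset.mem_powerset.1 hI)
  · intro I hI
    simp only [Finset.sdiff_sdiff_eq_self (Finset.mem_powerset.1 hI)]
    ring

lemma mul_assoc' (f g h : SetFun ι B) : f * g * h = f * (g * h) := by
  ext N
  simp only [mul_apply, Finset.sum_mul, Finset.mul_sum]
  rw [Finset.sum_sigma', Finset.sum_sigma']
  refine Finset.sum_nbij' (fun p => ⟨p.2, p.1 \ p.2⟩) (fun p => ⟨p.1 ∪ p.2, p.1⟩) ?_ ?_ ?_ ?_ ?_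
  · rintro ⟨I, J⟩ hI
    simp only [Finset.mem_sigma, Finset.mem_powerset] at hI ⊢
    exact ⟨hI.2.trans hI.1, Finset.sdiff_subset_sdiff hI.1 le_rfl⟩
  · rintro ⟨I, J⟩ hI
    simp only [Finset.mem_sigma, Finset.mem_powerset] at hI ⊢
    exact ⟨Finset.union_subset hI.1 (hI.2.trans Finset.sdiff_subset), Finset.subset_union_left⟩
  · rintro ⟨I, J⟩ hI
    simp only [Finset.mem_sigma, Finset.mem_powerset] at hI
    simp [Finset.union_sdiff_of_subset hI.2]
  · rintro ⟨I, J⟩ hI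
    simp only [Finset.mem_sigma, Finset.mem_powerset] at hI
    have : Disjoint J I := by
      rw [Finset.disjoint_left]
      intro a ha
      exact (Finset.mem_sdiff.1 (hI.2 ha)).2
    simp [Finset.union_sdiff_left, Finset.sdiff_eq_self_of_disjoint this]
  · rintro ⟨I, J⟩ hI
    simp only [Finset.mem_sigma, Finset.mem_powerset] at hI
    have : (N \ J) \ (I \ J) = N \ I := by
      ext a; have := @hI.2 a; simp only [Finset.mem_sdiff]; tauto
    simp only [this]
    ring

lemma single_mul_apply (c : B) (f : SetFun ι B) (N : Finset ι) :
    ((single c : SetFun ι B) * f) N = c * f N := by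
  rw [mul_apply, Finset.sum_eq_single ∅]
  · simp [single_apply]
  · intro I _ hI; simp [single_apply, hI]
  · simp

instance : CommRing (SetFun ι B) :=
  { (inferInstance : AddCommGroup (SetFun ι B)) with
    mul := (· * ·)
    one := 1
    mul_assoc := mul_assoc'
    mul_comm := mul_comm'
    one_mul := fun f => by
      ext N; exact (single_mul_apply 1 f N).trans (one_mul _)
    mul_one := fun f => by
      rw [mul_comm']; ext N; exact (single_mul_apply 1 f N).trans (one_mul _)
    left_distrib := fun f g h => by
      ext N; simp [mul_apply, mul_add, Finset.sum_add_distrib]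
    right_distrib := fun f g h => by
      ext N; simp [mul_apply, add_mul, Finset.sum_add_distrib]
    zero_mul := fun f => by ext N; simp [mul_apply]
    mul_zero := fun f => by ext N; simp [mul_apply] }

@[simp] lemma sum_apply {α : Type} (s : Finset α) (f : α → SetFun ι B) (N : Finset ι) :
    (∑ a ∈ s, f a) N = ∑ a ∈ s, f a N :=
  Finset.sum_apply N s f

@[simp] lemma nsmul_apply (n : ℕ) (f : SetFun ι B) (N : Finset ι) : (n • f) N = n • f N := rfl

lemma natCast_mul_apply (n : ℕ) (f : SetFun ι B) (N : Finset ι) :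
    ((n : SetFun ι B) * f) N = n * f N := by
  rw [← nsmul_eq_mul, nsmul_apply, nsmul_eq_mul]

/-- `SetFun.single` as a ring homomorphism. -/
def const : B →+* SetFun ι B where
  toFun := single
  map_one' := rfl
  map_zero' := by ext N; simp [single_apply]
  map_add' a b := by ext N; by_cases h : N = ∅ <;> simp [single_apply, h]
  map_mul' a b := by
    ext N
    rw [single_mul_apply]
    by_cases h : N = ∅ <;> simp [single_apply, h]

lemma const_apply (c : B) (N : Finset ι) : (const c : SetFun ι B) N = if N = ∅ then c else 0 := rfl

lemma const_mul_apply (c : B) (f : SetFun ι B) (N : Finset ι) :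
    ((const c : SetFun ι B) * f) N = c * f N := single_mul_apply c f N

instance [Algebra ℚ B] : Algebra ℚ (SetFun ι B) := (const.comp (algebraMap ℚ B)).toAlgebra

lemma algebraMap_eq [Algebra ℚ B] (c : ℚ) :
    algebraMap ℚ (SetFun ι B) c = const (algebraMap ℚ B c) := rfl

@[simp] lemma smul_apply [Algebra ℚ B] (c : ℚ) (f : SetFun ι B) (N : Finset ι) :
    (c • f) N = c • f N := by
  rw [Algebra.smul_def, Algebra.smul_def, algebraMap_eq, const_mul_apply]

/-- Multiplication of the value at `N` by `∑ i ∈ N, ω i`, as a derivation. -/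
def weight [Algebra ℚ B] (ω : ι → B) : Derivation ℚ (SetFun ι B) (SetFun ι B) :=
  Derivation.mk'
    { toFun := fun f N => (∑ i ∈ N, ω i) * f N
      map_add' := fun f g => funext fun N => mul_add _ (f N) (g N)
      map_smul' := fun c f => by
        ext N
        refine Eq.trans ?_ (smul_apply c _ N).symm
        rw [smul_apply]
        exact mul_smul_comm _ _ _ }
    (fun f g => by
      ext N
      refine Eq.trans ?_ (add_apply _ _ N).symm
      rw [smul_eq_mul, smul_eq_mul, mul_comm g, mul_apply, mul_apply]
      change (∑ i ∈ N, ω i) * ∑ I ∈ N.powerset, f I * g (N \ I) =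
        ∑ I ∈ N.powerset, f I * ((∑ i ∈ N \ I, ω i) * g (N \ I)) +
          ∑ I ∈ N.powerset, ((∑ i ∈ I, ω i) * f I) * g (N \ I)
      rw [Finset.mul_sum, ← Finset.sum_add_distrib]
      refine Finset.sum_congr rfl fun I hI => ?_
      rw [← Finset.sum_sdiff (Finset.mem_powerset.1 hI)]
      ring)

@[simp] lemma weight_apply [Algebra ℚ B] (ω : ι → B) (f : SetFun ι B) (N : Finset ι) :
    (weight ω f) N = (∑ i ∈ N, ω i) * f N := rfl

lemma weight_comm [Algebra ℚ B] (ω ω' : ι → B) (f : SetFun ι B) :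
    weight ω (weight ω' f) = weight ω' (weight ω f) := by
  ext N; simp only [weight_apply]; ring

/-- Pointwise application of a ring homomorphism to set functions. -/
def map {B' : Type} [CommRing B'] (φ : B →+* B') : SetFun ι B →+* SetFun ι B' where
  toFun f N := φ (f N)
  map_one' := by ext N; by_cases h : N = ∅ <;> simp [one_apply, h]
  map_zero' := by ext N; simp
  map_add' f g := funext fun N => map_add φ (f N) (g N)
  map_mul' f g := by
    ext N
    rw [mul_apply, map_sum]
    simp only [map_mul]
    rfl

@[simp] lemma map_apply {B' : Type} [CommRing B'] (φ : B →+* B') (f : SetFun ι B) (N : Finset ι) :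
    map φ f N = φ (f N) := rfl

end Ring

end SetFun

section SeriesDerivations

variable {A : Type} [CommRing A] [Algebra ℚ A]

/-- Coefficientwise application of a derivation to a power series. -/
def coeffDerivation (D : Derivation ℚ A A) : Derivation ℚ (PowerSeries A) (PowerSeries A) :=
  Derivation.mk'
    { toFun := fun f => PowerSeries.mk fun g => D (PowerSeries.coeff g f)
      map_add' := fun f h => by ext g; simp
      map_smul' := fun c f => by ext g; simp [PowerSeries.coeff_mk] }
    (fun f h => by
      ext g
      simp only [LinearMap.coe_mk, AddHom.coe_mk, PowerSeries.coeff_mk, smul_eq_mul, map_add,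
        mul_comm h, PowerSeries.coeff_mul, map_sum, Derivation.leibniz, Finset.sum_add_distrib]
      simp only [mul_comm])

@[simp] lemma coeff_coeffDerivation (D : Derivation ℚ A A) (f : PowerSeries A) (g : ℕ) :
    PowerSeries.coeff g (coeffDerivation D f) = D (PowerSeries.coeff g f) := by
  change PowerSeries.coeff g (PowerSeries.mk fun g => D (PowerSeries.coeff g f)) = _
  rw [PowerSeries.coeff_mk]

variable (A) in
/-- The Euler derivation `X d/dX` on power series. -/
def eulerDerivation : Derivation ℚ (PowerSeries A) (PowerSeries A) :=
  Derivation.mk'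
    { toFun := fun f => PowerSeries.mk fun g => (g : A) * PowerSeries.coeff g f
      map_add' := fun f h => by ext g; simp [mul_add]
      map_smul' := fun c f => by ext g; simp [PowerSeries.coeff_mk] }
    (fun f h => by
      ext g
      simp only [LinearMap.coe_mk, AddHom.coe_mk, PowerSeries.coeff_mk, smul_eq_mul, map_add,
        mul_comm h, PowerSeries.coeff_mul]
      rw [Finset.mul_sum, ← Finset.sum_add_distrib]
      refine Finset.sum_congr rfl fun p hp => ?_
      rw [← Finset.HasAntidiagonal.mem_antidiagonal.1 hp]
      push_cast
      ring)

@[simp] lemma coeff_eulerDerivation (f : PowerSeries A) (g : ℕ) :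
    PowerSeries.coeff g (eulerDerivation A f) = (g : A) * PowerSeries.coeff g f := by
  change PowerSeries.coeff g (PowerSeries.mk fun g => (g : A) * PowerSeries.coeff g f) = _
  rw [PowerSeries.coeff_mk]

lemma coeffDerivation_X_mul (D : Derivation ℚ A A) (f : PowerSeries A) :
    coeffDerivation D (PowerSeries.X * f) = PowerSeries.X * coeffDerivation D f := by
  have h : coeffDerivation D (PowerSeries.X : PowerSeries A) = 0 := by
    ext g
    rw [coeff_coeffDerivation, PowerSeries.coeff_X]
    split_ifs <;> simp
  rw [Derivation.leibniz, h]; simp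

lemma coeffDerivation_C (D : Derivation ℚ A A) (a : A) :
    coeffDerivation D (PowerSeries.C a) = PowerSeries.C (D a) := by
  ext g
  rw [coeff_coeffDerivation, PowerSeries.coeff_C, PowerSeries.coeff_C]
  split_ifs <;> simp

end SeriesDerivations

section Bilinear

variable {A : Type} [CommRing A] [Algebra ℚ A] (d : Derivation ℚ A A) (y : A)

/-- The operators `f ⊗ g ↦ ((d + y) ⊗ 1 - 1 ⊗ (d - y))^k (f ⊗ g)` followed by multiplication. -/
def hirota : ℕ → A → A → A
  | 0, f, g => f * g
  | k + 1, f, g => hirota k (d f + y * f) g - hirota k f (d g - y * g)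

lemma hirota_zero (f g : A) : hirota d y 0 f g = f * g := rfl

lemma hirota_succ (k : ℕ) (f g : A) :
    hirota d y (k + 1) f g = hirota d y k (d f + y * f) g - hirota d y k f (d g - y * g) := rfl

lemma hirota_add_left (k : ℕ) (f f' g : A) :
    hirota d y k (f + f') g = hirota d y k f g + hirota d y k f' g := by
  induction k generalizing f f' g with
  | zero => simp [hirota_zero, add_mul]
  | succ k ih =>
    have : d (f + f') + y * (f + f') = (d f + y * f) + (d f' + y * f') := by
      rw [map_add]; ring
    rw [hirota_succ, this, ih (d f + y * f), ih f f', hirota_succ, hirota_succ]; ring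

lemma hirota_add_right (k : ℕ) (f g g' : A) :
    hirota d y k f (g + g') = hirota d y k f g + hirota d y k f g' := by
  induction k generalizing f g g' with
  | zero => simp [hirota_zero, mul_add]
  | succ k ih =>
    have : d (g + g') - y * (g + g') = (d g - y * g) + (d g' - y * g') := by
      rw [map_add]; ring
    rw [hirota_succ, this, ih, ih, hirota_succ, hirota_succ]; ring

variable {d y}

lemma hirota_const_mul_left {c : A} (hc : d c = 0) (k : ℕ) (f g : A) :
    hirota d y k (c * f) g = c * hirota d y k f g := by
  induction k generalizing f g with
  | zero => simp [hirota_zero, mul_assoc]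
  | succ k ih =>
    have : d (c * f) + y * (c * f) = c * (d f + y * f) := by
      rw [Derivation.leibniz, hc]; simp only [smul_eq_mul]; ring
    rw [hirota_succ, this, ih, ih, hirota_succ]; ring

lemma hirota_const_mul_right {c : A} (hc : d c = 0) (k : ℕ) (f g : A) :
    hirota d y k f (c * g) = c * hirota d y k f g := by
  induction k generalizing f g with
  | zero => simp only [hirota_zero]; ring
  | succ k ih =>
    have : d (c * g) - y * (c * g) = c * (d g - y * g) := by
      rw [Derivation.leibniz, hc]; simp only [smul_eq_mul]; ring
    rw [hirota_succ, this, ih, ih, hirota_succ]; ring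

lemma derivation_hirota {E : Derivation ℚ A A} (hE : ∀ a, E (d a) = d (E a)) (hy : E y = 0)
    (k : ℕ) (f g : A) :
    E (hirota d y k f g) = hirota d y k (E f) g + hirota d y k f (E g) := by
  induction k generalizing f g with
  | zero =>
    simp only [hirota_zero, Derivation.leibniz, smul_eq_mul]; ring
  | succ k ih =>
    have h1 : E (d f + y * f) = d (E f) + y * E f := by
      rw [map_add, Derivation.leibniz, hy, hE]; simp
    have h2 : E (d g - y * g) = d (E g) - y * E g := by
      rw [map_sub, Derivation.leibniz, hy, hE]; simp
    rw [hirota_succ, map_sub, ih, ih, h1, h2, hirota_succ, hirota_succ]; ring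

lemma d_hirota (hy : d y = 0) (k : ℕ) (f g : A) :
    d (hirota d y k f g) = hirota d y k (d f + y * f) g + hirota d y k f (d g - y * g) := by
  have h1 : d g - y * g = d g + (-y) * g := by ring
  have h2 : d (-y) = 0 := by simp [hy]
  rw [derivation_hirota (fun a => rfl) hy, hirota_add_left, h1, hirota_add_right,
    hirota_const_mul_left hy, hirota_const_mul_right h2]
  ring

lemma hirota_shift_left (hy : d y = 0) (k : ℕ) (f g : A) :
    2 * hirota d y k (d f + y * f) g = d (hirota d y k f g) + hirota d y (k + 1) f g := by
  rw [d_hirota hy, hirota_succ]; ring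

lemma hirota_shift_right (hy : d y = 0) (k : ℕ) (f g : A) :
    2 * hirota d y k f (d g - y * g) = d (hirota d y k f g) - hirota d y (k + 1) f g := by
  rw [d_hirota hy, hirota_succ]; ring

lemma hirota_mul_left (k : ℕ) (u f g : A) :
    hirota d y k (u * f) g =
      ∑ p ∈ antidiagonal k, (k.choose p.1 : A) * (d^[p.1] u * hirota d y p.2 f g) := by
  induction k generalizing u f g with
  | zero => simp [hirota_zero, mul_assoc]
  | succ k ih =>
    have h1 : d (u * f) + y * (u * f) = d u * f + u * (d f + y * f) := by
      rw [Derivation.leibniz]; simp only [smul_eq_mul]; ring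
    rw [hirota_succ, h1, hirota_add_left, ih, ih, ih,
      Finset.sum_antidiagonal_choose_succ_mul
        (fun i j => d^[i] u * hirota d y j f g), add_sub_assoc, ← Finset.sum_sub_distrib,
      add_comm]
    congr 1
    · refine Finset.sum_congr rfl fun p _ => ?_
      rw [hirota_succ]; ring
    · refine Finset.sum_congr rfl fun p hp => ?_
      rw [Nat.choose_symm_of_eq_add (Finset.HasAntidiagonal.mem_antidiagonal.1 hp).symm]
      rfl

lemma hirota_mul_right (k : ℕ) (u f g : A) :
    hirota d y k f (u * g) =
      ∑ p ∈ antidiagonal k,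
        (k.choose p.1 : A) * ((-1) ^ p.1 * d^[p.1] u * hirota d y p.2 f g) := by
  induction k generalizing u f g with
  | zero => simp [hirota_zero, mul_left_comm]
  | succ k ih =>
    have h1 : d (u * g) - y * (u * g) = d u * g + u * (d g - y * g) := by
      rw [Derivation.leibniz]; simp only [smul_eq_mul]; ring
    rw [hirota_succ, h1, hirota_add_right, ih, ih, ih,
      Finset.sum_antidiagonal_choose_succ_mul
        (fun i j => (-1) ^ i * d^[i] u * hirota d y j f g), sub_add_eq_sub_sub_swap,
      ← Finset.sum_sub_distrib, sub_eq_add_neg, ← Finset.sum_neg_distrib]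
    congr 1
    · refine Finset.sum_congr rfl fun p _ => ?_
      rw [hirota_succ]; ring
    · refine Finset.sum_congr rfl fun p hp => ?_
      rw [Nat.choose_symm_of_eq_add (Finset.HasAntidiagonal.mem_antidiagonal.1 hp).symm,
        Function.iterate_succ_apply]
      ring

/-- The sum of the two cubic terms. -/
lemma hirota_cube (hy : d y = 0) (k : ℕ) (f g : A) :
    4 * (hirota d y k (d (d (d f + y * f) + y * (d f + y * f))
          + y * (d (d f + y * f) + y * (d f + y * f))) g
        + hirota d y k f (d (d (d g - y * g) - y * (d g - y * g))
          - y * (d (d g - y * g) - y * (d g - y * g))))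
      = d (d (d (hirota d y k f g))) + 3 * d (hirota d y (k + 2) f g) := by
  simp only [d_hirota hy, map_add, hirota_succ, map_sub]
  ring

variable {E : Derivation ℚ A A} {l u w w' : A}

/-- The evolution of the bilinear quantities attached to two solutions of the linear problem. -/
lemma derivation_hirota_of_lax (hE : ∀ a, E (d a) = d (E a)) (hy : d y = 0) (hEy : E y = 0)
    (hl : d l = 0)
    (hw : 12 * E w = 12 * (u * (d w + y * w)) + l * (d (d (d w + y * w) + y * (d w + y * w))
          + y * (d (d w + y * w) + y * (d w + y * w))))
    (hw' : 12 * E w' = 12 * (u * (d w' - y * w')) + l * (d (d (d w' - y * w') - y * (d w' - y * w'))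
          - y * (d (d w' - y * w') - y * (d w' - y * w')))) (k : ℕ) :
    48 * E (hirota d y k w w') =
      48 * ∑ p ∈ antidiagonal k, (k.choose p.1 : A) * (d^[p.1] u *
        (if Even p.1 then d (hirota d y p.2 w w') else hirota d y (p.2 + 1) w w'))
      + l * (d (d (d (hirota d y k w w'))) + 3 * d (hirota d y (k + 2) w w')) := by
  have h12 : d (12 : A) = 0 := by
    simpa using d.map_natCast 12
  have e1 := congrArg (fun f => hirota d y k f w') hw
  have e2 := congrArg (fun f => hirota d y k w f) hw'
  simp only [hirota_add_left, hirota_add_right, hirota_const_mul_left h12,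
    hirota_const_mul_right h12, hirota_const_mul_left hl, hirota_const_mul_right hl] at e1 e2
  rw [← hirota_cube hy]
  have key : 2 * (hirota d y k (u * (d w + y * w)) w' + hirota d y k w (u * (d w' - y * w'))) =
      2 * ∑ p ∈ antidiagonal k, (k.choose p.1 : A) * (d^[p.1] u *
        (if Even p.1 then d (hirota d y p.2 w w') else hirota d y (p.2 + 1) w w')) := by
    rw [hirota_mul_left, hirota_mul_right, ← Finset.sum_add_distrib, Finset.mul_sum,
      Finset.mul_sum]
    refine Finset.sum_congr rfl fun p _ => ?_
    have s1 := hirota_shift_left hy p.2 w w'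
    have s2 := hirota_shift_right hy p.2 w w'
    split_ifs with hp
    · rw [hp.neg_one_pow]
      linear_combination (k.choose p.1 : A) * d^[p.1] u * (s1 + s2)
    · rw [(Nat.not_even_iff_odd.1 hp).neg_one_pow]
      linear_combination (k.choose p.1 : A) * d^[p.1] u * (s1 - s2)
  rw [derivation_hirota hE hEy]
  simp only [hirota_add_left] at e1 e2 ⊢
  linear_combination 4 * e1 + 4 * e2 + 24 * key

/-- The flux identity for the square of a solution. -/
lemma square_flux (hl : d l = 0)
    (hu : 12 * (E u - u) = 12 * (u * d u) + l * d (d (d u))) :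
    12 * (E (u ^ 2) - 2 * u ^ 2) = d (8 * u ^ 3 + 2 * (l * (u * d (d u))) - l * (d u) ^ 2) := by
  have h8 : d (8 : A) = 0 := by simpa using d.map_natCast 8
  have h2 : d (2 : A) = 0 := by simpa using d.map_natCast 2
  simp only [map_sub, map_add, pow_succ, pow_zero, one_mul, Derivation.leibniz,
    smul_eq_mul, hl, h8, h2]
  linear_combination 2 * u * hu

end Bilinear

/-- Power series in the genus variable whose coefficients are functions on finite sets. -/
abbrev GenusSeries (ι B : Type) [DecidableEq ι] [CommRing B] : Type := PowerSeries (SetFun ι B)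

namespace GenusSeries

variable {ι B : Type} [DecidableEq ι] [CommRing B]

/-- The value of a genus series in genus `g` on the set `N`. -/
def val (f : GenusSeries ι B) (g : ℕ) (N : Finset ι) : B := (PowerSeries.coeff g f : SetFun ι B) N

lemma ext_val {f h : GenusSeries ι B} (H : ∀ g N, f.val g N = h.val g N) : f = h :=
  PowerSeries.ext fun g => SetFun.ext fun N => H g N

@[simp] lemma val_add (f h : GenusSeries ι B) (g : ℕ) (N : Finset ι) :
    (f + h).val g N = f.val g N + h.val g N := by simp [val]

@[simp] lemma val_sub (f h : GenusSeries ι B) (g : ℕ) (N : Finset ι) :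
    (f - h).val g N = f.val g N - h.val g N := by simp [val]

@[simp] lemma val_neg (f : GenusSeries ι B) (g : ℕ) (N : Finset ι) :
    (-f).val g N = -f.val g N := by simp [val]

@[simp] lemma val_zero (g : ℕ) (N : Finset ι) : (0 : GenusSeries ι B).val g N = 0 := by simp [val]

lemma val_mul (f h : GenusSeries ι B) (g : ℕ) (N : Finset ι) :
    (f * h).val g N =
      ∑ p ∈ antidiagonal g, ∑ I ∈ N.powerset, f.val p.1 I * h.val p.2 (N \ I) := by
  simp [val, PowerSeries.coeff_mul, SetFun.mul_apply]

lemma val_C_const_mul (c : B) (f : GenusSeries ι B) (g : ℕ) (N : Finset ι) :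
    val (PowerSeries.C (SetFun.const c) * f) g N = c * f.val g N := by
  rw [val, PowerSeries.coeff_C_mul, SetFun.const_mul_apply, val]

lemma natCast_eq (n : ℕ) :
    (n : GenusSeries ι B) = PowerSeries.C (SetFun.const (n : B)) := by simp

lemma val_natCast_mul (n : ℕ) (f : GenusSeries ι B) (g : ℕ) (N : Finset ι) :
    ((n : GenusSeries ι B) * f).val g N = n * f.val g N := by
  rw [natCast_eq, val_C_const_mul]

lemma val_ofNat_mul (n : ℕ) [n.AtLeastTwo] (f : GenusSeries ι B) (g : ℕ) (N : Finset ι) :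
    ((OfNat.ofNat n : GenusSeries ι B) * f).val g N = OfNat.ofNat n * f.val g N :=
  val_natCast_mul n f g N

@[simp] lemma val_X_mul_zero (f : GenusSeries ι B) (N : Finset ι) :
    val (PowerSeries.X * f) 0 N = 0 := by simp [val]

@[simp] lemma val_X_mul_succ (f : GenusSeries ι B) (g : ℕ) (N : Finset ι) :
    val (PowerSeries.X * f) (g + 1) N = f.val g N := by
  rw [val, PowerSeries.coeff_succ_X_mul, val]

@[simp] lemma val_C_zero (f : SetFun ι B) (N : Finset ι) :
    val (PowerSeries.C f) 0 N = f N := by simp [val]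

@[simp] lemma val_C_succ (f : SetFun ι B) (g : ℕ) (N : Finset ι) :
    val (PowerSeries.C f) (g + 1) N = 0 := by simp [val]

/-- The bottom value, as a ring homomorphism. -/
def bot : GenusSeries ι B →+* B where
  toFun f := f.val 0 ∅
  map_one' := by simp [val, SetFun.one_apply]
  map_zero' := by simp
  map_add' := by simp
  map_mul' f h := by simp [val_mul]

lemma bot_apply (f : GenusSeries ι B) : bot f = f.val 0 ∅ := rfl

variable [Algebra ℚ B]

/-- The derivation multiplying the value on `N` by `∑ i ∈ N, ω i`. -/
def wt (ω : ι → B) : Derivation ℚ (GenusSeries ι B) (GenusSeries ι B) :=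
  coeffDerivation (SetFun.weight ω)

@[simp] lemma val_wt (ω : ι → B) (f : GenusSeries ι B) (g : ℕ) (N : Finset ι) :
    (wt ω f).val g N = (∑ i ∈ N, ω i) * f.val g N := by simp [val, wt]

/-- The derivation multiplying the value in genus `g` on `N` by `|N| + 2 g`. -/
def deg : Derivation ℚ (GenusSeries ι B) (GenusSeries ι B) :=
  coeffDerivation (SetFun.weight 1) + (2 : ℕ) • eulerDerivation (SetFun ι B)

@[simp] lemma val_deg (f : GenusSeries ι B) (g : ℕ) (N : Finset ι) :
    (deg f).val g N = ((N.card + 2 * g : ℕ) : B) * f.val g N := by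
  simp only [val, deg, Derivation.add_apply, map_add, Derivation.smul_apply, map_nsmul,
    coeff_coeffDerivation, coeff_eulerDerivation, SetFun.add_apply, SetFun.nsmul_apply,
    SetFun.weight_apply, SetFun.natCast_mul_apply]
  simp
  ring

lemma deg_wt (ω : ι → B) (f : GenusSeries ι B) : deg (wt ω f) = wt ω (deg f) :=
  ext_val fun g N => by simp only [val_deg, val_wt]; ring

lemma bot_wt (ω : ι → B) (f : GenusSeries ι B) : bot (wt ω f) = 0 := by simp [bot_apply]

lemma wt_C_const (ω : ι → B) (c : B) : wt ω (PowerSeries.C (SetFun.const c)) = 0 :=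
  ext_val fun g N => by
    rw [val_wt]
    cases g with
    | zero =>
      by_cases h : N = ∅ <;> simp [SetFun.const_apply, h]
    | succ g => simp

lemma deg_C_const (c : B) : deg (PowerSeries.C (SetFun.const c) : GenusSeries ι B) = 0 :=
  ext_val fun g N => by
    rw [val_deg]
    cases g with
    | zero =>
      by_cases h : N = ∅ <;> simp [SetFun.const_apply, h]
    | succ g => simp

lemma wt_X (ω : ι → B) : wt ω PowerSeries.X = 0 := by
  have h := coeffDerivation_X_mul (SetFun.weight ω) (1 : GenusSeries ι B)
  rwa [mul_one, Derivation.map_one_eq_zero, mul_zero] at h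

end GenusSeries

section TopCoefficient

variable {S : Type} [CommRing S]

/-- `p` has degree at most `n`, and its coefficient of degree `n` is `t`. -/
def HasTopCoeff (n : ℕ) (p : Polynomial S) (t : S) : Prop := p.natDegree ≤ n ∧ p.coeff n = t

namespace HasTopCoeff

variable {n m : ℕ} {p q : Polynomial S} {s t : S}

lemma zero (n : ℕ) : HasTopCoeff n (0 : Polynomial S) 0 := ⟨by simp, by simp⟩

lemma C (s : S) : HasTopCoeff 0 (Polynomial.C s) s := ⟨by simp, by simp⟩

lemma add (hp : HasTopCoeff n p s) (hq : HasTopCoeff n q t) : HasTopCoeff n (p + q) (s + t) :=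
  ⟨Polynomial.natDegree_add_le_of_degree_le hp.1 hq.1, by rw [Polynomial.coeff_add, hp.2, hq.2]⟩

lemma mul (hp : HasTopCoeff n p s) (hq : HasTopCoeff m q t) : HasTopCoeff (n + m) (p * q) (s * t) :=
  ⟨Polynomial.natDegree_mul_le_of_le hp.1 hq.1,
    by rw [Polynomial.coeff_mul_add_eq_of_natDegree_le hp.1 hq.1, hp.2, hq.2]⟩

lemma C_mul (c : S) (hp : HasTopCoeff n p s) : HasTopCoeff n (Polynomial.C c * p) (c * s) := by
  simpa using (C c).mul hp

lemma natCast_mul (c : ℕ) (hp : HasTopCoeff n p s) : HasTopCoeff n ((c : Polynomial S) * p) ((c : S) * s) := by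
  simpa using hp.C_mul (c : S)

lemma sum {α : Type} {F : Finset α} {f : α → Polynomial S} {c : α → S}
    (h : ∀ a ∈ F, HasTopCoeff n (f a) (c a)) : HasTopCoeff n (∑ a ∈ F, f a) (∑ a ∈ F, c a) :=
  ⟨Polynomial.natDegree_sum_le_of_forall_le F f fun a ha => (h a ha).1,
    by rw [Polynomial.finsetSum_coeff]; exact Finset.sum_congr rfl fun a ha => (h a ha).2⟩

lemma weaken (hp : HasTopCoeff n p s) (h : n < m) : HasTopCoeff m p 0 :=
  ⟨hp.1.trans h.le, Polynomial.coeff_eq_zero_of_natDegree_lt (hp.1.trans_lt h)⟩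

lemma of_natCast_mul [Algebra ℚ S] {c : ℕ} (hc : c ≠ 0) (h : HasTopCoeff n ((c : Polynomial S) * p) ((c : S) * s)) :
    HasTopCoeff n p s := by
  have hc' : (algebraMap ℚ S (c : ℚ)⁻¹) * c = 1 := by
    rw [← map_natCast (algebraMap ℚ S), ← map_mul, inv_mul_cancel₀ (by exact_mod_cast hc), map_one]
  have hc'' : Polynomial.C (algebraMap ℚ S (c : ℚ)⁻¹) * (c : Polynomial S) = 1 := by
    rw [← map_natCast Polynomial.C, ← map_mul, hc', map_one]
  have := h.C_mul (algebraMap ℚ S (c : ℚ)⁻¹)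
  rwa [← mul_assoc, ← mul_assoc, hc', hc'', one_mul, one_mul] at this

lemma of_X_pow_mul {j : ℕ} (h : HasTopCoeff (n + j) (Polynomial.X ^ j * p) s) :
    HasTopCoeff n p s := by
  refine ⟨?_, by simpa [Polynomial.coeff_X_pow_mul] using h.2⟩
  rw [Polynomial.natDegree_le_iff_coeff_eq_zero]
  intro N hN
  have := Polynomial.coeff_eq_zero_of_natDegree_lt (h.1.trans_lt (Nat.add_lt_add_right hN j))
  rwa [Polynomial.coeff_X_pow_mul] at this

end HasTopCoeff

end TopCoefficient

namespace GenusSeries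

variable {ι S : Type} [DecidableEq ι] [CommRing S]

/-- In genus `g`, the values of `f` on small sets have degree at most `2 g + k`, with top
coefficient given by `m`. -/
def IsTop (W k : ℕ) (f : GenusSeries ι (Polynomial S)) (m : GenusSeries ι S) : Prop :=
  ∀ g N, N.card + 2 * g < W → HasTopCoeff (2 * g + k) (f.val g N) (m.val g N)

namespace IsTop

variable {W k j : ℕ} {f f' : GenusSeries ι (Polynomial S)} {m m' : GenusSeries ι S}

lemma add (h : IsTop W k f m) (h' : IsTop W k f' m') : IsTop W k (f + f') (m + m') :=
  fun g N hN => by simpa using (h g N hN).add (h' g N hN)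

lemma natCast_mul (c : ℕ) (h : IsTop W k f m) : IsTop W k ((c : GenusSeries ι (Polynomial S)) * f) ((c : GenusSeries ι S) * m) :=
  fun g N hN => by
    rw [val_natCast_mul, val_natCast_mul]
    exact (h g N hN).natCast_mul c

lemma neg (h : IsTop W k f m) : IsTop W k (-f) (-m) :=
  fun g N hN => by simpa using (h g N hN).C_mul (-1)

lemma sum {α : Type} {F : Finset α} {f : α → GenusSeries ι (Polynomial S)}
    {m : α → GenusSeries ι S} (h : ∀ a ∈ F, IsTop W k (f a) (m a)) :
    IsTop W k (∑ a ∈ F, f a) (∑ a ∈ F, m a) := by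
  classical
  induction F using Finset.induction_on with
  | empty => exact fun g N _ => by simpa using HasTopCoeff.zero _
  | insert a F ha ih =>
    rw [Finset.sum_insert ha, Finset.sum_insert ha]
    exact (h a (by simp)).add (ih fun b hb => h b (by simp [hb]))

lemma weaken (h : IsTop W k f m) (hk : k < j) : IsTop W j f 0 :=
  fun g N hN => by simpa using (h g N hN).weaken (m := 2 * g + j) (by omega)

lemma mono {W' : ℕ} (h : IsTop W k f m) (hW : W' ≤ W) : IsTop W' k f m :=
  fun g N hN => h g N (hN.trans_le hW)

lemma pos_mul (h : IsTop (W + 1) k f m) (hf : ∀ g, f.val g ∅ = 0) (hm : ∀ g, m.val g ∅ = 0)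
    (h' : IsTop W j f' m') : IsTop (W + 1) (k + j) (f * f') (m * m') := by
  intro g N hN
  rw [val_mul, val_mul]
  refine HasTopCoeff.sum fun p hp => HasTopCoeff.sum fun I hI => ?_
  have hp := Finset.HasAntidiagonal.mem_antidiagonal.1 hp
  rcases eq_or_ne I ∅ with rfl | hI0
  · rw [hf, hm, zero_mul, zero_mul]
    exact HasTopCoeff.zero _
  have h0 : 0 < I.card := Finset.card_pos.2 (Finset.nonempty_iff_ne_empty.2 hI0)
  have h1 := Finset.card_le_card (Finset.mem_powerset.1 hI)
  have h2 := Finset.card_sdiff_add_card_eq_card (Finset.mem_powerset.1 hI)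
  have := (h p.1 I (by omega)).mul (h' p.2 (N \ I) (by omega))
  rwa [show 2 * p.1 + k + (2 * p.2 + j) = 2 * g + (k + j) by omega] at this

lemma X_mul (h : IsTop W (k + 2) f m) :
    IsTop (W + 2) k (PowerSeries.X * f) (PowerSeries.X * m) := by
  intro g N hN
  cases g with
  | zero => simpa using HasTopCoeff.zero _
  | succ g =>
    rw [val_X_mul_succ, val_X_mul_succ, show 2 * (g + 1) + k = 2 * g + (k + 2) by ring]
    exact h g N (by omega)

lemma X_mul_weaken (h : IsTop W k f m) : IsTop (W + 2) k (PowerSeries.X * f) 0 := by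
  simpa using (h.weaken (j := k + 2) (by omega)).X_mul

variable [Algebra ℚ S]

lemma wt (ω : ι → S) (h : IsTop W k f m) :
    IsTop W k (GenusSeries.wt (fun i => Polynomial.C (ω i)) f) (GenusSeries.wt ω m) :=
  fun g N hN => by
    rw [val_wt, val_wt, ← map_sum]
    exact (h g N hN).C_mul _

lemma wt_iterate (ω : ι → S) (h : IsTop W k f m) (i : ℕ) :
    IsTop W k ((GenusSeries.wt (fun i => Polynomial.C (ω i)))^[i] f)
      ((GenusSeries.wt ω)^[i] m) := by
  induction i with
  | zero => exact h
  | succ i ih =>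
    rw [Function.iterate_succ_apply', Function.iterate_succ_apply']
    exact ih.wt ω

lemma of_deg_eq {a c : ℕ} (ha : a ≠ 0) {r : GenusSeries ι (Polynomial S)} {r' : GenusSeries ι S}
    (h : (a : GenusSeries ι (Polynomial S)) * (deg f + (c : GenusSeries ι (Polynomial S)) * f) = r)
    (h' : (a : GenusSeries ι S) * (deg m + (c : GenusSeries ι S) * m) = r') (hr : IsTop W k r r')
    (h0 : c = 0 → HasTopCoeff k (f.val 0 ∅) (m.val 0 ∅)) : IsTop W k f m := by
  intro g N hN
  by_cases hc : a * (N.card + 2 * g + c) = 0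
  · have hc' : N.card + 2 * g + c = 0 := (Nat.mul_eq_zero.1 hc).resolve_left ha
    obtain rfl : g = 0 := by omega
    obtain rfl : N = ∅ := Finset.card_eq_zero.1 (by omega)
    simpa using h0 (by omega)
  · have := hr g N hN
    rw [← h, ← h', val_natCast_mul, val_natCast_mul, val_add, val_add, val_natCast_mul,
      val_natCast_mul, val_deg, val_deg, ← add_mul, ← add_mul, ← Nat.cast_add, ← Nat.cast_add,
      ← mul_assoc, ← mul_assoc, ← Nat.cast_mul, ← Nat.cast_mul] at this
    exact this.of_natCast_mul hc

end IsTop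

end GenusSeries

lemma map_hirota {A B : Type} [CommRing A] [Algebra ℚ A] [CommRing B] {d : Derivation ℚ A A}
    {y : A} (β : A →+* B) (hβ : ∀ a, β (d a) = 0) (k : ℕ) (f g : A) :
    β (hirota d y k f g) = (2 * β y) ^ k * (β f * β g) := by
  induction k generalizing f g with
  | zero => simp [hirota_zero]
  | succ k ih =>
    rw [hirota_succ, map_sub, ih, ih, map_add, map_sub, hβ, hβ, map_mul, map_mul]
    ring

namespace GenusSeries

variable {ι S : Type} [DecidableEq ι] [CommRing S] [Algebra ℚ S]

lemma iterate_wt_val_empty {B : Type} [CommRing B] [Algebra ℚ B] (ω : ι → B)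
    {u : GenusSeries ι B} (hu : ∀ g, u.val g ∅ = 0) (i g : ℕ) : ((wt ω)^[i] u).val g ∅ = 0 := by
  cases i with
  | zero => exact hu g
  | succ i => rw [Function.iterate_succ_apply']; simp

lemma sum_antidiagonal_first_two {A : Type} [CommRing A] (k : ℕ) (v m m' : ℕ → A) :
    (∑ p ∈ antidiagonal k, (k.choose p.1 : A) *
        (v p.1 * (if p.1 = 0 then m p.2 else if p.1 = 1 then m' (p.2 + 1) else 0)))
      = v 0 * m k + k * (v 1 * m' k) := by
  rcases k with _ | _ | k
  · simp
  · simp [Finset.Nat.antidiagonal_succ]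
  · simp [Finset.Nat.sum_antidiagonal_succ]

variable {ω : ι → S} {u w w' : GenusSeries ι (Polynomial S)} {u₀ : GenusSeries ι S}
  {m : ℕ → GenusSeries ι S}

variable (ι S) in
/-- The spectral parameter. -/
def spectral : GenusSeries ι (Polynomial S) := PowerSeries.C (SetFun.const Polynomial.X)

omit [Algebra ℚ S] in
lemma bot_spectral : bot (spectral ι S) = Polynomial.X := by
  simp [bot_apply, spectral, SetFun.const_apply]

/-- The derivation with constant polynomial weights. -/
abbrev polyWt (ω : ι → S) :
    Derivation ℚ (GenusSeries ι (Polynomial S)) (GenusSeries ι (Polynomial S)) :=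
  wt fun i => Polynomial.C (ω i)

/-- The bilinear quantities with respect to the spectral parameter. -/
abbrev bil (ω : ι → S) (k : ℕ) (f g : GenusSeries ι (Polynomial S)) :
    GenusSeries ι (Polynomial S) :=
  hirota (polyWt ω) (spectral ι S) k f g

lemma isTop_bil
    (hu : ∀ W, IsTop W 0 u u₀) (hu_empty : ∀ g, u.val g ∅ = 0) (hu₀_empty : ∀ g, u₀.val g ∅ = 0)
    (h : ∀ k, 48 * deg (bil ω k w w') =
      48 * ∑ p ∈ antidiagonal k, (k.choose p.1 : GenusSeries ι (Polynomial S)) *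
        ((polyWt ω)^[p.1] u *
          (if Even p.1 then polyWt ω (bil ω p.2 w w') else bil ω (p.2 + 1) w w'))
      + PowerSeries.X * (polyWt ω (polyWt ω (polyWt ω (bil ω k w w')))
        + 3 * polyWt ω (bil ω (k + 2) w w')))
    (hw : bot w = 1) (hw' : bot w' = 1)
    (hm : ∀ k, 48 * deg (m k) =
      48 * (u₀ * wt ω (m k) + (k : GenusSeries ι S) * (wt ω u₀ * m k))
        + PowerSeries.X * (3 * wt ω (m (k + 2))))
    (hm0 : ∀ k, bot (m k) = 2 ^ k) (W k : ℕ) :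
    IsTop W k (bil ω k w w') (m k) := by
  induction W generalizing k with
  | zero => exact fun g N hN => absurd hN (Nat.not_lt_zero _)
  | succ W ih =>
    have hsum : IsTop (W + 1) k
        (∑ p ∈ antidiagonal k, (k.choose p.1 : GenusSeries ι (Polynomial S)) *
          ((polyWt ω)^[p.1] u *
          (if Even p.1 then polyWt ω (bil ω p.2 w w')
            else bil ω (p.2 + 1) w w')))
        (∑ p ∈ antidiagonal k, (k.choose p.1 : GenusSeries ι S) *
          ((wt ω)^[p.1] u₀ *
            (if p.1 = 0 then wt ω (m p.2) else if p.1 = 1 then m (p.2 + 1) else 0))) := by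
      refine IsTop.sum fun p hp => IsTop.natCast_mul _ ?_
      have hp := Finset.HasAntidiagonal.mem_antidiagonal.1 hp
      have := (((hu (W + 1)).wt_iterate ω p.1)).pos_mul (iterate_wt_val_empty _ hu_empty p.1)
        (iterate_wt_val_empty _ hu₀_empty p.1) (j := k) (W := W)
        (f' := if Even p.1 then polyWt ω (bil ω p.2 w w')
            else bil ω (p.2 + 1) w w')
        (m' := if p.1 = 0 then wt ω (m p.2) else if p.1 = 1 then m (p.2 + 1) else 0)
      rw [zero_add] at this
      apply this
      obtain ⟨i, j⟩ := p
      dsimp only at hp ⊢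
      rcases i with _ | _ | i
      · obtain rfl : j = k := by omega
        simpa using (ih j).wt ω
      · obtain rfl : j + 1 = k := by omega
        simpa using ih (j + 1)
      · rw [if_neg (by omega : ¬ i + 1 + 1 = 0), if_neg (by omega : ¬ i + 1 + 1 = 1)]
        split_ifs
        · exact ((ih j).wt ω).weaken (by omega)
        · exact (ih (j + 1)).weaken (by omega)
    rw [sum_antidiagonal_first_two k (fun i => (wt ω)^[i] u₀) (fun j => wt ω (m j)) m] at hsum
    have hX : IsTop (W + 1) k (PowerSeries.X * (polyWt ω
          (polyWt ω (polyWt ω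
            (bil ω k w w')))
        + 3 * polyWt ω
            (bil ω (k + 2) w w')))
        (PowerSeries.X * (3 * wt ω (m (k + 2)))) := by
      have h1 := ((((ih k).wt ω).wt ω).wt ω).X_mul_weaken
      have h2 := (((ih (k + 2)).wt ω).natCast_mul 3).X_mul
      have h3 := (h1.add h2).mono (W' := W + 1) (by omega)
      rw [zero_add] at h3
      rw [mul_add]
      exact h3
    refine IsTop.of_deg_eq (a := 48) (c := 0) (by norm_num)
      (r := _) (r' := _) ?_ ?_ ((hsum.natCast_mul 48).add hX) ?_
    · simpa using h k
    · simpa using hm k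
    · intro _
      have hb := map_hirota (d := polyWt ω) (y := spectral ι S) bot (bot_wt _) k w w'
      rw [← bot_apply, ← bot_apply, hm0, hb, hw, hw', bot_spectral]
      have : (2 * Polynomial.X) ^ k * (1 * 1) = Polynomial.C ((2 : S) ^ k) * Polynomial.X ^ k := by
        rw [map_pow, map_ofNat]; ring
      rw [this]
      refine ⟨Polynomial.natDegree_C_mul_X_pow_le _ _, ?_⟩
      rw [Polynomial.coeff_C_mul, Polynomial.coeff_X_pow, if_pos rfl, mul_one]


lemma isTop_of_bilinear {v v' η : GenusSeries ι (Polynomial S)} {n mη : GenusSeries ι S}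
    (hu : ∀ W, IsTop W 0 u u₀) (hu_empty : ∀ g, u.val g ∅ = 0) (hu₀_empty : ∀ g, u₀.val g ∅ = 0)
    (hw : 12 * deg w = 12 * (u * (spectral ι S * v)) + PowerSeries.X *
      (polyWt ω (polyWt ω (spectral ι S * v) + spectral ι S * (spectral ι S * v))
        + spectral ι S * (polyWt ω (spectral ι S * v) + spectral ι S * (spectral ι S * v))))
    (hv : spectral ι S * v = polyWt ω w + spectral ι S * w)
    (hw' : 12 * deg w' = 12 * (u * (-spectral ι S * v')) + PowerSeries.X *
      (polyWt ω (polyWt ω (-spectral ι S * v') - spectral ι S * (-spectral ι S * v'))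
        - spectral ι S * (polyWt ω (-spectral ι S * v') - spectral ι S * (-spectral ι S * v'))))
    (hv' : -spectral ι S * v' = polyWt ω w' - spectral ι S * w')
    (hbw : bot w = 1) (hbw' : bot w' = 1)
    (hη : 12 * (deg η + η) = 12 * (u * polyWt ω η) + 12 * (v * v')
      + PowerSeries.X * polyWt ω (polyWt ω (polyWt ω η)))
    (hm : ∀ k, 48 * deg (m k) =
      48 * (u₀ * wt ω (m k) + (k : GenusSeries ι S) * (wt ω u₀ * m k))
        + PowerSeries.X * (3 * wt ω (m (k + 2))))
    (hm0 : ∀ k, bot (m k) = 2 ^ k) (hn : m 2 = 4 * n)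
    (hmη : 12 * (deg mη + mη) = 12 * (u₀ * wt ω mη) + 12 * n) (W : ℕ) :
    IsTop W 0 η mη := by
  rw [hv] at hw
  rw [hv'] at hw'
  have hM := isTop_bil hu hu_empty hu₀_empty
    (derivation_hirota_of_lax (deg_wt _) (wt_C_const _ _) (deg_C_const _) (wt_X _) hw hw')
    hbw hbw' hm hm0
  have hvv : ∀ W, IsTop W 0 (v * v') n := by
    intro W g N hN
    have e : 4 * (spectral ι S * (spectral ι S * (v * v'))) =
        bil ω 2 w w' + -polyWt ω (polyWt ω (bil ω 0 w w')) := by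
      have : spectral ι S * (spectral ι S * (v * v')) =
          -((spectral ι S * v) * (-spectral ι S * v')) := by ring
      rw [this, hv, hv', d_hirota (wt_C_const _ _), map_add, d_hirota (wt_C_const _ _),
        d_hirota (wt_C_const _ _), bil, hirota_succ, hirota_succ, hirota_succ]
      simp only [hirota_zero]
      ring
    have t := ((hM W 2).add ((((hM W 0).wt ω).wt ω).weaken (j := 2) (by norm_num)).neg) g N hN
    rw [← e, neg_zero, add_zero, hn, val_ofNat_mul, val_ofNat_mul, spectral, val_C_const_mul,
      val_C_const_mul, ← mul_assoc Polynomial.X, ← pow_two] at t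
    exact (HasTopCoeff.of_natCast_mul (c := 4) (by norm_num) t).of_X_pow_mul (n := 2 * g + 0)
  induction W with
  | zero => exact fun g N hN => absurd hN (Nat.not_lt_zero _)
  | succ W ih =>
    have h1 := (hu (W + 1)).pos_mul hu_empty hu₀_empty (ih.wt ω)
    have h2 := (((ih.wt ω).wt ω).wt ω).X_mul_weaken.mono (W' := W + 1) (by omega)
    refine IsTop.of_deg_eq (a := 12) (c := 1) (by norm_num) (r := _) (r' := _) ?_ ?_
      (((h1.natCast_mul 12).add ((hvv (W + 1)).natCast_mul 12)).add h2) (by simp)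
    · simpa using hη
    · simpa using hmη

end GenusSeries

section Dispersionless

variable {A : Type} [CommRing A] [Algebra ℚ A] (d : Derivation ℚ A A) (p : A)

/-- The moments `I_{j+1}` of a solution of the dispersionless equation. -/
def moment : ℕ → A
  | 0 => 1 - p
  | j + 1 => p * d (moment j)

/-- The generating series of the moments. -/
def momentSeries : PowerSeries A :=
  1 - PowerSeries.mk fun j => ((Nat.doubleFactorial (2 * j + 1) : ℚ)⁻¹) • moment d p j

lemma coeff_momentSeries_zero : PowerSeries.coeff 0 (momentSeries d p) = p := by
  rw [momentSeries, map_sub, PowerSeries.coeff_mk]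
  simp [moment]

lemma coeff_momentSeries_succ (j : ℕ) : PowerSeries.coeff (j + 1) (momentSeries d p) =
    -(((Nat.doubleFactorial (2 * (j + 1) + 1) : ℚ)⁻¹) • moment d p (j + 1)) := by
  rw [momentSeries, map_sub, PowerSeries.coeff_mk]
  simp [PowerSeries.coeff_one]

/-- The inverse of the generating series of the moments, given the inverse of `p`. -/
def momentInv (q : Aˣ) : PowerSeries A := PowerSeries.invOfUnit (momentSeries d ↑q⁻¹) q⁻¹

variable {d} {E : Derivation ℚ A A} {u : A} {q : Aˣ}

lemma momentSeries_mul_momentInv (q : Aˣ) :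
    momentSeries d ↑q⁻¹ * momentInv d q = 1 := by
  refine PowerSeries.mul_invOfUnit _ _ ?_
  rw [← PowerSeries.coeff_zero_eq_constantCoeff_apply, coeff_momentSeries_zero]

section
variable (hE : ∀ a, E (d a) = d (E a)) (hu : E u = u + u * d u) (hq : (q : A) = 1 + d u)
include hE hu hq

lemma derivation_moment (j : ℕ) :
    E (moment d ↑q⁻¹ j) = moment d ↑q⁻¹ j + u * d (moment d ↑q⁻¹ j) := by
  have hpq : (↑q⁻¹ : A) * q = 1 := q.inv_mul
  have inv_der : ∀ D : Derivation ℚ A A, D (↑q⁻¹ : A) = -(↑q⁻¹ * ↑q⁻¹ * D (d u)) := by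
    intro D
    have h := congrArg D hpq
    rw [Derivation.leibniz, Derivation.map_one_eq_zero, hq, map_add, Derivation.map_one_eq_zero,
      zero_add, smul_eq_mul, smul_eq_mul, ← hq] at h
    linear_combination (↑q⁻¹ : A) * h - D (↑q⁻¹ : A) * hpq
  have hp : E (↑q⁻¹ : A) = ↑q⁻¹ - 1 + u * d (↑q⁻¹ : A) := by
    have h2 : E (d u) = d u + (d u * d u + u * d (d u)) := by
      rw [hE, hu, map_add, Derivation.leibniz]; simp only [smul_eq_mul]; ring
    rw [inv_der, inv_der, h2]
    have hdu : d u = q - 1 := by rw [hq]; ring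
    linear_combination (-(↑q⁻¹ * ↑q⁻¹ * (d u + q))) * hdu + ((↑q⁻¹ : A) - ↑q⁻¹ * q - 1) * hpq
  induction j with
  | zero =>
    rw [moment, map_sub, map_sub, hp, Derivation.map_one_eq_zero, Derivation.map_one_eq_zero]
    ring
  | succ j ih =>
    rw [moment, Derivation.leibniz, hE, ih, map_add, Derivation.leibniz, hp, Derivation.leibniz]
    simp only [smul_eq_mul]
    have hdu : d u = q - 1 := by rw [hq]; ring
    rw [hdu]
    linear_combination d (moment d ↑q⁻¹ j) * hpq

lemma derivation_momentSeries :
    coeffDerivation E (momentSeries d ↑q⁻¹) = momentSeries d ↑q⁻¹ - 1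
      + PowerSeries.C u * coeffDerivation d (momentSeries d ↑q⁻¹) := by
  have key : coeffDerivation E (1 - momentSeries d ↑q⁻¹) = (1 - momentSeries d ↑q⁻¹)
      + PowerSeries.C u * coeffDerivation d (1 - momentSeries d ↑q⁻¹) := by
    ext j
    rw [map_add, PowerSeries.coeff_C_mul, coeff_coeffDerivation, coeff_coeffDerivation,
      momentSeries, sub_sub_cancel, PowerSeries.coeff_mk, Derivation.map_smul,
      Derivation.map_smul,
      derivation_moment hE hu hq, smul_add, mul_smul_comm]
  rw [map_sub, map_sub, Derivation.map_one_eq_zero, Derivation.map_one_eq_zero] at key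
  linear_combination -key

end

lemma X_mul_derivation_momentSeries (q : Aˣ) :
    PowerSeries.X * coeffDerivation d (momentSeries d ↑q⁻¹) =
      PowerSeries.C (q : A) * (2 * eulerDerivation A (momentSeries d ↑q⁻¹)
        + momentSeries d ↑q⁻¹) - 1 := by
  have h2 : (2 : PowerSeries A) = PowerSeries.C 2 := (map_ofNat PowerSeries.C 2).symm
  ext j
  rw [map_sub, PowerSeries.coeff_C_mul, map_add, h2, PowerSeries.coeff_C_mul,
    coeff_eulerDerivation]
  cases j with
  | zero =>
    rw [coeff_momentSeries_zero]
    simp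
  | succ j =>
    rw [PowerSeries.coeff_succ_X_mul, coeff_coeffDerivation, coeff_momentSeries_succ, moment]
    have hd : d (PowerSeries.coeff j (momentSeries d ↑q⁻¹)) =
        -(((Nat.doubleFactorial (2 * j + 1) : ℚ)⁻¹) • d (moment d ↑q⁻¹ j)) := by
      cases j with
      | zero => simp [coeff_momentSeries_zero, moment]
      | succ j => rw [coeff_momentSeries_succ, map_neg, Derivation.map_smul]
    have hf : ((Nat.doubleFactorial (2 * j + 1) : ℚ)⁻¹) =
        (2 * (j + 1) + 1) * ((Nat.doubleFactorial (2 * (j + 1) + 1) : ℚ)⁻¹) := by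
      rw [show 2 * (j + 1) + 1 = 2 * j + 1 + 2 by ring, Nat.doubleFactorial_add_two]
      have : (Nat.doubleFactorial (2 * j + 1) : ℚ) ≠ 0 := by
        exact_mod_cast (Nat.doubleFactorial_pos _).ne'
      have h3 : (2 * (j + 1) + 1 : ℚ) ≠ 0 := by positivity
      push_cast
      field_simp
      ring
    rw [hd, hf, PowerSeries.coeff_one, if_neg (Nat.succ_ne_zero j)]
    have hpq : (q : A) * ↑q⁻¹ = 1 := q.mul_inv
    simp only [Algebra.smul_def, map_mul, map_add, map_natCast, map_ofNat, map_one]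
    push_cast
    linear_combination algebraMap ℚ A ((Nat.doubleFactorial (2 * (j + 1) + 1) : ℚ)⁻¹)
      * (2 * (j + 1) + 1) * d (moment d ↑q⁻¹ j) * hpq

lemma derivation_pow_of_mul_eq_one {B : Type} [CommRing B] [Algebra ℚ B] (D : Derivation ℚ B B)
    {f h : B} (hf : f * h = 1) (a : ℕ) : D (h ^ a) = -(a * (h ^ (a + 1) * D f)) := by
  have h1 : D h = -(h ^ 2 * D f) := by
    have := congrArg D hf
    rw [Derivation.leibniz, Derivation.map_one_eq_zero, smul_eq_mul, smul_eq_mul] at this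
    linear_combination h * this - D h * hf
  induction a with
  | zero => simp
  | succ a ih =>
    rw [pow_succ, Derivation.leibniz, ih, h1]
    simp only [smul_eq_mul]
    push_cast
    ring

variable (d) in
/-- The coefficient of genus `g` in the `a`-th power of the inverse moment series. -/
def momentCoeff (q : Aˣ) (a g : ℕ) : A := PowerSeries.coeff g (momentInv d q ^ a)

lemma derivation_momentCoeff (hE : ∀ a, E (d a) = d (E a)) (hu : E u = u + u * d u)
    (hq : (q : A) = 1 + d u) (a g : ℕ) :
    E (momentCoeff d q a g) = u * d (momentCoeff d q a g) - a * momentCoeff d q a g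
      + a * momentCoeff d q (a + 1) g := by
  have h1 := derivation_pow_of_mul_eq_one (coeffDerivation E)
    (momentSeries_mul_momentInv (d := d) q) a
  have h2 := derivation_pow_of_mul_eq_one (coeffDerivation d)
    (momentSeries_mul_momentInv (d := d) q) a
  have h3 : coeffDerivation E (momentInv d q ^ a) =
      PowerSeries.C u * coeffDerivation d (momentInv d q ^ a)
        - PowerSeries.C (a : A) * momentInv d q ^ a
        + PowerSeries.C (a : A) * momentInv d q ^ (a + 1) := by
    rw [h1, h2, derivation_momentSeries hE hu hq, map_natCast]
    linear_combination (-(a : PowerSeries A)) * momentInv d q ^ a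
      * momentSeries_mul_momentInv (d := d) q
  have := congrArg (PowerSeries.coeff g) h3
  simp only [map_add, map_sub, PowerSeries.coeff_C_mul, coeff_coeffDerivation] at this
  exact this

lemma d_momentCoeff (q : Aˣ) (a g : ℕ) :
    d (momentCoeff d q a g) = (2 * (g + 1) - a) * q * momentCoeff d q a (g + 1)
      + a * momentCoeff d q (a + 1) (g + 1) := by
  have h1 := derivation_pow_of_mul_eq_one (coeffDerivation d)
    (momentSeries_mul_momentInv (d := d) q) a
  have h2 := derivation_pow_of_mul_eq_one (eulerDerivation A)
    (momentSeries_mul_momentInv (d := d) q) a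
  have h3 : PowerSeries.X * coeffDerivation d (momentInv d q ^ a) =
      PowerSeries.C (2 * (q : A)) * eulerDerivation A (momentInv d q ^ a)
        - PowerSeries.C (a * (q : A)) * momentInv d q ^ a
        + PowerSeries.C (a : A) * momentInv d q ^ (a + 1) := by
    rw [h1, h2, map_natCast, map_mul, map_mul, map_natCast, map_ofNat]
    linear_combination (-(a : PowerSeries A)) * momentInv d q ^ (a + 1)
      * X_mul_derivation_momentSeries (d := d) q
      - (a : PowerSeries A) * PowerSeries.C (q : A) * momentInv d q ^ a
      * momentSeries_mul_momentInv (d := d) q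
  have := congrArg (PowerSeries.coeff (g + 1)) h3
  simp only [map_add, map_sub, PowerSeries.coeff_C_mul, coeff_coeffDerivation,
    PowerSeries.coeff_succ_X_mul, coeff_eulerDerivation] at this
  rw [momentCoeff, momentCoeff, momentCoeff, this]
  push_cast
  ring

lemma d_momentCoeff_zero (q : Aˣ) (a : ℕ) :
    (a : A) * q * momentCoeff d q a 0 = a * momentCoeff d q (a + 1) 0 := by
  have h0 : PowerSeries.constantCoeff (momentInv d q) = q := by
    rw [momentInv, PowerSeries.constantCoeff_invOfUnit, inv_inv]
  rw [momentCoeff, momentCoeff, PowerSeries.coeff_zero_eq_constantCoeff_apply,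
    PowerSeries.coeff_zero_eq_constantCoeff_apply, map_pow, map_pow, h0]
  ring

end Dispersionless

/-- The restriction of a derivation to a subalgebra that it preserves. -/
def Subalgebra.restrictDerivation {A : Type} [CommRing A] [Algebra ℚ A] (N : Subalgebra ℚ A)
    (D : Derivation ℚ A A) (h : ∀ a ∈ N, D a ∈ N) : Derivation ℚ N N :=
  Derivation.mk'
    { toFun := fun a => ⟨D a, h a a.2⟩
      map_add' := fun a b => Subtype.ext (by simp)
      map_smul' := fun c a => Subtype.ext (by simp) }
    (fun a b => Subtype.ext (by simp))

@[simp] lemma Subalgebra.coe_restrictDerivation {A : Type} [CommRing A] [Algebra ℚ A]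
    (N : Subalgebra ℚ A) (D : Derivation ℚ A A) (h : ∀ a ∈ N, D a ∈ N) (a : N) :
    (N.restrictDerivation D h a : A) = D a := rfl

namespace SetFun

variable {ι B : Type} [DecidableEq ι] [CommRing B]

/-- A series of set functions as a set function with values in series. -/
def ofSeries : PowerSeries (SetFun ι B) →+* SetFun ι (PowerSeries B) where
  toFun f N := PowerSeries.mk fun g => (PowerSeries.coeff g f : SetFun ι B) N
  map_one' := by
    ext N g
    rw [PowerSeries.coeff_mk, PowerSeries.coeff_one, one_apply]
    by_cases hg : g = 0 <;> by_cases hN : N = ∅ <;> simp [hg, hN, one_apply, PowerSeries.coeff_one]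
  map_zero' := by ext N g; simp
  map_add' f h := by
    ext N g
    change PowerSeries.coeff g (PowerSeries.mk fun g => (PowerSeries.coeff g (f + h) : SetFun ι B) N) =
      PowerSeries.coeff g ((PowerSeries.mk fun g => (PowerSeries.coeff g f : SetFun ι B) N) +
        PowerSeries.mk fun g => (PowerSeries.coeff g h : SetFun ι B) N)
    rw [map_add, PowerSeries.coeff_mk, PowerSeries.coeff_mk, PowerSeries.coeff_mk, map_add,
      add_apply]
  map_mul' f h := by
    ext N g
    change PowerSeries.coeff g (PowerSeries.mk fun g => (PowerSeries.coeff g (f * h) : SetFun ι B) N) =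
      PowerSeries.coeff g (∑ I ∈ N.powerset,
        (PowerSeries.mk fun g => (PowerSeries.coeff g f : SetFun ι B) I) *
          PowerSeries.mk fun g => (PowerSeries.coeff g h : SetFun ι B) (N \ I))
    rw [map_sum]
    simp only [PowerSeries.coeff_mul, PowerSeries.coeff_mk, sum_apply, mul_apply]
    rw [Finset.sum_comm]

@[simp] lemma coeff_ofSeries (f : PowerSeries (SetFun ι B)) (N : Finset ι) (g : ℕ) :
    PowerSeries.coeff g (ofSeries f N) = (PowerSeries.coeff g f : SetFun ι B) N :=
  PowerSeries.coeff_mk g fun g => (PowerSeries.coeff g f : SetFun ι B) N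

/-- The set function supported on singletons, with prescribed values. -/
def ofSingletons (β : ι → B) : SetFun ι B := fun N => if N.card = 1 then ∏ i ∈ N, β i else 0

lemma ofSingletons_mul_apply (β : ι → B) (f : SetFun ι B) (N : Finset ι) :
    (ofSingletons β * f) N = ∑ i ∈ N, β i * f (N \ {i}) := by
  rw [mul_apply]
  simp only [ofSingletons, ite_mul, zero_mul]
  rw [← Finset.sum_filter, ← Finset.powersetCard_eq_filter, Finset.powersetCard_one,
    Finset.sum_map]
  simp

/-- The powers of the inverse of `1 - ofSingletons β`. -/
def rising (β : ι → B) (a : ℕ) : SetFun ι B := fun N => (a.ascFactorial N.card : B) * ∏ i ∈ N, β i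

lemma rising_mul (β : ι → B) (a : ℕ) :
    (1 - ofSingletons β) * rising β (a + 1) = rising β a := by
  ext N
  rw [sub_mul, one_mul, sub_apply, ofSingletons_mul_apply]
  have h : ∀ i ∈ N, β i * rising β (a + 1) (N \ {i}) =
      ((a + 1).ascFactorial (N.card - 1) : B) * ∏ i ∈ N, β i := by
    intro i hi
    rw [rising, Finset.card_sdiff_of_subset (by simpa using hi), Finset.card_singleton,
      ← Finset.mul_prod_erase N β hi, Finset.sdiff_singleton_eq_erase]
    ring
  rw [Finset.sum_congr rfl h, Finset.sum_const, nsmul_eq_mul, rising, rising]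
  obtain h0 | ⟨c, hc⟩ : N.card = 0 ∨ ∃ c, N.card = c + 1 := by
    cases N.card <;> simp
  · simp [h0]
  · rw [hc, Nat.add_sub_cancel, Nat.ascFactorial_succ, Nat.ascFactorial_succ]
    have := congrArg (Nat.cast : ℕ → B) (Nat.succ_ascFactorial a c)
    push_cast at this ⊢
    linear_combination (∏ i ∈ N, β i) * this

lemma rising_zero (β : ι → B) : rising β 0 = 1 := by
  ext N
  rw [rising, one_apply]
  split_ifs with h
  · simp [h]
  · obtain ⟨c, hc⟩ := Nat.exists_eq_succ_of_ne_zero (Finset.card_pos.2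
      (Finset.nonempty_iff_ne_empty.2 h)).ne'
    simp [hc, Nat.zero_ascFactorial]

lemma pow_eq_rising {β : ι → B} {j : SetFun ι B} (h : (1 - ofSingletons β) * j = 1) (a : ℕ) :
    j ^ a = rising β a := by
  induction a with
  | zero => rw [pow_zero, rising_zero]
  | succ a ih =>
    rw [pow_succ, ih, ← rising_mul, mul_assoc, mul_comm (rising _ _), ← mul_assoc, h, one_mul]

lemma isNilpotent_of_apply_empty [Fintype ι] {f : SetFun ι B} (h : f ∅ = 0) : IsNilpotent f := by
  refine ⟨Fintype.card ι + 1, ?_⟩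
  have key : ∀ k N, N.card < k → (f ^ k) N = 0 := by
    intro k
    induction k with
    | zero => intro N hN; exact absurd hN (Nat.not_lt_zero _)
    | succ k ih =>
      intro N hN
      rw [pow_succ', mul_apply]
      refine Finset.sum_eq_zero fun I hI => ?_
      rcases eq_or_ne I ∅ with rfl | hI0
      · rw [h, zero_mul]
      · have h0 := Finset.card_pos.2 (Finset.nonempty_iff_ne_empty.2 hI0)
        have h2 := Finset.card_sdiff_add_card_eq_card (Finset.mem_powerset.1 hI)
        rw [ih _ (by omega), mul_zero]
  ext N
  exact key _ N (Nat.lt_succ_of_le (Finset.card_le_univ N))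

end SetFun

namespace SetFun

variable {ι : Type} [DecidableEq ι]

/-- The set functions whose value at `N` only involves the variables indexed by `N`. -/
def natural (ι : Type) [DecidableEq ι] : Subalgebra ℚ (SetFun ι (MvPolynomial ι ℚ)) where
  carrier := {f | ∀ N : Finset ι, f N ∈ MvPolynomial.supported ℚ (N : Set ι)}
  mul_mem' {f h} hf hh N := by
    rw [mul_apply]
    refine Subalgebra.sum_mem _ fun I hI => Subalgebra.mul_mem _ ?_ ?_
    · exact MvPolynomial.supported_mono (Finset.coe_subset.2 (Finset.mem_powerset.1 hI)) (hf I)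
    · exact MvPolynomial.supported_mono (Finset.coe_subset.2 Finset.sdiff_subset) (hh (N \ I))
  add_mem' {f h} hf hh N := Subalgebra.add_mem _ (hf N) (hh N)
  algebraMap_mem' c N := by
    rw [algebraMap_eq, const_apply]
    split_ifs
    · exact Subalgebra.algebraMap_mem _ c
    · exact Subalgebra.zero_mem _

lemma weight_X_mem_natural {f : SetFun ι (MvPolynomial ι ℚ)} (hf : f ∈ natural ι) :
    weight X f ∈ natural ι := fun N => by
  rw [weight_apply]
  refine Subalgebra.mul_mem _ (Subalgebra.sum_mem _ fun i hi => ?_) (hf N)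
  exact Algebra.subset_adjoin ⟨i, hi, rfl⟩

lemma weight_one_mem_natural {f : SetFun ι (MvPolynomial ι ℚ)} (hf : f ∈ natural ι) :
    weight (fun _ => 1) f ∈ natural ι := fun N => by
  rw [weight_apply]
  exact Subalgebra.mul_mem _ (Subalgebra.sum_mem _ fun i hi => Subalgebra.one_mem _) (hf N)

lemma coeff_filter_mul (d : ι →₀ ℕ) {I N : Finset ι} (hI : I ⊆ N) {p q : MvPolynomial ι ℚ}
    (hp : p ∈ MvPolynomial.supported ℚ (I : Set ι))
    (hq : q ∈ MvPolynomial.supported ℚ ((N \ I : Finset ι) : Set ι)) :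
    coeff (d.filter (· ∈ N)) (p * q) =
      coeff (d.filter (· ∈ I)) p * coeff (d.filter (· ∈ N \ I)) q := by
  have key : ∀ {J : Finset ι} {p : MvPolynomial ι ℚ}, p ∈ MvPolynomial.supported ℚ (J : Set ι) →
      ∀ a, coeff a p ≠ 0 → ∀ i, i ∉ J → a i = 0 := by
    intro J p hp a ha i hi
    by_contra h
    refine hi (MvPolynomial.mem_supported.1 hp ?_)
    exact Finset.mem_coe.2 ((MvPolynomial.mem_vars_iff_mem_support i).2
      ⟨a, MvPolynomial.mem_support_iff.2 ha, Finsupp.mem_support_iff.2 h⟩)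
  rw [MvPolynomial.coeff_mul]
  refine Finset.sum_eq_single_of_mem (d.filter (· ∈ I), d.filter (· ∈ N \ I)) ?_ ?_
  · rw [Finset.HasAntidiagonal.mem_antidiagonal]
    ext i
    have := @hI i
    by_cases h1 : i ∈ I <;> by_cases h2 : i ∈ N <;> simp_all
  · rintro ⟨a, b⟩ hab hne
    rw [Finset.HasAntidiagonal.mem_antidiagonal] at hab
    by_contra h
    have ha := key hp a (left_ne_zero_of_mul h)
    have hb := key hq b (right_ne_zero_of_mul h)
    refine hne (Prod.ext (Finsupp.ext fun i => ?_) (Finsupp.ext fun i => ?_))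
    all_goals
      have h1 := DFunLike.congr_fun hab i
      have h2 := ha i
      have h3 := hb i
      have h4 := @hI i
      clear key ha hb hab hne h hp hq hI
      by_cases h5 : i ∈ I <;> by_cases h6 : i ∈ N <;> simp_all

/-- The set function of coefficients of the monomials `∏ i ∈ N, X i ^ d i`. -/
def extract (d : ι →₀ ℕ) : natural ι →+* SetFun ι ℚ where
  toFun f N := coeff (d.filter (· ∈ N)) ((f : SetFun ι (MvPolynomial ι ℚ)) N)
  map_zero' := funext fun N => MvPolynomial.coeff_zero _
  map_add' f h := funext fun N => MvPolynomial.coeff_add _ _ _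
  map_one' := funext fun N => by
    change coeff (d.filter (· ∈ N)) ((1 : SetFun ι (MvPolynomial ι ℚ)) N) = (1 : SetFun ι ℚ) N
    rw [one_apply, one_apply]
    split_ifs with h
    · subst h
      have h0 : d.filter (· ∈ (∅ : Finset ι)) = 0 := by ext; simp
      rw [h0]
      simp
    · simp
  map_mul' f h := funext fun N => by
    change coeff (d.filter (· ∈ N)) (((f : SetFun ι (MvPolynomial ι ℚ)) * h) N) =
      ∑ I ∈ N.powerset, coeff (d.filter (· ∈ I)) ((f : SetFun ι (MvPolynomial ι ℚ)) I) *
        coeff (d.filter (· ∈ N \ I)) ((h : SetFun ι (MvPolynomial ι ℚ)) (N \ I))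
    rw [mul_apply, MvPolynomial.coeff_sum]
    exact Finset.sum_congr rfl fun I hI =>
      coeff_filter_mul d (Finset.mem_powerset.1 hI) (f.2 I) (h.2 _)

lemma extract_apply (d : ι →₀ ℕ) (f : natural ι) (N : Finset ι) :
    extract d f N = coeff (d.filter (· ∈ N)) ((f : SetFun ι (MvPolynomial ι ℚ)) N) := rfl

section Hopf

variable {u : SetFun ι (MvPolynomial ι ℚ)}

lemma weight_one_apply {B : Type} [CommRing B] [Algebra ℚ B] (f : SetFun ι B) (N : Finset ι) :
    weight (fun _ => 1) f N = N.card * f N := by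
  rw [weight_apply, Finset.sum_const, nsmul_eq_mul, mul_one]

lemma hopf_empty (hu : weight (fun _ => 1) u = u + u * weight X u) : u ∅ = 0 := by
  have h := congrFun hu ∅
  rw [weight_one_apply, add_apply, mul_apply] at h
  simpa using h.symm

lemma hopf_natural (hu : weight (fun _ => 1) u = u + u * weight X u) (h1 : ∀ i, u {i} = 1)
    (N : Finset ι) :
    u N ∈ MvPolynomial.supported ℚ (N : Set ι) ∧ (u N).totalDegree ≤ N.card - 1 := by
  induction N using Finset.strongInduction with
  | H N ih =>
    rcases lt_trichotomy N.card 1 with h | h | h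
    · rw [Finset.card_eq_zero.1 (Nat.lt_one_iff.1 h), hopf_empty hu]
      exact ⟨Subalgebra.zero_mem _, by simp⟩
    · obtain ⟨i, rfl⟩ := Finset.card_eq_one.1 h
      rw [h1]
      exact ⟨Subalgebra.one_mem _, by simp⟩
    · have hc : ((N.card : ℚ) - 1) ≠ 0 := by
        have : (1 : ℚ) < N.card := by exact_mod_cast h
        linarith
      have e := congrFun hu N
      rw [weight_one_apply, add_apply, mul_apply] at e
      have e2 : u N = ((N.card : ℚ) - 1)⁻¹ • ∑ I ∈ N.powerset, u I * weight X u (N \ I) := by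
        rw [eq_inv_smul_iff₀ hc, sub_smul, one_smul, Algebra.smul_def, map_natCast]
        linear_combination e
      have hI : ∀ I ∈ N.powerset, u I * weight X u (N \ I) ∈ MvPolynomial.supported ℚ (N : Set ι) ∧
          (u I * weight X u (N \ I)).totalDegree ≤ N.card - 1 := by
        intro I hI
        rw [Finset.mem_powerset] at hI
        rcases eq_or_ne I ∅ with rfl | hI0
        · rw [hopf_empty hu, zero_mul]
          exact ⟨Subalgebra.zero_mem _, by simp⟩
        rcases eq_or_ne I N with rfl | hIN
        · rw [weight_apply]
          simp only [sdiff_self, Finset.bot_eq_empty, Finset.sum_empty, zero_mul, mul_zero]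
          exact ⟨Subalgebra.zero_mem _, by simp⟩
        have hI1 : I ⊂ N := lt_of_le_of_ne hI hIN
        have hc0 := Finset.card_pos.2 (Finset.nonempty_iff_ne_empty.2 hI0)
        have hc1 := Finset.card_lt_card hI1
        have hc2 := Finset.card_sdiff_add_card_eq_card hI
        have hJ1 : N \ I ⊂ N := Finset.sdiff_ssubset hI (Finset.nonempty_iff_ne_empty.2 hI0)
        rw [weight_apply]
        constructor
        · refine Subalgebra.mul_mem _ (MvPolynomial.supported_mono (by simpa using hI) (ih I hI1).1)
            (Subalgebra.mul_mem _ (Subalgebra.sum_mem _ fun i hi => ?_)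
              (MvPolynomial.supported_mono (by simp) (ih _ hJ1).1))
          exact Algebra.subset_adjoin ⟨i, (Finset.mem_sdiff.1 hi).1, rfl⟩
        · have hs : (∑ i ∈ N \ I, X i : MvPolynomial ι ℚ).totalDegree ≤ 1 :=
            MvPolynomial.totalDegree_finsetSum_le fun i _ => (MvPolynomial.totalDegree_X i).le
          have t1 := MvPolynomial.totalDegree_mul (u I) ((∑ i ∈ N \ I, X i) * u (N \ I))
          have t2 := MvPolynomial.totalDegree_mul (∑ i ∈ N \ I, X i) (u (N \ I))
          have t3 := (ih I hI1).2
          have t4 := (ih _ hJ1).2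
          omega
      rw [e2]
      refine ⟨Subalgebra.smul_mem _ (Subalgebra.sum_mem _ fun I h => (hI I h).1) _,
        (MvPolynomial.totalDegree_smul_le _ _).trans
          (MvPolynomial.totalDegree_finsetSum_le fun I h => (hI I h).2)⟩

lemma extract_hopf (hu : weight (fun _ => 1) u = u + u * weight X u) (h1 : ∀ i, u {i} = 1)
    {d : ι →₀ ℕ} (hd : ∀ i, 1 ≤ d i) :
    extract d ⟨u, fun N => (hopf_natural hu h1 N).1⟩ = 0 := by
  ext N
  change coeff (d.filter (· ∈ N)) (u N) = 0
  rcases eq_or_ne N ∅ with rfl | hN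
  · rw [hopf_empty hu, MvPolynomial.coeff_zero]
  · refine MvPolynomial.coeff_eq_zero_of_totalDegree_lt ?_
    have hc := Finset.card_pos.2 (Finset.nonempty_iff_ne_empty.2 hN)
    have h2 : (d.filter (· ∈ N)).support = N := by
      ext i
      have := hd i
      simp
      omega
    have h3 : N.card ≤ ∑ i ∈ N, (d.filter (· ∈ N)) i := by
      rw [Finset.card_eq_sum_ones]
      refine Finset.sum_le_sum fun i hi => ?_
      rw [Finsupp.filter_apply_pos _ _ hi]
      exact hd i
    have h4 := (hopf_natural hu h1 N).2
    rw [h2]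
    omega

end Hopf

end SetFun

namespace SetFun

variable {ι : Type} [DecidableEq ι]

/-- The derivation `f N ↦ (∑ i ∈ N, X i) * f N` of natural set functions. -/
def naturalWeight (ι : Type) [DecidableEq ι] : Derivation ℚ (natural ι) (natural ι) :=
  (natural ι).restrictDerivation (weight X) fun _ => weight_X_mem_natural

/-- The derivation `f N ↦ |N| * f N` of natural set functions. -/
def naturalDegree (ι : Type) [DecidableEq ι] : Derivation ℚ (natural ι) (natural ι) :=
  (natural ι).restrictDerivation (weight fun _ => 1) fun _ => weight_one_mem_natural

lemma naturalDegree_naturalWeight (f : natural ι) :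
    naturalDegree ι (naturalWeight ι f) = naturalWeight ι (naturalDegree ι f) :=
  Subtype.ext (weight_comm _ _ _)

lemma extract_naturalDegree (d : ι →₀ ℕ) (f : natural ι) (N : Finset ι) :
    extract d (naturalDegree ι f) N = N.card * extract d f N := by
  change coeff _ (weight (fun _ => 1) (f : SetFun ι (MvPolynomial ι ℚ)) N) = _ * coeff _ _
  rw [weight_one_apply, ← nsmul_eq_mul, MvPolynomial.coeff_smul, nsmul_eq_mul]

variable {u : natural ι} {q : (natural ι)ˣ}
  (hu : naturalDegree ι u = u + u * naturalWeight ι u) (h1 : ∀ i, u.1 {i} = 1)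
  (hq : (q : natural ι) = 1 + naturalWeight ι u)
include hq

lemma inv_apply_empty : (↑q⁻¹ : natural ι).1 ∅ = 1 := by
  have h : ((↑q⁻¹ : natural ι).1 * (q : natural ι).1) ∅ = (1 : SetFun ι (MvPolynomial ι ℚ)) ∅ :=
    congrFun (congrArg Subtype.val q.inv_mul) ∅
  have h2 : (q : natural ι).1 = 1 + weight X u.1 := congrArg Subtype.val hq
  rw [mul_apply, h2, Finset.powerset_empty, Finset.sum_singleton] at h
  simpa [one_apply] using h

include h1 in
lemma moment_apply_singleton (j : ℕ) (i : ι) :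
    (moment (naturalWeight ι) ↑q⁻¹ j).1 {i} = X i ^ (j + 1) := by
  have hp := inv_apply_empty hq
  have hmul : ∀ f h : SetFun ι (MvPolynomial ι ℚ), (f * h) {i} = f ∅ * h {i} + f {i} * h ∅ := by
    intro f h
    rw [mul_apply, ← insert_empty_eq, Finset.sum_powerset_insert (by simp)]
    simp
  induction j with
  | zero =>
    have h : ((↑q⁻¹ : natural ι).1 * (q : natural ι).1) {i} =
        (1 : SetFun ι (MvPolynomial ι ℚ)) {i} :=
      congrFun (congrArg Subtype.val q.inv_mul) {i}
    have h2 : (q : natural ι).1 = 1 + weight X u.1 := congrArg Subtype.val hq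
    rw [hmul, h2, hp] at h
    change (1 - (↑q⁻¹ : natural ι).1) {i} = _
    simp [one_apply, h1] at h ⊢
    linear_combination -h
  | succ j ih =>
    change ((↑q⁻¹ : natural ι).1 * weight X (moment (naturalWeight ι) ↑q⁻¹ j).1) {i} = _
    rw [hmul, hp, weight_apply, weight_apply, ih]
    simp [pow_succ']

include hu

include h1 in
lemma extract_moment {d : ι →₀ ℕ} (hd : ∀ i, 1 ≤ d i) (j : ℕ) :
    extract d (moment (naturalWeight ι) ↑q⁻¹ j) =
      ofSingletons fun i => if d i = j + 1 then 1 else 0 := by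
  ext N
  rw [ofSingletons]
  split_ifs with hN
  · obtain ⟨i, rfl⟩ := Finset.card_eq_one.1 hN
    rw [extract_apply, moment_apply_singleton h1 hq, Finset.prod_singleton, X_pow_eq_monomial,
      coeff_monomial]
    refine if_congr ?_ rfl rfl
    rw [DFunLike.ext_iff]
    constructor
    · intro h
      simpa [eq_comm] using h i
    · intro h k
      by_cases hk : k = i
      · subst hk; simp [h]
      · simp [hk]
  · have hE := derivation_moment (E := naturalDegree ι) naturalDegree_naturalWeight hu hq j
    have h0 : extract d u = 0 :=
      extract_hopf (u := u.1) (congrArg Subtype.val hu) h1 hd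
    have h2 := congrFun (congrArg (extract d) hE) N
    rw [map_add, map_mul, h0, zero_mul, add_zero, extract_naturalDegree] at h2
    have h3 : ((N.card : ℚ) - 1) ≠ 0 := by
      rw [sub_ne_zero]
      exact_mod_cast hN
    refine (mul_eq_zero.1 ?_).resolve_left h3
    linear_combination h2

include h1 in
lemma extract_momentCoeff {d : ι →₀ ℕ} (hd : ∀ i, 1 ≤ d i) (a g : ℕ) (N : Finset ι) :
    extract d (momentCoeff (naturalWeight ι) q a g) N = PowerSeries.coeff g
      (rising (fun i => PowerSeries.monomial (d i - 1)
        ((Nat.doubleFactorial (2 * d i - 1) : ℚ)⁻¹)) a N) := by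
  set T : PowerSeries (natural ι) →+* SetFun ι (PowerSeries ℚ) :=
    ofSeries.comp (PowerSeries.map (extract d)) with hT
  have key : T (momentSeries (naturalWeight ι) ↑q⁻¹) = 1 - ofSingletons
      (fun i => PowerSeries.monomial (d i - 1) ((Nat.doubleFactorial (2 * d i - 1) : ℚ)⁻¹)) := by
    rw [momentSeries, map_sub, map_one]
    congr 1
    ext N k
    rw [hT, RingHom.comp_apply, coeff_ofSeries, PowerSeries.coeff_map, PowerSeries.coeff_mk,
      Algebra.smul_def, map_mul, extract_moment hu h1 hq hd, RingHom.map_rat_algebraMap,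
      ← Algebra.smul_def, smul_apply, ofSingletons, ofSingletons]
    split_ifs with hN
    · obtain ⟨i, rfl⟩ := Finset.card_eq_one.1 hN
      have := hd i
      rw [Finset.prod_singleton, Finset.prod_singleton, PowerSeries.coeff_monomial]
      by_cases hk : d i = k + 1
      · simp [hk, show 2 * (k + 1) - 1 = 2 * k + 1 by omega]
      · simp [hk, show ¬ k = d i - 1 by omega]
    · simp
  have hinv : (1 - ofSingletons (fun i => PowerSeries.monomial (d i - 1)
      ((Nat.doubleFactorial (2 * d i - 1) : ℚ)⁻¹))) * T (momentInv (naturalWeight ι) q) = 1 := by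
    rw [← key, ← map_mul, momentSeries_mul_momentInv, map_one]
  rw [← pow_eq_rising hinv, ← map_pow, hT, RingHom.comp_apply, coeff_ofSeries,
    PowerSeries.coeff_map]
  rfl

end SetFun

lemma coeff_rising_univ {ι : Type} [DecidableEq ι] [Fintype ι] (d : ι →₀ ℕ) (a g : ℕ)
    (hg : ∑ i, (d i - 1) = g) :
    PowerSeries.coeff g
      (SetFun.rising (fun i => PowerSeries.monomial (d i - 1)
        ((Nat.doubleFactorial (2 * d i - 1) : ℚ)⁻¹)) a univ) =
    a.ascFactorial (Fintype.card ι) * ∏ i, (Nat.doubleFactorial (2 * d i - 1) : ℚ)⁻¹ := by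
  have h : ∀ s : Finset ι, ∏ i ∈ s, PowerSeries.monomial (d i - 1)
      ((Nat.doubleFactorial (2 * d i - 1) : ℚ)⁻¹) = PowerSeries.monomial (∑ i ∈ s, (d i - 1))
        (∏ i ∈ s, (Nat.doubleFactorial (2 * d i - 1) : ℚ)⁻¹) := by
    intro s
    induction s using Finset.induction_on with
    | empty => simp
    | insert i s hi ih =>
      rw [Finset.prod_insert hi, Finset.prod_insert hi, Finset.sum_insert hi, ih,
        PowerSeries.monomial_mul_monomial]
  rw [SetFun.rising, h, hg, Finset.card_univ, ← nsmul_eq_mul, map_nsmul, nsmul_eq_mul,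
    PowerSeries.coeff_monomial_same]

/-- The leading coefficients attached to a solution of the dispersionless equation. -/
lemma exists_momentCoeff {ι : Type} [DecidableEq ι] [Fintype ι]
    {u : SetFun ι (MvPolynomial ι ℚ)}
    (hu : SetFun.weight (fun _ => 1) u = u + u * SetFun.weight X u) (h1 : ∀ i, u {i} = 1) :
    ∃ (q : SetFun ι (MvPolynomial ι ℚ)) (μ : ℕ → ℕ → SetFun ι (MvPolynomial ι ℚ)),
      (q = 1 + SetFun.weight X u) ∧
      (∀ a g : ℕ, SetFun.weight (fun _ => 1) (μ a g) = u * SetFun.weight X (μ a g)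
        - (a : SetFun ι (MvPolynomial ι ℚ)) * μ a g
        + (a : SetFun ι (MvPolynomial ι ℚ)) * μ (a + 1) g) ∧
      (∀ a g : ℕ, SetFun.weight X (μ a g) =
        (2 * ((g : SetFun ι (MvPolynomial ι ℚ)) + 1) - (a : SetFun ι (MvPolynomial ι ℚ)))
          * q * μ a (g + 1)
        + (a : SetFun ι (MvPolynomial ι ℚ)) * μ (a + 1) (g + 1)) ∧
      (∀ a : ℕ, (a : SetFun ι (MvPolynomial ι ℚ)) * q * μ a 0 =
        (a : SetFun ι (MvPolynomial ι ℚ)) * μ (a + 1) 0) ∧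
      (∀ a : ℕ, μ a 0 ∅ = 1) ∧
      (∀ (a g : ℕ) (d : ι →₀ ℕ), (∀ i, 1 ≤ d i) → ∑ i, (d i - 1) = g →
        coeff d (μ a g univ) = a.ascFactorial (Fintype.card ι) *
          ∏ i, (Nat.doubleFactorial (2 * d i - 1) : ℚ)⁻¹) := by
  set U : SetFun.natural ι := ⟨u, fun N => (SetFun.hopf_natural hu h1 N).1⟩ with hU
  have hU' : SetFun.naturalDegree ι U = U + U * SetFun.naturalWeight ι U := Subtype.ext hu
  have hnil : IsNilpotent (SetFun.naturalWeight ι U) := by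
    obtain ⟨k, hk⟩ := SetFun.isNilpotent_of_apply_empty (f := SetFun.weight X u) (by simp)
    exact ⟨k, Subtype.ext hk⟩
  obtain ⟨q, hq⟩ := hnil.isUnit_one_add
  refine ⟨(q : SetFun.natural ι).1, fun a g => (momentCoeff (SetFun.naturalWeight ι) q a g).1,
    congrArg Subtype.val hq, fun a g => ?_, fun a g => ?_, fun a => ?_, fun a => ?_,
    fun a g d hd hg => ?_⟩
  · have h := congrArg (SetFun.natural ι).val
      (derivation_momentCoeff (d := SetFun.naturalWeight ι) (E := SetFun.naturalDegree ι)
        SetFun.naturalDegree_naturalWeight hU' hq a g)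
    rw [map_add, map_sub, map_mul, map_mul, map_mul, map_natCast] at h
    exact h
  · have h := congrArg (SetFun.natural ι).val (d_momentCoeff (d := SetFun.naturalWeight ι) q a g)
    rw [map_add, map_mul, map_mul, map_mul, map_sub, map_mul, map_add, map_one, map_natCast,
      map_natCast, map_ofNat] at h
    exact h
  · have h := congrArg (SetFun.natural ι).val (d_momentCoeff_zero (d := SetFun.naturalWeight ι) q a)
    rw [map_mul, map_mul, map_mul, map_natCast] at h
    exact h
  · have hq0 : (q : SetFun.natural ι).1 ∅ = 1 := by
      have h2 : (q : SetFun.natural ι).1 = 1 + SetFun.weight X u := congrArg Subtype.val hq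
      rw [h2]
      simp [SetFun.one_apply]
    have hpow : ∀ k : ℕ, ((q : SetFun.natural ι).1 ^ k) ∅ = 1 := by
      intro k
      induction k with
      | zero => simp [SetFun.one_apply]
      | succ k ih => rw [pow_succ, SetFun.mul_apply, Finset.powerset_empty, Finset.sum_singleton]; simp [ih, hq0]
    have hm : momentCoeff (SetFun.naturalWeight ι) q a 0 = (q : SetFun.natural ι) ^ a := by
      rw [momentCoeff, PowerSeries.coeff_zero_eq_constantCoeff_apply, map_pow, momentInv,
        PowerSeries.constantCoeff_invOfUnit, inv_inv]
    change (momentCoeff (SetFun.naturalWeight ι) q a 0).1 ∅ = 1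
    rw [hm]
    exact hpow a
  · have h := SetFun.extract_momentCoeff hU' h1 hq hd a g univ
    rw [coeff_rising_univ d a g hg, SetFun.extract_apply] at h
    have hf : d.filter (· ∈ (univ : Finset ι)) = d := by ext; simp
    rwa [hf] at h

namespace GenusSeries

section Coeff

variable {ι B : Type} [DecidableEq ι] [CommRing B]

lemma coeff_natCast_mul (n : ℕ) (f : GenusSeries ι B) (g : ℕ) :
    PowerSeries.coeff g ((n : GenusSeries ι B) * f) = (n : SetFun ι B) * PowerSeries.coeff g f := by
  rw [← nsmul_eq_mul, map_nsmul, nsmul_eq_mul]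

lemma coeff_ofNat_mul (n : ℕ) [n.AtLeastTwo] (f : GenusSeries ι B) (g : ℕ) :
    PowerSeries.coeff g ((OfNat.ofNat n : GenusSeries ι B) * f) =
      (OfNat.ofNat n : SetFun ι B) * PowerSeries.coeff g f :=
  coeff_natCast_mul n f g

variable [Algebra ℚ B]

lemma coeff_deg (f : GenusSeries ι B) (g : ℕ) :
    PowerSeries.coeff g (deg f) = SetFun.weight (fun _ => 1) (PowerSeries.coeff g f)
      + 2 * ((g : SetFun ι B) * PowerSeries.coeff g f) := by
  change PowerSeries.coeff g (coeffDerivation (SetFun.weight fun _ => 1) f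
    + (2 : ℕ) • eulerDerivation (SetFun ι B) f) = _
  rw [map_add, coeff_coeffDerivation, map_nsmul, coeff_eulerDerivation, nsmul_eq_mul]
  rfl

lemma coeff_wt (ω : ι → B) (f : GenusSeries ι B) (g : ℕ) :
    PowerSeries.coeff g (wt ω f) = SetFun.weight ω (PowerSeries.coeff g f) :=
  coeff_coeffDerivation _ _ _

end Coeff

/-- The series of leading coefficients attached to a solution of the dispersionless equation. -/
lemma exists_topSeries {ι : Type} [DecidableEq ι] [Fintype ι]
    {u : SetFun ι (MvPolynomial ι ℚ)}
    (hu : SetFun.weight (fun _ => 1) u = u + u * SetFun.weight X u) (h1 : ∀ i, u {i} = 1) :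
    ∃ (m : ℕ → GenusSeries ι (MvPolynomial ι ℚ)) (n mη : GenusSeries ι (MvPolynomial ι ℚ)),
      (∀ k, 48 * deg (m k) =
        48 * (PowerSeries.C u * wt X (m k)
          + (k : GenusSeries ι (MvPolynomial ι ℚ)) * (wt X (PowerSeries.C u) * m k))
        + PowerSeries.X * (3 * wt X (m (k + 2)))) ∧
      (∀ k, bot (m k) = 2 ^ k) ∧ m 2 = 4 * n ∧
      12 * (deg mη + mη) = 12 * (PowerSeries.C u * wt X mη) + 12 * n ∧
      ∀ (g : ℕ) (d : ι →₀ ℕ), 1 ≤ g → (∀ i, 1 ≤ d i) → ∑ i, (d i - 1) = g - 1 →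
        ∃ p : MvPolynomial ι ℚ, mη.val g univ = (∑ i, X i) * p ∧
          coeff d p = ((2 * g).ascFactorial (Fintype.card ι) *
            ∏ i, (Nat.doubleFactorial (2 * d i - 1) : ℚ)⁻¹) / (4 ^ g * (2 * g * (2 * g + 1))) := by
  obtain ⟨q, μ, hq, hE, hd, hd0, hμ0, hμ⟩ := exists_momentCoeff hu h1
  refine ⟨fun k => PowerSeries.mk fun g => ((2 : ℚ) ^ k * ((4 : ℚ) ^ g)⁻¹) • μ (k + 2 * g) g,
    PowerSeries.mk fun g => ((4 : ℚ) ^ g)⁻¹ • μ (2 + 2 * g) g,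
    PowerSeries.mk fun g => (((4 : ℚ) ^ g)⁻¹ * (2 * (g : ℚ) + 1)⁻¹) • μ (2 * g + 1) g,
    fun k => ?_, fun k => ?_, ?_, ?_, fun g d hg hd1 hs => ?_⟩
  · refine PowerSeries.ext fun g => ?_
    rw [map_add, coeff_ofNat_mul, coeff_ofNat_mul, coeff_deg, map_add, PowerSeries.coeff_C_mul,
      coeff_natCast_mul, wt, coeffDerivation_C, PowerSeries.coeff_C_mul, coeff_coeffDerivation,
      PowerSeries.coeff_mk, Derivation.map_smul, Derivation.map_smul, hE]
    simp only [Algebra.smul_def]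
    cases g with
    | zero =>
      rw [PowerSeries.coeff_zero_X_mul]
      have h := hd0 k
      rw [hq] at h
      simp only [Nat.cast_zero, zero_mul, mul_zero, add_zero]
      linear_combination (-48 * algebraMap ℚ (SetFun ι (MvPolynomial ι ℚ)) ((2 : ℚ) ^ k * ((4 : ℚ) ^ 0)⁻¹)) * h
    | succ g =>
      rw [PowerSeries.coeff_succ_X_mul, coeff_ofNat_mul, coeff_coeffDerivation,
        PowerSeries.coeff_mk, ← Algebra.smul_def (_ : ℚ) (μ (k + 2 + 2 * g) g),
        Derivation.map_smul, show k + 2 + 2 * g = k + 2 * (g + 1) by ring]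
      simp only [Algebra.smul_def]
      have hc : algebraMap ℚ (SetFun ι (MvPolynomial ι ℚ)) ((2 : ℚ) ^ (k + 2) * ((4 : ℚ) ^ g)⁻¹) =
          16 * algebraMap ℚ (SetFun ι (MvPolynomial ι ℚ)) ((2 : ℚ) ^ k * ((4 : ℚ) ^ (g + 1))⁻¹) := by
        have h16 : (16 : SetFun ι (MvPolynomial ι ℚ)) = algebraMap ℚ _ 16 := (map_ofNat _ 16).symm
        rw [h16, ← map_mul]
        congr 1
        rw [pow_add, pow_succ (4 : ℚ)]
        field_simp
        norm_num
      have h := hd (k + 2 * (g + 1)) g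
      rw [hq] at h
      rw [hc]
      generalize algebraMap ℚ (SetFun ι (MvPolynomial ι ℚ)) ((2 : ℚ) ^ k * ((4 : ℚ) ^ (g + 1))⁻¹) = c
      push_cast at h ⊢
      linear_combination (-48 * c) * h
  · rw [bot_apply, val, PowerSeries.coeff_mk, SetFun.smul_apply, hμ0, Algebra.smul_def]
    simp [← map_ofNat (C : ℚ →+* MvPolynomial ι ℚ) 2]
  · refine PowerSeries.ext fun g => ?_
    rw [coeff_ofNat_mul, PowerSeries.coeff_mk, PowerSeries.coeff_mk]
    have h4 : (4 : SetFun ι (MvPolynomial ι ℚ)) = algebraMap ℚ _ 4 := (map_ofNat _ 4).symm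
    rw [h4, ← Algebra.smul_def, smul_smul]
    norm_num
  · refine PowerSeries.ext fun g => ?_
    rw [map_add, coeff_ofNat_mul, coeff_ofNat_mul, coeff_ofNat_mul, map_add, coeff_deg,
      PowerSeries.coeff_C_mul, coeff_wt,
      PowerSeries.coeff_mk, PowerSeries.coeff_mk, Derivation.map_smul, Derivation.map_smul, hE,
      show 2 * g + 1 + 1 = 2 + 2 * g by ring]
    simp only [Algebra.smul_def]
    have hc : algebraMap ℚ (SetFun ι (MvPolynomial ι ℚ)) ((4 : ℚ) ^ g)⁻¹ =
        algebraMap ℚ (SetFun ι (MvPolynomial ι ℚ)) (((4 : ℚ) ^ g)⁻¹ * (2 * (g : ℚ) + 1)⁻¹) *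
          (2 * (g : SetFun ι (MvPolynomial ι ℚ)) + 1) := by
      have h1 : (2 * (g : SetFun ι (MvPolynomial ι ℚ)) + 1) = algebraMap ℚ _ (2 * g + 1) := by
        rw [map_add, map_mul, map_natCast, map_ofNat, map_one]
      have h2 : (2 * (g : ℚ) + 1) ≠ 0 := by positivity
      rw [h1, ← map_mul]
      congr 1
      field_simp
    rw [hc]
    generalize algebraMap ℚ (SetFun ι (MvPolynomial ι ℚ)) _ = c
    push_cast
    ring
  · obtain ⟨g, rfl⟩ : ∃ k, g = k + 1 := ⟨g - 1, by omega⟩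
    rw [Nat.add_sub_cancel] at hs
    have hb := congrFun (hd (2 * (g + 1)) g) univ
    rw [show (2 * ((g : SetFun ι (MvPolynomial ι ℚ)) + 1) - ((2 * (g + 1) : ℕ) : SetFun ι _)) = 0 by
      push_cast; ring, zero_mul, zero_mul, zero_add, SetFun.natCast_mul_apply,
      SetFun.weight_apply] at hb
    refine ⟨(((4 : ℚ) ^ (g + 1))⁻¹ * (2 * ((g + 1 : ℕ) : ℚ) + 1)⁻¹ * (2 * ((g + 1 : ℕ) : ℚ))⁻¹) •
      μ (2 * (g + 1)) g univ, ?_, ?_⟩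
    · rw [val, PowerSeries.coeff_mk, SetFun.smul_apply, mul_smul_comm, hb, ← nsmul_eq_mul,
        ← Nat.cast_smul_eq_nsmul ℚ, smul_smul]
      congr 1
      have : ((2 * (g + 1 : ℕ) : ℕ) : ℚ) ≠ 0 := by positivity
      push_cast at this ⊢
      field_simp
    · rw [MvPolynomial.coeff_smul, hμ _ _ d hd1 hs, smul_eq_mul]
      push_cast
      field_simp

end GenusSeries

lemma Gf_eq_of_le (n : ℕ) : ∀ f f', n ≤ f → n ≤ f' → ∀ g, Gf f n g = Gf f' n g := by
  induction n using Nat.strong_induction_on with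
  | _ n ih =>
    match n with
    | 0 => intro f f' _ _ g; simp [Gf]
    | 1 => intro f f' _ _ g; cases g <;> simp [Gf]
    | n + 2 =>
      intro f f' hf hf' g
      obtain ⟨f, rfl⟩ : ∃ k, f = k + 1 := ⟨f - 1, by omega⟩
      obtain ⟨f', rfl⟩ : ∃ k, f' = k + 1 := ⟨f' - 1, by omega⟩
      rw [Gf, Gf]
      refine Finset.sum_congr rfl fun s _ => ?_
      congr 3
      refine Finset.sum_congr rfl fun I _ => ?_
      split_ifs with hI
      · have h1 : I.card < n + 2 := by
          simpa using Finset.card_lt_univ_of_notMem (s := I)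
            (not_forall.1 fun h => hI.2 (Finset.eq_univ_of_forall h)).choose_spec
        have h2 : Iᶜ.card < n + 2 := by
          have := Finset.card_pos.2 (Finset.nonempty_iff_ne_empty.2 hI.1)
          rw [Finset.card_compl, Fintype.card_fin]
          omega
        congr 1
        refine Finset.sum_congr rfl fun r _ => ?_
        rw [ih _ h1 f f' (by omega) (by omega), ih _ h2 f f' (by omega) (by omega)]
      · rfl

lemma Gnpt_eq_sum (n g : ℕ) : Gnpt (n + 2) g = ∑ s ∈ Finset.range (g + 1),
    (((Nat.doubleFactorial (2 * (g - s) + (n + 2) - 3) : ℚ) /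
      (4 ^ s * (Nat.doubleFactorial (2 * g + (n + 2) - 1) : ℚ))) : K (n + 2)) *
        Ppoly (n + 2) (g - s) * Dlt (n + 2) ^ s := by
  rw [Gnpt, Gf]
  refine Finset.sum_congr rfl fun s _ => ?_
  rw [Ppoly]
  congr 3
  refine Finset.sum_congr rfl fun I _ => ?_
  split_ifs with hI
  · have h1 : I.card < n + 2 := by
      simpa using Finset.card_lt_univ_of_notMem (s := I)
        (not_forall.1 fun h => hI.2 (Finset.eq_univ_of_forall h)).choose_spec
    have h2 : Iᶜ.card < n + 2 := by
      have := Finset.card_pos.2 (Finset.nonempty_iff_ne_empty.2 hI.1)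
      rw [Finset.card_compl, Fintype.card_fin]
      omega
    congr 1
    refine Finset.sum_congr rfl fun r _ => ?_
    rw [Gnpt, Gnpt, Gf_eq_of_le _ (n + 1) I.card (by omega) le_rfl,
      Gf_eq_of_le _ (n + 1) Iᶜ.card (by omega) le_rfl]
  · rfl

lemma doubleFactorial_pred (m : ℕ) :
    Nat.doubleFactorial (m + 1) = (m + 1) * Nat.doubleFactorial (m - 1) := by
  cases m <;> simp [Nat.doubleFactorial]

lemma Gnpt_recursion (n g : ℕ) : ((2 * g + n + 1 : ℕ) : K (n + 2)) * Gnpt (n + 2) g =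
    Ppoly (n + 2) g + if g = 0 then 0 else Dlt (n + 2) / 4 * Gnpt (n + 2) (g - 1) := by
  have hdf : ∀ m : ℕ, (Nat.doubleFactorial m : K (n + 2)) ≠ 0 := fun m =>
    Nat.cast_ne_zero.2 (Nat.doubleFactorial_pos m).ne'
  have h1 : Nat.doubleFactorial (2 * g + (n + 2) - 1) =
      (2 * g + n + 1) * Nat.doubleFactorial (2 * g + n - 1) :=
    doubleFactorial_pred (2 * g + n)
  have hc : ((2 * g + n + 1 : ℕ) : K (n + 2)) ≠ 0 := Nat.cast_ne_zero.2 (by omega)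
  rw [Gnpt_eq_sum, Finset.sum_range_succ', mul_add]
  refine (add_comm _ _).trans (congrArg₂ (· + ·) ?_ ?_)
  · rw [Nat.sub_zero, h1, show 2 * g + (n + 2) - 3 = 2 * g + n - 1 by omega]
    have := hdf (2 * g + n - 1)
    simp only [Rat.cast_natCast]
    rw [Nat.cast_mul]
    field_simp
  · cases g with
    | zero => simp
    | succ g =>
      rw [if_neg (Nat.succ_ne_zero _), Nat.add_sub_cancel, Gnpt_eq_sum, Finset.mul_sum,
        Finset.mul_sum]
      refine Finset.sum_congr rfl fun s _ => ?_
      rw [h1, show g + 1 - (s + 1) = g - s by omega,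
        show 2 * (g + 1) + n - 1 = 2 * g + (n + 2) - 1 by omega]
      have := hdf (2 * g + (n + 2) - 1)
      simp only [Rat.cast_natCast]
      rw [Nat.cast_mul]
      field_simp
      ring

/-- The field embedding induced by an order embedding of the variables. -/
def orderEmb {c n : ℕ} (ψ : Fin c ↪o Fin n) : K c →+* K n :=
  IsFractionRing.lift (g := (algebraMap (_root_.R n) (K n)).comp (MvPolynomial.rename ψ).toRingHom)
    ((IsFractionRing.injective (_root_.R n) (K n)).comp
      (MvPolynomial.rename_injective _ ψ.injective))

lemma orderEmb_algebraMap {c n : ℕ} (ψ : Fin c ↪o Fin n) (p : _root_.R c) :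
    orderEmb ψ (algebraMap (_root_.R c) (K c) p) =
      algebraMap (_root_.R n) (K n) (MvPolynomial.rename ψ p) :=
  IsFractionRing.lift_algebraMap _ _

lemma emb_algebraMap {n : ℕ} (I : Finset (Fin n)) (p : _root_.R I.card) :
    emb I (algebraMap (_root_.R I.card) (K I.card) p) =
      algebraMap (_root_.R n) (K n) (MvPolynomial.rename (I.orderEmbOfFin rfl) p) :=
  IsFractionRing.lift_algebraMap _ _

lemma emb_eq_orderEmb {n : ℕ} (I : Finset (Fin n)) : emb I = orderEmb (I.orderEmbOfFin rfl) := by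
  refine IsLocalization.ringHom_ext (nonZeroDivisors (_root_.R I.card)) (RingHom.ext fun p => ?_)
  rw [RingHom.comp_apply, RingHom.comp_apply, emb_algebraMap, orderEmb_algebraMap]

lemma orderEmb_orderEmb {a b c : ℕ} (φ : Fin a ↪o Fin b) (ψ : Fin b ↪o Fin c) (f : K a) :
    orderEmb ψ (orderEmb φ f) = orderEmb (φ.trans ψ) f := by
  suffices h : (orderEmb ψ).comp (orderEmb φ) = orderEmb (φ.trans ψ) from RingHom.congr_fun h f
  refine IsLocalization.ringHom_ext (nonZeroDivisors (_root_.R a)) (RingHom.ext fun p => ?_)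
  rw [RingHom.comp_apply, RingHom.comp_apply, RingHom.comp_apply, orderEmb_algebraMap,
    orderEmb_algebraMap, orderEmb_algebraMap, MvPolynomial.rename_rename]
  rfl

lemma orderEmb_eq_emb {c n : ℕ} (ψ : Fin c ↪o Fin n) (F : ∀ k, K k) {I : Finset (Fin n)}
    (hI : univ.map ψ.toEmbedding = I) : orderEmb ψ (F c) = emb I (F I.card) := by
  have hc : I.card = c := by rw [← hI, Finset.card_map, Finset.card_univ, Fintype.card_fin]
  subst hc
  have h : ψ = I.orderEmbOfFin rfl := Finset.orderEmbOfFin_unique' (s := I) rfl fun x =>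
    hI.subset (Finset.mem_map_of_mem ψ.toEmbedding (Finset.mem_univ x))
  rw [emb_eq_orderEmb, ← h]

lemma orderEmb_emb {n N : ℕ} (ψ : Fin n ↪o Fin N) (A : Finset (Fin n)) (F : ∀ k, K k) :
    orderEmb ψ (emb A (F A.card)) = emb (A.map ψ.toEmbedding) (F (A.map ψ.toEmbedding).card) := by
  rw [emb_eq_orderEmb A, orderEmb_orderEmb]
  refine orderEmb_eq_emb _ F ?_
  ext x
  simp only [Finset.mem_map, Finset.mem_univ, true_and]
  constructor
  · rintro ⟨y, rfl⟩
    exact ⟨A.orderEmbOfFin rfl y, Finset.orderEmbOfFin_mem A rfl y, rfl⟩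
  · rintro ⟨y, hy, rfl⟩
    have : y ∈ Set.range (A.orderEmbOfFin rfl) := by rwa [Finset.range_orderEmbOfFin]
    obtain ⟨z, rfl⟩ := this
    exact ⟨z, rfl⟩

lemma emb_emb {n : ℕ} (I : Finset (Fin n)) (A : Finset (Fin I.card)) (F : ∀ k, K k) :
    emb I (emb A (F A.card)) = emb (A.map (I.orderEmbOfFin rfl).toEmbedding)
      (F (A.map (I.orderEmbOfFin rfl).toEmbedding).card) := by
  rw [emb_eq_orderEmb I, orderEmb_emb]

lemma emb_univ {n : ℕ} (F : ∀ k, K k) :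
    emb (univ : Finset (Fin n)) (F (univ : Finset (Fin n)).card) = F n := by
  rw [← orderEmb_eq_emb (RelEmbedding.refl _) F (by ext; simp)]
  suffices h : orderEmb (RelEmbedding.refl _) = RingHom.id (K n) from RingHom.congr_fun h _
  refine IsLocalization.ringHom_ext (nonZeroDivisors (_root_.R n)) (RingHom.ext fun p => ?_)
  rw [RingHom.comp_apply, RingHom.comp_apply, orderEmb_algebraMap, RingHom.id_apply]
  congr 1
  exact MvPolynomial.rename_id_apply p

/-- The sum of the variables indexed by `I`, as a rational function. -/
def varSum {n : ℕ} (I : Finset (Fin n)) : K n := algebraMap (_root_.R n) (K n) (∑ i ∈ I, X i)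

/-- The sum of the cubes of the variables indexed by `I`, as a rational function. -/
def cubeSum {n : ℕ} (I : Finset (Fin n)) : K n := algebraMap (_root_.R n) (K n) (∑ i ∈ I, X i ^ 3)

lemma varSum_empty {n : ℕ} : varSum (∅ : Finset (Fin n)) = 0 := by simp [varSum]

lemma orderEmb_varSum {n N : ℕ} (ψ : Fin n ↪o Fin N) (A : Finset (Fin n)) :
    orderEmb ψ (varSum A) = varSum (A.map ψ.toEmbedding) := by
  rw [varSum, varSum, orderEmb_algebraMap, map_sum, Finset.sum_map]
  simp

lemma emb_varSum {n : ℕ} (I : Finset (Fin n)) (A : Finset (Fin I.card)) :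
    emb I (varSum A) = varSum (A.map (I.orderEmbOfFin rfl).toEmbedding) := by
  rw [emb_eq_orderEmb, orderEmb_varSum]

lemma emb_SX {n : ℕ} (I : Finset (Fin n)) : emb I (SX I.card) = varSum I := by
  have h := emb_varSum I univ
  rwa [Finset.map_orderEmbOfFin_univ I rfl] at h

lemma emb_SX3 {n : ℕ} (I : Finset (Fin n)) : emb I (SX3 I.card) = cubeSum I := by
  have h : cubeSum I = cubeSum (univ.map (I.orderEmbOfFin rfl).toEmbedding) := by
    rw [Finset.map_orderEmbOfFin_univ I rfl]
  rw [h, SX3, cubeSum, emb_algebraMap, map_sum, Finset.sum_map]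
  simp

lemma varSum_ne_zero {n : ℕ} {I : Finset (Fin n)} (hI : I.Nonempty) : varSum I ≠ 0 := by
  rw [varSum, Ne, map_eq_zero_iff _ (IsFractionRing.injective (_root_.R n) (K n))]
  intro h
  obtain ⟨i, hi⟩ := hI
  have := congrArg (coeff (Finsupp.single i 1)) h
  classical
  rw [MvPolynomial.coeff_sum] at this
  simp [MvPolynomial.coeff_X, Finsupp.single_left_inj, hi] at this

lemma Gnpt_zero_left (g : ℕ) : Gnpt 0 g = 0 := by simp [Gnpt, Gf]

lemma Gnpt_one_succ (g : ℕ) : Gnpt 1 (g + 1) = 0 := rfl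

lemma Ppoly_sum (c g : ℕ) : (∑ A : Finset (Fin c),
      if A ≠ ∅ ∧ A ≠ univ then
        (algebraMap (_root_.R c) (K c) (∑ i ∈ A, X i))^2 *
        (algebraMap (_root_.R c) (K c) (∑ i ∈ Aᶜ, X i))^2 *
        ∑ r' ∈ Finset.range (g+1), emb A (Gnpt A.card r') * emb Aᶜ (Gnpt Aᶜ.card (g - r'))
      else 0) =
    ∑ A : Finset (Fin c), varSum A ^ 2 * varSum Aᶜ ^ 2 *
      ∑ p ∈ antidiagonal g, emb A (Gnpt A.card p.1) * emb Aᶜ (Gnpt Aᶜ.card p.2) := by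
  refine Finset.sum_congr rfl fun A _ => ?_
  rw [Finset.Nat.sum_antidiagonal_eq_sum_range_succ
    (fun i j => emb A (Gnpt A.card i) * emb Aᶜ (Gnpt Aᶜ.card j))]
  split_ifs with h
  · rfl
  · by_cases h0 : A = ∅
    · subst h0
      rw [varSum_empty]
      simp
    · obtain rfl : A = univ := by
        by_contra h1
        exact h ⟨h0, h1⟩
      rw [Finset.compl_univ, varSum_empty]
      simp

lemma SX_ne_zero (n : ℕ) : SX (n + 1) ≠ 0 :=
  varSum_ne_zero (n := n + 1) (I := univ) Finset.univ_nonempty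

lemma SX_mul_Gnpt (c g : ℕ) :
    2 * SX c * (((2 * g + c : ℕ) : K c) * Gnpt c g - Gnpt c g) =
      (∑ A : Finset (Fin c), varSum A ^ 2 * varSum Aᶜ ^ 2 *
        ∑ p ∈ antidiagonal g, emb A (Gnpt A.card p.1) * emb Aᶜ (Gnpt Aᶜ.card p.2)) +
      if g = 0 then 0 else SX c * Dlt c / 2 * Gnpt c (g - 1) := by
  match c with
  | 0 =>
    have h : ∀ A : Finset (Fin 0), varSum A = 0 := fun A => by
      rw [Subsingleton.elim A ∅, varSum_empty]
    simp [h, Gnpt_zero_left]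
  | 1 =>
    have h : ∀ A : Finset (Fin 1), varSum A ^ 2 * varSum Aᶜ ^ 2 = 0 := fun A => by
      by_cases h0 : A = ∅
      · rw [h0, varSum_empty]
        simp
      · obtain rfl : A = univ := by
          obtain ⟨i, hi⟩ := Finset.nonempty_iff_ne_empty.2 h0
          ext j
          exact ⟨fun _ => Finset.mem_univ j, fun _ => Subsingleton.elim i j ▸ hi⟩
        rw [Finset.compl_univ, varSum_empty]
        simp
    have hD : Dlt 1 = 0 := by simp [Dlt, SX, SX3]
    rw [Finset.sum_eq_zero fun A _ => by rw [h A, zero_mul], hD]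
    cases g with
    | zero => simp
    | succ g => simp [Gnpt_one_succ]
  | c + 2 =>
    have h := Gnpt_recursion c g
    rw [Ppoly, Ppoly_sum] at h
    have hS := SX_ne_zero (c + 1)
    have h2 : ((2 * g + (c + 2) : ℕ) : K (c + 2)) * Gnpt (c + 2) g - Gnpt (c + 2) g =
        ((2 * g + c + 1 : ℕ) : K (c + 2)) * Gnpt (c + 2) g := by
      push_cast
      ring
    rw [h2, h, mul_add, mul_inv_cancel_left₀ (mul_ne_zero two_ne_zero hS)]
    congr 1
    split_ifs
    · simp
    · ring

lemma sum_map_powerset {n : ℕ} {M : Type} [AddCommMonoid M] (I : Finset (Fin n))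
    (f : Finset (Fin n) → Finset (Fin n) → M) :
    (∑ A : Finset (Fin I.card), f (A.map (I.orderEmbOfFin rfl).toEmbedding)
      (Aᶜ.map (I.orderEmbOfFin rfl).toEmbedding)) = ∑ B ∈ I.powerset, f B (I \ B) := by
  refine Finset.sum_nbij (fun A => A.map (I.orderEmbOfFin rfl).toEmbedding) ?_ ?_ ?_ ?_
  · intro A _
    rw [Finset.mem_powerset]
    conv_rhs => rw [← Finset.map_orderEmbOfFin_univ I rfl]
    exact Finset.map_subset_map.2 (Finset.subset_univ A)
  · exact (Finset.map_injective _).injOn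
  · intro B hB
    have hB' : B ⊆ univ.map (I.orderEmbOfFin rfl).toEmbedding := by
      rw [Finset.map_orderEmbOfFin_univ I rfl]
      exact Finset.mem_powerset.1 hB
    obtain ⟨A, _, rfl⟩ := Finset.subset_map_iff.1 hB'
    exact ⟨A, Finset.mem_coe.2 (Finset.mem_univ A), rfl⟩
  · intro A _
    rw [Finset.compl_eq_univ_sdiff, Finset.map_sdiff, Finset.map_orderEmbOfFin_univ I rfl]

lemma varSum_mul_emb_Gnpt {n : ℕ} (I : Finset (Fin n)) (g : ℕ) :
    12 * varSum I * (((2 * g + I.card : ℕ) : K n) * emb I (Gnpt I.card g) -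
        emb I (Gnpt I.card g)) =
      6 * (∑ B ∈ I.powerset, varSum B ^ 2 * varSum (I \ B) ^ 2 *
        ∑ p ∈ antidiagonal g, emb B (Gnpt B.card p.1) * emb (I \ B) (Gnpt (I \ B).card p.2)) +
      if g = 0 then 0 else
        varSum I * (varSum I ^ 3 - cubeSum I) * emb I (Gnpt I.card (g - 1)) := by
  have he : ∀ A r, emb I (emb A (Gnpt A.card r)) = emb (A.map (I.orderEmbOfFin rfl).toEmbedding)
      (Gnpt (A.map (I.orderEmbOfFin rfl).toEmbedding).card r) :=
    fun A r => emb_emb I A fun k => Gnpt k r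
  have h := congrArg (emb I) (SX_mul_Gnpt I.card g)
  simp only [map_mul, map_sub, map_add, map_natCast, map_ofNat, emb_SX, map_sum, map_pow,
    emb_varSum, he, apply_ite (emb I), map_zero, map_div₀, Dlt,
    emb_SX3] at h
  rw [sum_map_powerset I fun A B => varSum A ^ 2 * varSum B ^ 2 *
    ∑ p ∈ antidiagonal g, emb A (Gnpt A.card p.1) * emb B (Gnpt B.card p.2)] at h
  rw [show 12 * varSum I * (((2 * g + I.card : ℕ) : K n) * emb I (Gnpt I.card g) -
        emb I (Gnpt I.card g)) = 6 * (2 * varSum I * (((2 * g + I.card : ℕ) : K n) *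
          emb I (Gnpt I.card g) - emb I (Gnpt I.card g))) by ring, h, mul_add]
  congr 1
  split_ifs
  · simp
  · ring

lemma eulerDerivation_mul {A : Type} [CommRing A] [Algebra ℚ A] (f h : PowerSeries A) :
    eulerDerivation A (f * h) = f * eulerDerivation A h + h * eulerDerivation A f :=
  (eulerDerivation A).leibniz f h

/-- The generating series of the normalized functions `G_g(x_I)` in the genus. -/
def normalizedSeries {n : ℕ} (I : Finset (Fin n)) : PowerSeries (K n) :=
  PowerSeries.mk fun g => emb I (Gnpt I.card g)

/-- The series `exp (λ ∑ x_i ^ 3 / 24)`. -/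
def cubeExp {n : ℕ} (I : Finset (Fin n)) : PowerSeries (K n) :=
  PowerSeries.rescale (cubeSum I / 24) (PowerSeries.exp (K n))

lemma cubeExp_mul {n : ℕ} {I B : Finset (Fin n)} (hB : B ⊆ I) :
    cubeExp I = cubeExp B * cubeExp (I \ B) := by
  rw [cubeExp, cubeExp, cubeExp, PowerSeries.exp_mul_exp_eq_exp_add, ← add_div, cubeSum, cubeSum,
    cubeSum, ← map_add, add_comm, Finset.sum_sdiff hB]

lemma eulerDerivation_cubeExp {n : ℕ} (I : Finset (Fin n)) : eulerDerivation (K n) (cubeExp I) =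
    PowerSeries.X * (PowerSeries.C (cubeSum I / 24) * cubeExp I) := by
  ext g
  rw [coeff_eulerDerivation]
  cases g with
  | zero => simp
  | succ g =>
    rw [PowerSeries.coeff_succ_X_mul, PowerSeries.coeff_C_mul, cubeExp, PowerSeries.coeff_rescale,
      PowerSeries.coeff_rescale, PowerSeries.coeff_exp, PowerSeries.coeff_exp, Nat.factorial_succ]
    simp only [map_div₀, map_one, map_natCast]
    have h1 : ((g + 1 : ℕ) : K n) ≠ 0 := Nat.cast_ne_zero.2 g.succ_ne_zero
    have h2 : (g.factorial : K n) ≠ 0 := Nat.cast_ne_zero.2 g.factorial_ne_zero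
    rw [Nat.cast_mul, pow_succ]
    field_simp

/-- The generating series of the functions `F_g(x_I)` in the genus. -/
def pointSeries {n : ℕ} (I : Finset (Fin n)) : PowerSeries (K n) :=
  cubeExp I * normalizedSeries I

lemma coeff_pointSeries {n : ℕ} (I : Finset (Fin n)) (g : ℕ) :
    PowerSeries.coeff g (pointSeries I) = emb I (Fnpt I.card g) := by
  rw [pointSeries, PowerSeries.coeff_mul, Finset.Nat.sum_antidiagonal_eq_sum_range_succ
    (fun i j => PowerSeries.coeff i (cubeExp I) * PowerSeries.coeff j (normalizedSeries I)),
    Fnpt, map_sum]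
  refine Finset.sum_congr rfl fun d _ => ?_
  rw [cubeExp, PowerSeries.coeff_rescale, PowerSeries.coeff_exp, normalizedSeries,
    PowerSeries.coeff_mk, map_mul, map_mul, map_pow, map_div₀, map_div₀ _ (SX3 _), emb_SX3, map_ofNat (emb I) 24, map_one,
    div_pow]
  simp only [map_div₀, map_one, map_natCast, Rat.cast_natCast]
  ring

lemma varSum_mul_normalizedSeries {n : ℕ} (I : Finset (Fin n)) :
    PowerSeries.C (12 * varSum I) * (2 * eulerDerivation (K n) (normalizedSeries I) +
        (I.card : PowerSeries (K n)) * normalizedSeries I - normalizedSeries I) =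
      6 * (∑ B ∈ I.powerset, PowerSeries.C (varSum B ^ 2 * varSum (I \ B) ^ 2) *
        (normalizedSeries B * normalizedSeries (I \ B))) +
      PowerSeries.X * (PowerSeries.C (varSum I * (varSum I ^ 3 - cubeSum I)) *
        normalizedSeries I) := by
  ext g
  have h := varSum_mul_emb_Gnpt I g
  have h2 : (2 : PowerSeries (K n)) = PowerSeries.C 2 := (map_ofNat _ 2).symm
  have h6 : (6 : PowerSeries (K n)) = PowerSeries.C 6 := (map_ofNat _ 6).symm
  have hc : (I.card : PowerSeries (K n)) = PowerSeries.C (I.card : K n) := (map_natCast _ _).symm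
  rw [h2, h6, hc]
  simp only [map_add, map_sub, PowerSeries.coeff_C_mul, coeff_eulerDerivation, map_sum,
    PowerSeries.coeff_mul g (normalizedSeries _)]
  have hX : PowerSeries.coeff g (PowerSeries.X * (PowerSeries.C (varSum I *
      (varSum I ^ 3 - cubeSum I)) * normalizedSeries I)) = if g = 0 then 0 else
        varSum I * (varSum I ^ 3 - cubeSum I) * emb I (Gnpt I.card (g - 1)) := by
    cases g with
    | zero => simp
    | succ g =>
      rw [PowerSeries.coeff_succ_X_mul, PowerSeries.coeff_C_mul, normalizedSeries,
        PowerSeries.coeff_mk, if_neg g.succ_ne_zero, Nat.add_sub_cancel]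
  rw [hX]
  simp only [normalizedSeries, PowerSeries.coeff_mk]
  rw [← h]
  push_cast
  ring

lemma varSum_mul_pointSeries {n : ℕ} (I : Finset (Fin n)) :
    PowerSeries.C (12 * varSum I) * (2 * eulerDerivation (K n) (pointSeries I) +
        (I.card : PowerSeries (K n)) * pointSeries I - pointSeries I) =
      6 * (∑ B ∈ I.powerset, PowerSeries.C (varSum B ^ 2 * varSum (I \ B) ^ 2) *
        (pointSeries B * pointSeries (I \ B))) +
      PowerSeries.X * (PowerSeries.C (varSum I ^ 4) * pointSeries I) := by
  have h := congrArg (cubeExp I * ·) (varSum_mul_normalizedSeries I)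
  have hs : (∑ B ∈ I.powerset, PowerSeries.C (varSum B ^ 2 * varSum (I \ B) ^ 2) *
        (pointSeries B * pointSeries (I \ B))) = cubeExp I *
      ∑ B ∈ I.powerset, PowerSeries.C (varSum B ^ 2 * varSum (I \ B) ^ 2) *
        (normalizedSeries B * normalizedSeries (I \ B)) := by
    rw [Finset.mul_sum]
    refine Finset.sum_congr rfl fun B hB => ?_
    rw [cubeExp_mul (Finset.mem_powerset.1 hB), pointSeries, pointSeries]
    ring
  have hp : PowerSeries.C (cubeSum I) = 24 * PowerSeries.C (cubeSum I / 24) := by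
    have h24 : (24 : PowerSeries (K n)) = PowerSeries.C 24 := (map_ofNat _ 24).symm
    rw [h24, ← map_mul]
    congr 1
    ring
  rw [hs, pointSeries, eulerDerivation_mul, eulerDerivation_cubeExp]
  simp only [map_mul, map_sub, map_pow, map_ofNat, hp] at h ⊢
  linear_combination h

namespace GenusSeries

/-- The genus series with given values. -/
def ofVal {ι B : Type} [DecidableEq ι] [CommRing B] (F : ℕ → Finset ι → B) : GenusSeries ι B :=
  PowerSeries.mk (R := SetFun ι B) F

@[simp] lemma val_ofVal {ι B : Type} [DecidableEq ι] [CommRing B] (F : ℕ → Finset ι → B) (g : ℕ)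
    (N : Finset ι) : (ofVal F).val g N = F g N := by
  have h : PowerSeries.coeff g (ofVal F) = (F g : SetFun ι B) := PowerSeries.coeff_mk g _
  rw [val, h]

/-- The variables as elements of the field of rational functions. -/
abbrev ratVar (n : ℕ) (i : Fin n) : K n := algebraMap (_root_.R n) (K n) (X i)

lemma sum_ratVar {n : ℕ} (N : Finset (Fin n)) : ∑ i ∈ N, ratVar n i = varSum N := by
  rw [varSum, map_sum]

/-- The genus series of the functions `F_g(x_N)`. -/
def point (n : ℕ) : GenusSeries (Fin n) (K n) :=
  ofVal fun g N => emb N (Fnpt N.card g)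

lemma val_point {n : ℕ} (g : ℕ) (N : Finset (Fin n)) :
    (point n).val g N = emb N (Fnpt N.card g) :=
  val_ofVal _ g N

/-- The genus series of the functions `(∑ x_i) F_g(x_N)`. -/
def point₁ (n : ℕ) : GenusSeries (Fin n) (K n) := wt (ratVar n) (point n)

/-- The genus series of the functions `(∑ x_i) ^ 2 F_g(x_N)`. -/
def point₂ (n : ℕ) : GenusSeries (Fin n) (K n) := wt (ratVar n) (point₁ n)

theorem deg_point₁ (n : ℕ) : 12 * (deg (point₁ n) - point₁ n) =
    6 * point₂ n ^ 2 + PowerSeries.X * wt (ratVar n) (wt (ratVar n) (point₂ n)) := by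
  refine ext_val fun g N => ?_
  have h := congrArg (PowerSeries.coeff g) (varSum_mul_pointSeries N)
  have h2 : (2 : PowerSeries (K n)) = PowerSeries.C 2 := (map_ofNat _ 2).symm
  have h6 : (6 : PowerSeries (K n)) = PowerSeries.C 6 := (map_ofNat _ 6).symm
  have hc : (N.card : PowerSeries (K n)) = PowerSeries.C (N.card : K n) := (map_natCast _ _).symm
  rw [h2, h6, hc] at h
  simp only [map_add, map_sub, PowerSeries.coeff_C_mul, coeff_eulerDerivation, map_sum,
    PowerSeries.coeff_mul g (pointSeries _), coeff_pointSeries] at h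
  have hm : (point₂ n ^ 2).val g N = ∑ B ∈ N.powerset, varSum B ^ 2 * varSum (N \ B) ^ 2 *
      ∑ p ∈ antidiagonal g, emb B (Fnpt B.card p.1) * emb (N \ B) (Fnpt (N \ B).card p.2) := by
    rw [sq, val_mul, Finset.sum_comm]
    refine Finset.sum_congr rfl fun B _ => ?_
    rw [Finset.mul_sum]
    refine Finset.sum_congr rfl fun p _ => ?_
    simp only [point₂, point₁, val_wt, sum_ratVar, val_point]
    ring
  rw [val_add, val_ofNat_mul, val_ofNat_mul, hm, val_sub, val_deg]
  have hX : val (PowerSeries.X * wt (ratVar n) (wt (ratVar n) (point₂ n))) g N =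
      PowerSeries.coeff g (PowerSeries.X * (PowerSeries.C (varSum N ^ 4) * pointSeries N)) := by
    cases g with
    | zero => simp
    | succ g =>
      rw [val_X_mul_succ, PowerSeries.coeff_succ_X_mul, PowerSeries.coeff_C_mul,
        coeff_pointSeries]
      simp only [point₂, point₁, val_wt, sum_ratVar, val_point]
      ring
  rw [hX, ← h]
  simp only [point₁, val_wt, sum_ratVar, val_point]
  push_cast
  ring

theorem deg_point₂ (n : ℕ) : 12 * (deg (point₂ n) - point₂ n) =
    12 * (point₂ n * wt (ratVar n) (point₂ n)) +
      PowerSeries.X * wt (ratVar n) (wt (ratVar n) (wt (ratVar n) (point₂ n))) := by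
  have h := congrArg (wt (ratVar n)) (deg_point₁ n)
  have h12 : wt (ratVar n) (12 : GenusSeries (Fin n) (K n)) = 0 := Derivation.map_natCast _ 12
  have h6 : wt (ratVar n) (6 : GenusSeries (Fin n) (K n)) = 0 := Derivation.map_natCast _ 6
  simp only [map_add, map_sub, Derivation.leibniz, Derivation.leibniz_pow, h12, h6, wt_X,
    smul_eq_mul, ← deg_wt, mul_zero, add_zero] at h
  rw [← point₂, pow_one] at h
  linear_combination h

end GenusSeries

namespace GenusSeries

lemma congr_val {ι B : Type} [DecidableEq ι] [CommRing B] {f h : GenusSeries ι B} (e : f = h)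
    (g : ℕ) (N : Finset ι) : f.val g N = h.val g N := by rw [e]

section Map

variable {ι B B' : Type} [DecidableEq ι] [CommRing B] [CommRing B']

/-- Valuewise application of a ring homomorphism. -/
def mapSeries (β : B →+* B') : GenusSeries ι B →+* GenusSeries ι B' :=
  PowerSeries.map (SetFun.map β)

@[simp] lemma val_mapSeries (β : B →+* B') (f : GenusSeries ι B) (g : ℕ) (N : Finset ι) :
    (mapSeries β f).val g N = β (f.val g N) := by
  rw [val, mapSeries, PowerSeries.coeff_map, SetFun.map_apply, val]

lemma mapSeries_injective {β : B →+* B'} (hβ : Function.Injective β) :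
    Function.Injective (mapSeries (ι := ι) β) := fun f h hfh =>
  ext_val fun g N => hβ (by rw [← val_mapSeries, hfh, val_mapSeries])

lemma exists_mapSeries_eq (β : B →+* B') (f : GenusSeries ι B')
    (h : ∀ g N, ∃ b, β b = f.val g N) : ∃ f' : GenusSeries ι B, mapSeries β f' = f := by
  choose F hF using h
  exact ⟨ofVal F, ext_val fun g N => by rw [val_mapSeries, val_ofVal, hF]⟩

lemma mapSeries_X (β : B →+* B') :
    mapSeries β (PowerSeries.X : GenusSeries ι B) = PowerSeries.X := PowerSeries.map_X _

lemma mapSeries_C_const (β : B →+* B') (c : B) :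
    mapSeries β (PowerSeries.C (SetFun.const c) : GenusSeries ι B) =
      PowerSeries.C (SetFun.const (β c)) := by
  rw [mapSeries, PowerSeries.map_C]
  congr 1
  ext N
  by_cases h : N = ∅ <;> simp [SetFun.const_apply, h]

variable [Algebra ℚ B] [Algebra ℚ B']

lemma mapSeries_wt (β : B →+* B') (ω : ι → B) (f : GenusSeries ι B) :
    mapSeries β (wt ω f) = wt (fun i => β (ω i)) (mapSeries β f) :=
  ext_val fun g N => by simp

lemma mapSeries_deg (β : B →+* B') (f : GenusSeries ι B) :
    mapSeries β (deg f) = deg (mapSeries β f) :=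
  ext_val fun g N => by
    rw [val_mapSeries, val_deg, val_deg, val_mapSeries, map_mul, map_natCast]

end Map

lemma val_point₁ {n : ℕ} (g : ℕ) (N : Finset (Fin n)) :
    (point₁ n).val g N = varSum N * emb N (Fnpt N.card g) := by
  rw [point₁, val_wt, sum_ratVar, val_point]

lemma val_point₂ {n : ℕ} (g : ℕ) (N : Finset (Fin n)) :
    (point₂ n).val g N = varSum N * (varSum N * emb N (Fnpt N.card g)) := by
  rw [point₂, val_wt, sum_ratVar, val_point₁]

lemma val_point₁_empty {n : ℕ} (g : ℕ) : (point₁ n).val g ∅ = 0 := by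
  rw [val_point₁, varSum_empty, zero_mul]

lemma val_point₂_empty {n : ℕ} (g : ℕ) : (point₂ n).val g ∅ = 0 := by
  rw [val_point₂, varSum_empty, zero_mul]

lemma ratVar_ne_zero {n : ℕ} (i : Fin n) : ratVar n i ≠ 0 := by
  have h := varSum_ne_zero (Finset.singleton_nonempty i)
  rwa [varSum, Finset.sum_singleton] at h

lemma emb_Fnpt_singleton {n : ℕ} (i : Fin n) :
    emb {i} (Fnpt ({i} : Finset (Fin n)).card 0) = (ratVar n i ^ 2)⁻¹ := by
  have hmono : StrictMono fun _ : Fin 1 => i := fun a b hab =>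
    absurd (Subsingleton.elim a b) hab.ne
  have h := orderEmb_eq_emb (I := {i}) (OrderEmbedding.ofStrictMono _ hmono)
    (fun k => Fnpt k 0) (by ext; simp [eq_comm])
  have hF : Fnpt 1 0 = (algebraMap (_root_.R 1) (K 1) (X 0) ^ 2)⁻¹ := by
    have hG : Gnpt 1 0 = (algebraMap (_root_.R 1) (K 1) (X 0)) ^ (-2 : ℤ) := rfl
    rw [Fnpt, zero_add, Finset.sum_range_one, hG, zpow_neg]
    simp
  rw [← h]
  simp only [hF]
  rw [map_inv₀, map_pow, orderEmb_algebraMap, MvPolynomial.rename_X]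
  rfl

lemma val_point₁_singleton {n : ℕ} (i : Fin n) : (point₁ n).val 0 {i} = (ratVar n i)⁻¹ := by
  have := ratVar_ne_zero i
  rw [val_point₁, emb_Fnpt_singleton, varSum, Finset.sum_singleton, ratVar]
  rw [ratVar] at this
  field_simp

lemma val_point₂_singleton {n : ℕ} (i : Fin n) : (point₂ n).val 0 {i} = 1 := by
  rw [point₂, val_wt, val_point₁_singleton, Finset.sum_singleton, mul_inv_cancel₀ (ratVar_ne_zero i)]

/-- The polynomials inside the field of rational functions. -/
abbrev polys (n : ℕ) : Subring (K n) := (algebraMap (_root_.R n) (K n)).range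

lemma varSum_mem_polys {n : ℕ} (N : Finset (Fin n)) : varSum N ∈ polys n := ⟨_, rfl⟩

lemma mem_polys_of_natCast_mul {n c : ℕ} (hc : c ≠ 0) {x : K n} (h : (c : K n) * x ∈ polys n) :
    x ∈ polys n := by
  obtain ⟨p, hp⟩ := h
  refine ⟨MvPolynomial.C (c : ℚ)⁻¹ * p, ?_⟩
  have hc' : (c : K n) ≠ 0 := Nat.cast_ne_zero.2 hc
  refine mul_left_cancel₀ hc' ?_
  rw [← hp, ← map_natCast (algebraMap (_root_.R n) (K n)) c, ← map_mul, ← mul_assoc,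
    ← map_natCast (MvPolynomial.C : ℚ →+* _root_.R n) c, ← map_mul,
    mul_inv_cancel₀ (Nat.cast_ne_zero.2 hc), map_one, one_mul]

lemma val_point₂_mem {n : ℕ} (g : ℕ) (N : Finset (Fin n)) : (point₂ n).val g N ∈ polys n := by
  induction hm : N.card + 2 * g using Nat.strong_induction_on generalizing g N with
  | _ m ih =>
    subst hm
    obtain rfl | hN := N.eq_empty_or_nonempty
    · rw [val_point₂_empty]
      exact zero_mem _
    by_cases h1 : N.card + 2 * g = 1
    · obtain rfl : g = 0 := by omega
      obtain ⟨i, rfl⟩ := Finset.card_eq_one.1 (show N.card = 1 by omega)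
      rw [val_point₂_singleton]
      exact one_mem _
    have hpos := hN.card_pos
    have h := congr_val (deg_point₂ n) g N
    rw [val_ofNat_mul, val_sub, val_deg, val_add, val_ofNat_mul, val_mul] at h
    simp only [val_wt, sum_ratVar] at h
    refine mem_polys_of_natCast_mul (c := 12 * (N.card + 2 * g - 1)) (by omega) ?_
    rw [show ((12 * (N.card + 2 * g - 1) : ℕ) : K n) * (point₂ n).val g N =
      12 * (((N.card + 2 * g : ℕ) : K n) * (point₂ n).val g N - (point₂ n).val g N) by
        obtain ⟨k, hk⟩ : ∃ k, N.card + 2 * g = k + 1 := ⟨N.card + 2 * g - 1, by omega⟩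
        rw [hk, Nat.add_sub_cancel]
        push_cast
        ring, h]
    have h12 : (12 : K n) ∈ polys n := ofNat_mem _ 12
    refine add_mem (mul_mem h12 (sum_mem fun p hp => sum_mem fun I hI => ?_)) ?_
    · have hp' : p.1 + p.2 = g := Finset.HasAntidiagonal.mem_antidiagonal.1 hp
      have hI' := Finset.mem_powerset.1 hI
      have hcard := Finset.card_sdiff_add_card_eq_card hI'
      obtain rfl | hI0 := I.eq_empty_or_nonempty
      · rw [val_point₂_empty, zero_mul]
        exact zero_mem _
      obtain hJ0 | hJ0 := (N \ I).eq_empty_or_nonempty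
      · rw [hJ0, val_point₂_empty, mul_zero, mul_zero]
        exact zero_mem _
      have := hI0.card_pos
      have := hJ0.card_pos
      exact mul_mem (ih _ (by omega) _ _ rfl)
        (mul_mem (varSum_mem_polys _) (ih _ (by omega) _ _ rfl))
    · cases g with
      | zero =>
        rw [val_X_mul_zero]
        exact zero_mem _
      | succ g =>
        simp only [val_X_mul_succ, val_wt, sum_ratVar]
        exact mul_mem (varSum_mem_polys _) (mul_mem (varSum_mem_polys _)
          (mul_mem (varSum_mem_polys _) (ih _ (by omega) _ _ rfl)))

lemma val_mul_mem {n : ℕ} {f h : GenusSeries (Fin n) (K n)} (hf : ∀ g N, f.val g N ∈ polys n)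
    (hh : ∀ g N, h.val g N ∈ polys n) (g : ℕ) (N : Finset (Fin n)) :
    (f * h).val g N ∈ polys n := by
  rw [val_mul]
  exact sum_mem fun p _ => sum_mem fun I _ => mul_mem (hf _ _) (hh _ _)

lemma val_wt_mem {n : ℕ} {f : GenusSeries (Fin n) (K n)} (hf : ∀ g N, f.val g N ∈ polys n) (g : ℕ)
    (N : Finset (Fin n)) : (wt (ratVar n) f).val g N ∈ polys n := by
  rw [val_wt, sum_ratVar]
  exact mul_mem (varSum_mem_polys _) (hf _ _)

lemma val_X_mul_mem {n : ℕ} {f : GenusSeries (Fin n) (K n)} (hf : ∀ g N, f.val g N ∈ polys n)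
    (g : ℕ) (N : Finset (Fin n)) : val (PowerSeries.X * f) g N ∈ polys n := by
  cases g with
  | zero =>
    rw [val_X_mul_zero]
    exact zero_mem _
  | succ g =>
    rw [val_X_mul_succ]
    exact hf _ _

lemma val_point₂_sq {n : ℕ} (g : ℕ) (N : Finset (Fin n)) (h2 : ¬(g = 0 ∧ N.card = 2)) :
    ∃ q ∈ polys n, (point₂ n ^ 2).val g N = varSum N * q := by
  have hu := val_point₂_mem (n := n)
  obtain rfl | hN := N.eq_empty_or_nonempty
  · refine ⟨0, zero_mem _, ?_⟩
    rw [sq, val_mul, mul_zero]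
    simp [val_point₂_empty]
  by_cases h1 : N.card + 2 * g = 1
  · obtain rfl : g = 0 := by omega
    obtain ⟨i, rfl⟩ := Finset.card_eq_one.1 (show N.card = 1 by omega)
    refine ⟨0, zero_mem _, ?_⟩
    rw [sq, val_mul, mul_zero]
    refine Finset.sum_eq_zero fun p hp => Finset.sum_eq_zero fun I hI => ?_
    rcases Finset.subset_singleton_iff.1 (Finset.mem_powerset.1 hI) with rfl | rfl
    · rw [val_point₂_empty, zero_mul]
    · rw [Finset.sdiff_self, val_point₂_empty, mul_zero]
  have hpos := hN.card_pos
  set flux : GenusSeries (Fin n) (K n) := 8 * point₂ n ^ 3 +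
    2 * (PowerSeries.X * (point₂ n * wt (ratVar n) (wt (ratVar n) (point₂ n)))) -
      PowerSeries.X * wt (ratVar n) (point₂ n) ^ 2 with hflux
  have h : 12 * (deg (point₂ n ^ 2) - 2 * point₂ n ^ 2) = wt (ratVar n) flux :=
    square_flux (wt_X _) (deg_point₂ n)
  have hq : flux.val g N ∈ polys n := by
    rw [hflux, val_sub, val_add, pow_succ, sq, sq, val_ofNat_mul,
      val_ofNat_mul]
    refine sub_mem (add_mem (mul_mem (ofNat_mem _ 8) ?_) (mul_mem (ofNat_mem _ 2) ?_)) ?_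
    · exact val_mul_mem (val_mul_mem hu hu) hu g N
    · exact val_X_mul_mem (val_mul_mem hu (val_wt_mem (val_wt_mem hu))) g N
    · exact val_X_mul_mem (val_mul_mem (val_wt_mem hu) (val_wt_mem hu)) g N
  obtain ⟨c, hc⟩ : ∃ c, N.card + 2 * g = c + 2 := ⟨N.card + 2 * g - 2, by omega⟩
  have hc0 : 12 * c ≠ 0 := by
    rintro h0
    refine h2 ⟨?_, ?_⟩ <;> omega
  have hc1 : ((12 * c : ℕ) : K n) ≠ 0 := Nat.cast_ne_zero.2 hc0
  have hv := congr_val h g N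
  rw [val_ofNat_mul, val_sub, val_deg, val_ofNat_mul, val_wt, sum_ratVar, hc] at hv
  refine ⟨(((12 * c : ℕ) : K n))⁻¹ * flux.val g N, ?_, ?_⟩
  · refine mem_polys_of_natCast_mul hc0 ?_
    rwa [mul_inv_cancel_left₀ hc1]
  · refine mul_left_cancel₀ hc1 ?_
    rw [mul_left_comm, mul_inv_cancel_left₀ hc1, ← hv]
    push_cast
    ring

lemma natCast_mul_val_point₁ {n : ℕ} {g c : ℕ} {N : Finset (Fin n)} (hc : N.card + 2 * g = c + 1) :
    ((12 * c : ℕ) : K n) * (point₁ n).val g N = 6 * (point₂ n ^ 2).val g N +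
      val (PowerSeries.X * wt (ratVar n) (wt (ratVar n) (point₂ n))) g N := by
  have h := congr_val (deg_point₁ n) g N
  rw [val_ofNat_mul, val_sub, val_deg, val_add, val_ofNat_mul, hc] at h
  rw [← h]
  push_cast
  ring

lemma val_point₁_mem {n : ℕ} (g : ℕ) (N : Finset (Fin n)) (h1 : ¬(g = 0 ∧ N.card = 1)) :
    (point₁ n).val g N ∈ polys n := by
  have hu := val_point₂_mem (n := n)
  obtain rfl | hN := N.eq_empty_or_nonempty
  · rw [val_point₁_empty]
    exact zero_mem _
  have hpos := hN.card_pos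
  obtain ⟨c, hc⟩ : ∃ c, N.card + 2 * g = c + 1 := ⟨N.card + 2 * g - 1, by omega⟩
  refine mem_polys_of_natCast_mul (c := 12 * c) (by omega) ?_
  rw [natCast_mul_val_point₁ hc, sq]
  exact add_mem (mul_mem (ofNat_mem _ 6) (val_mul_mem hu hu g N))
    (val_X_mul_mem (val_wt_mem (val_wt_mem hu)) g N)

theorem emb_Fnpt_mem {n : ℕ} (g : ℕ) {N : Finset (Fin n)} (hN : N.Nonempty)
    (h2 : ¬(g = 0 ∧ N.card ≤ 2)) : emb N (Fnpt N.card g) ∈ polys n := by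
  have hpos := hN.card_pos
  obtain ⟨c, hc⟩ : ∃ c, N.card + 2 * g = c + 1 := ⟨N.card + 2 * g - 1, by omega⟩
  obtain ⟨q, hq, e⟩ := val_point₂_sq g N (by omega)
  have h := natCast_mul_val_point₁ hc
  have hX : val (PowerSeries.X * wt (ratVar n) (wt (ratVar n) (point₂ n))) g N =
      varSum N * val (PowerSeries.X * wt (ratVar n) (point₂ n)) g N := by
    cases g with
    | zero => simp
    | succ g => simp [val_wt, sum_ratVar]
  rw [e, hX, val_point₁] at h
  refine mem_polys_of_natCast_mul (c := 12 * c) (by omega) ?_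
  have h' : ((12 * c : ℕ) : K n) * emb N (Fnpt N.card g) =
      6 * q + val (PowerSeries.X * wt (ratVar n) (point₂ n)) g N := by
    refine mul_left_cancel₀ (varSum_ne_zero hN) ?_
    linear_combination h
  rw [h']
  exact add_mem (mul_mem (ofNat_mem _ 6) hq) (val_X_mul_mem (val_wt_mem val_point₂_mem) g N)

end GenusSeries

lemma sum_powerset_map {α β M : Type} [AddCommMonoid M] (e : α ↪ β) (N : Finset α)
    (f : Finset β → M) : ∑ B ∈ (N.map e).powerset, f B = ∑ A ∈ N.powerset, f (A.map e) := by
  refine (Finset.sum_nbij (fun A : Finset _ => A.map e) ?_ ?_ ?_ fun _ _ => rfl).symm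
  · intro A hA
    exact Finset.mem_powerset.2 (Finset.map_subset_map.2 (Finset.mem_powerset.1 hA))
  · exact (Finset.map_injective e).injOn
  · intro B hB
    obtain ⟨A, hA, rfl⟩ := Finset.subset_map_iff.1 (Finset.mem_powerset.1 hB)
    exact ⟨A, Finset.mem_coe.2 (Finset.mem_powerset.2 hA), rfl⟩

namespace SetFun

variable {n : ℕ} {B : Type} [CommRing B]

/-- Restriction of a set function to the sets without the marked point `0`. -/
def restrict : SetFun (Fin (n + 1)) B →+* SetFun (Fin n) B where
  toFun f N := f (N.map (Fin.succEmb n))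
  map_one' := by ext N; simp [one_apply]
  map_zero' := rfl
  map_add' _ _ := rfl
  map_mul' f h := by
    ext N
    change (f * h) (N.map (Fin.succEmb n)) = _
    rw [mul_apply, sum_powerset_map]
    refine Eq.trans (Finset.sum_congr rfl fun A _ => ?_) (mul_apply _ _ _).symm
    rw [← Finset.map_sdiff]

lemma restrict_apply (f : SetFun (Fin (n + 1)) B) (N : Finset (Fin n)) :
    restrict f N = f (N.map (Fin.succEmb n)) := rfl

end SetFun

namespace GenusSeries

variable {n : ℕ} {B : Type} [CommRing B]

/-- Restriction of a genus series to the sets without the marked point `0`. -/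
def restrict : GenusSeries (Fin (n + 1)) B →+* GenusSeries (Fin n) B :=
  PowerSeries.map SetFun.restrict

@[simp] lemma val_restrict (f : GenusSeries (Fin (n + 1)) B) (g : ℕ) (N : Finset (Fin n)) :
    (restrict f).val g N = f.val g (N.map (Fin.succEmb n)) := by
  rw [val, restrict, PowerSeries.coeff_map, SetFun.restrict_apply, val]

/-- Values of a genus series on the sets containing the marked point `0`. -/
def mark (f : GenusSeries (Fin (n + 1)) B) : GenusSeries (Fin n) B :=
  ofVal fun g N => f.val g (insert 0 (N.map (Fin.succEmb n)))

@[simp] lemma val_mark (f : GenusSeries (Fin (n + 1)) B) (g : ℕ) (N : Finset (Fin n)) :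
    (mark f).val g N = f.val g (insert 0 (N.map (Fin.succEmb n))) := val_ofVal _ _ _

lemma zero_notMem_map_succ (N : Finset (Fin n)) : (0 : Fin (n + 1)) ∉ N.map (Fin.succEmb n) := by
  simp [Fin.succ_ne_zero]

lemma mark_add (f h : GenusSeries (Fin (n + 1)) B) : mark (f + h) = mark f + mark h :=
  ext_val fun g N => by simp

lemma mark_sub (f h : GenusSeries (Fin (n + 1)) B) : mark (f - h) = mark f - mark h :=
  ext_val fun g N => by simp

lemma mark_ofNat_mul (c : ℕ) [c.AtLeastTwo] (f : GenusSeries (Fin (n + 1)) B) :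
    mark (OfNat.ofNat c * f) = OfNat.ofNat c * mark f :=
  ext_val fun g N => by rw [val_mark, val_ofNat_mul, val_ofNat_mul, val_mark]

lemma mark_X_mul (f : GenusSeries (Fin (n + 1)) B) :
    mark (PowerSeries.X * f) = PowerSeries.X * mark f :=
  ext_val fun g N => by cases g <;> simp

lemma mark_mul (f h : GenusSeries (Fin (n + 1)) B) :
    mark (f * h) = mark f * restrict h + restrict f * mark h :=
  ext_val fun g N => by
    rw [val_mark, val_add, val_mul, val_mul, val_mul, ← Finset.sum_add_distrib]
    refine Finset.sum_congr rfl fun p _ => ?_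
    rw [Finset.sum_powerset_insert (zero_notMem_map_succ N), sum_powerset_map, sum_powerset_map,
      add_comm, ← Finset.sum_add_distrib, ← Finset.sum_add_distrib]
    refine Finset.sum_congr rfl fun A _ => ?_
    simp only [val_mark, val_restrict, Finset.map_sdiff]
    rw [Finset.insert_sdiff_insert, Finset.sdiff_insert_of_notMem (zero_notMem_map_succ N),
      Finset.insert_sdiff_of_notMem _ (zero_notMem_map_succ A)]

lemma restrict_X : restrict (PowerSeries.X : GenusSeries (Fin (n + 1)) B) = PowerSeries.X :=
  PowerSeries.map_X _

lemma restrict_C_const (c : B) :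
    restrict (PowerSeries.C (SetFun.const c) : GenusSeries (Fin (n + 1)) B) =
      PowerSeries.C (SetFun.const c) := by
  rw [restrict, PowerSeries.map_C]
  congr 1
  ext N
  simp [SetFun.restrict_apply, SetFun.const_apply]

lemma mark_C_const_mul (c : B) (f : GenusSeries (Fin (n + 1)) B) :
    mark (PowerSeries.C (SetFun.const c) * f) = PowerSeries.C (SetFun.const c) * mark f :=
  ext_val fun g N => by rw [val_mark, val_C_const_mul, val_C_const_mul, val_mark]

variable [Algebra ℚ B]

lemma restrict_wt (ω : Fin (n + 1) → B) (f : GenusSeries (Fin (n + 1)) B) :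
    restrict (wt ω f) = wt (fun i => ω i.succ) (restrict f) :=
  ext_val fun g N => by simp [Finset.sum_map]

lemma restrict_deg (f : GenusSeries (Fin (n + 1)) B) : restrict (deg f) = deg (restrict f) :=
  ext_val fun g N => by simp

lemma mark_wt (ω : Fin (n + 1) → B) (f : GenusSeries (Fin (n + 1)) B) :
    mark (wt ω f) = wt (fun i => ω i.succ) (mark f) +
      PowerSeries.C (SetFun.const (ω 0)) * mark f :=
  ext_val fun g N => by
    rw [val_add, val_C_const_mul, val_wt, val_mark, val_mark, val_wt,
      Finset.sum_insert (zero_notMem_map_succ N), Finset.sum_map]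
    simp only [Fin.coe_succEmb]
    ring

lemma mark_deg (f : GenusSeries (Fin (n + 1)) B) : mark (deg f) = deg (mark f) + mark f :=
  ext_val fun g N => by
    rw [val_add, val_deg, val_mark, val_mark, val_deg,
      Finset.card_insert_of_notMem (zero_notMem_map_succ N), Finset.card_map]
    push_cast
    ring

/-- The linear system satisfied by the series with up to two marked points, of weights `a` and
`b`. -/
structure MarkedSystem {ι : Type} [DecidableEq ι] (ω : ι → B) (a b : B)
    (u v w v' w' η : GenusSeries ι B) : Prop where
  wave : 12 * deg w = 12 * (u * (PowerSeries.C (SetFun.const a) * v)) + PowerSeries.X *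
    (wt ω (wt ω (PowerSeries.C (SetFun.const a) * v) +
      PowerSeries.C (SetFun.const a) * (PowerSeries.C (SetFun.const a) * v)) +
        PowerSeries.C (SetFun.const a) * (wt ω (PowerSeries.C (SetFun.const a) * v) +
          PowerSeries.C (SetFun.const a) * (PowerSeries.C (SetFun.const a) * v)))
  shift : PowerSeries.C (SetFun.const a) * v = wt ω w + PowerSeries.C (SetFun.const a) * w
  wave' : 12 * deg w' = 12 * (u * (PowerSeries.C (SetFun.const b) * v')) + PowerSeries.X *
    (wt ω (wt ω (PowerSeries.C (SetFun.const b) * v') +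
      PowerSeries.C (SetFun.const b) * (PowerSeries.C (SetFun.const b) * v')) +
        PowerSeries.C (SetFun.const b) * (wt ω (PowerSeries.C (SetFun.const b) * v') +
          PowerSeries.C (SetFun.const b) * (PowerSeries.C (SetFun.const b) * v')))
  shift' : PowerSeries.C (SetFun.const b) * v' = wt ω w' + PowerSeries.C (SetFun.const b) * w'
  pair : 12 * (deg η + η) =
    12 * (u * (wt ω η + PowerSeries.C (SetFun.const (a + b)) * η)) + 12 * (v * v') +
    PowerSeries.X * (wt ω (wt ω (wt ω η)) +
      3 * (PowerSeries.C (SetFun.const (a + b)) * wt ω (wt ω η)) +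
      3 * (PowerSeries.C (SetFun.const (a + b)) * (PowerSeries.C (SetFun.const (a + b)) *
        wt ω η)) +
      PowerSeries.C (SetFun.const (a + b)) * (PowerSeries.C (SetFun.const (a + b)) *
        (PowerSeries.C (SetFun.const (a + b)) * η)))
  bot_left : bot w = 1
  bot_right : bot w' = 1

namespace MarkedSystem

variable {ι B' : Type} [DecidableEq ι] [CommRing B'] [Algebra ℚ B'] {ω : ι → B} {a b : B}
  {u v w v' w' η : GenusSeries ι B}

omit [Algebra ℚ B] [Algebra ℚ B'] in
lemma bot_mapSeries (β : B →+* B') (f : GenusSeries ι B) : bot (mapSeries β f) = β (bot f) := by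
  rw [bot_apply, bot_apply, val_mapSeries]

lemma map (β : B →+* B') (h : MarkedSystem ω a b u v w v' w' η) :
    MarkedSystem (fun i => β (ω i)) (β a) (β b) (mapSeries β u) (mapSeries β v) (mapSeries β w)
      (mapSeries β v') (mapSeries β w') (mapSeries β η) where
  wave := by
    simpa only [map_add, map_mul, mapSeries_wt, mapSeries_deg, mapSeries_X, mapSeries_C_const,
      map_ofNat] using congrArg (mapSeries β) h.wave
  shift := by
    simpa only [map_add, map_mul, mapSeries_wt, mapSeries_C_const] using
      congrArg (mapSeries β) h.shift
  wave' := by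
    simpa only [map_add, map_mul, mapSeries_wt, mapSeries_deg, mapSeries_X, mapSeries_C_const,
      map_ofNat] using congrArg (mapSeries β) h.wave'
  shift' := by
    simpa only [map_add, map_mul, mapSeries_wt, mapSeries_C_const] using
      congrArg (mapSeries β) h.shift'
  pair := by
    simpa only [map_add, map_mul, mapSeries_wt, mapSeries_deg, mapSeries_X, mapSeries_C_const,
      map_ofNat] using congrArg (mapSeries β) h.pair
  bot_left := by rw [bot_mapSeries, h.bot_left, map_one]
  bot_right := by rw [bot_mapSeries, h.bot_right, map_one]

lemma of_map {β : B →+* B'} (hβ : Function.Injective β)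
    (h : MarkedSystem (fun i => β (ω i)) (β a) (β b) (mapSeries β u) (mapSeries β v)
      (mapSeries β w) (mapSeries β v') (mapSeries β w') (mapSeries β η)) :
    MarkedSystem ω a b u v w v' w' η where
  wave := mapSeries_injective hβ (by
    simpa only [map_add, map_mul, mapSeries_wt, mapSeries_deg, mapSeries_X, mapSeries_C_const,
      map_ofNat] using h.wave)
  shift := mapSeries_injective hβ (by
    simpa only [map_add, map_mul, mapSeries_wt, mapSeries_C_const] using h.shift)
  wave' := mapSeries_injective hβ (by
    simpa only [map_add, map_mul, mapSeries_wt, mapSeries_deg, mapSeries_X, mapSeries_C_const,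
      map_ofNat] using h.wave')
  shift' := mapSeries_injective hβ (by
    simpa only [map_add, map_mul, mapSeries_wt, mapSeries_C_const] using h.shift')
  pair := mapSeries_injective hβ (by
    simpa only [map_add, map_mul, mapSeries_wt, mapSeries_deg, mapSeries_X, mapSeries_C_const,
      map_ofNat] using h.pair)
  bot_left := hβ (by rw [← bot_mapSeries, h.bot_left, map_one])
  bot_right := hβ (by rw [← bot_mapSeries, h.bot_right, map_one])

end MarkedSystem

end GenusSeries

namespace GenusSeries

section MarkedPoint

variable {n : ℕ} {B : Type} [CommRing B]

lemma mark_sq (f : GenusSeries (Fin (n + 1)) B) :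
    mark (f ^ 2) = 2 * (restrict f * mark f) := by
  rw [sq, mark_mul]
  ring

variable [Algebra ℚ B]

/-- One marked point in the equation of the one-derivative series. -/
lemma mark_equation {ω : Fin (n + 1) → B} {h : GenusSeries (Fin (n + 1)) B}
    (H : 12 * (deg h - h) = 6 * wt ω h ^ 2 + PowerSeries.X * wt ω (wt ω (wt ω h))) :
    12 * deg (mark h) = 12 * (restrict (wt ω h) * mark (wt ω h)) +
      PowerSeries.X * mark (wt ω (wt ω (wt ω h))) := by
  have e := congrArg mark H
  rw [mark_ofNat_mul, mark_sub, mark_deg, mark_add, mark_ofNat_mul, mark_sq, mark_X_mul] at e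
  linear_combination e

lemma wt_C_const_mul (ω : Fin n → B) (c : B) (f : GenusSeries (Fin n) B) :
    wt ω (PowerSeries.C (SetFun.const c) * f) = PowerSeries.C (SetFun.const c) * wt ω f :=
  ext_val fun g N => by simp only [val_wt, val_C_const_mul, mul_left_comm]

lemma deg_C_const_mul (c : B) (f : GenusSeries (Fin n) B) :
    deg (PowerSeries.C (SetFun.const c) * f) = PowerSeries.C (SetFun.const c) * deg f :=
  ext_val fun g N => by simp only [val_deg, val_C_const_mul, mul_left_comm]

theorem markedSystem_of_equation {ω : Fin (n + 2) → B} {h : GenusSeries (Fin (n + 2)) B}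
    (H : 12 * (deg h - h) = 6 * wt ω h ^ 2 + PowerSeries.X * wt ω (wt ω (wt ω h)))
    (h0 : ω 0 * h.val 0 {0} = 1) (h1 : ω 1 * h.val 0 {1} = 1) :
    MarkedSystem (fun i : Fin n => ω i.succ.succ) (ω 0) (ω 1)
      (restrict (restrict (wt ω h))) (restrict (mark (wt ω h)))
      (PowerSeries.C (SetFun.const (ω 0)) * restrict (mark h)) (mark (restrict (wt ω h)))
      (PowerSeries.C (SetFun.const (ω 1)) * mark (restrict h)) (mark (mark h)) where
  wave := by
    have e := congrArg restrict (mark_equation H)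
    simp only [mark_wt, restrict_wt, restrict_deg, map_add, map_mul, restrict_X, restrict_C_const,
      map_ofNat, wt_C_const_mul, deg_C_const_mul] at e ⊢
    linear_combination PowerSeries.C (SetFun.const (ω 0)) * e
  shift := by
    simp only [mark_wt, restrict_wt, map_add, map_mul, restrict_C_const, wt_C_const_mul]
    ring
  wave' := by
    have H' := congrArg restrict H
    simp only [restrict_wt, restrict_deg, map_add, map_sub, map_mul, map_pow, restrict_X,
      map_ofNat] at H'
    have e := mark_equation H'
    simp only [mark_wt, restrict_wt, map_add, Fin.succ_zero_eq_one, wt_C_const_mul,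
      deg_C_const_mul] at e ⊢
    linear_combination PowerSeries.C (SetFun.const (ω 1)) * e
  shift' := by
    simp only [mark_wt, restrict_wt, Fin.succ_zero_eq_one, wt_C_const_mul]
    ring
  pair := by
    have e := congrArg mark (mark_equation H)
    rw [mark_ofNat_mul, mark_deg, mark_add, mark_ofNat_mul, mark_mul, mark_X_mul] at e
    simp only [mark_wt, restrict_wt, map_add, Fin.succ_zero_eq_one, wt_C_const_mul, mark_add,
      mark_C_const_mul] at e ⊢
    linear_combination e
  bot_left := by
    rw [bot_apply, val_C_const_mul, val_restrict, val_mark]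
    simpa using h0
  bot_right := by
    rw [bot_apply, val_C_const_mul, val_mark, val_restrict]
    simpa using h1

end MarkedPoint

end GenusSeries

namespace GenusSeries

lemma ratVar_mul_val_point₁_mem {n g : ℕ} {N : Finset (Fin n)} {i : Fin n} (hi : i ∈ N) :
    ratVar n i * (point₁ n).val g N ∈ polys n := by
  by_cases h : g = 0 ∧ N.card = 1
  · obtain ⟨rfl, hN⟩ := h
    obtain ⟨j, rfl⟩ := Finset.card_eq_one.1 hN
    obtain rfl := Finset.mem_singleton.1 hi
    rw [val_point₁_singleton, mul_inv_cancel₀ (ratVar_ne_zero i)]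
    exact one_mem _
  · exact mul_mem ⟨_, rfl⟩ (val_point₁_mem g N h)

lemma exists_lift {ι : Type} [DecidableEq ι] {n : ℕ} {f : GenusSeries ι (K n)}
    (h : ∀ g N, f.val g N ∈ polys n) :
    ∃ f' : GenusSeries ι (_root_.R n), mapSeries (algebraMap _ (K n)) f' = f :=
  exists_mapSeries_eq _ f h

/-- The marked series of the `(n + 2)`-point functions have polynomial values. -/
theorem exists_markedSystem (n : ℕ) :
    ∃ u v w v' w' η : GenusSeries (Fin n) (_root_.R (n + 2)),
      MarkedSystem (fun i => X i.succ.succ) (X 0) (X 1) u v w v' w' η ∧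
      mapSeries (algebraMap _ (K (n + 2))) u = restrict (restrict (point₂ (n + 2))) ∧
      mapSeries (algebraMap _ (K (n + 2))) η = mark (mark (point₁ (n + 2))) := by
  have hs := markedSystem_of_equation (deg_point₁ (n + 2))
    (by rw [val_point₁_singleton, mul_inv_cancel₀ (ratVar_ne_zero _)])
    (by rw [val_point₁_singleton, mul_inv_cancel₀ (ratVar_ne_zero _)])
  obtain ⟨u, hu⟩ := exists_lift (f := restrict (restrict (point₂ (n + 2)))) fun g N => by
      rw [val_restrict, val_restrict]
      exact val_point₂_mem _ _
  obtain ⟨v, hv⟩ := exists_lift (f := restrict (mark (point₂ (n + 2)))) fun g N => by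
      rw [val_restrict, val_mark]
      exact val_point₂_mem _ _
  obtain ⟨v', hv'⟩ := exists_lift (f := mark (restrict (point₂ (n + 2)))) fun g N => by
      rw [val_mark, val_restrict]
      exact val_point₂_mem _ _
  obtain ⟨w, hw⟩ := exists_lift (f :=
    PowerSeries.C (SetFun.const (ratVar (n + 2) 0)) * restrict (mark (point₁ (n + 2))))
      fun g N => by
      rw [val_C_const_mul, val_restrict, val_mark]
      exact ratVar_mul_val_point₁_mem (Finset.mem_insert_self _ _)
  obtain ⟨w', hw'⟩ := exists_lift (f :=
    PowerSeries.C (SetFun.const (ratVar (n + 2) 1)) * mark (restrict (point₁ (n + 2))))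
      fun g N => by
      rw [val_C_const_mul, val_mark, val_restrict]
      exact ratVar_mul_val_point₁_mem (Finset.mem_map_of_mem _ (Finset.mem_insert_self _ _))
  obtain ⟨η, hη⟩ := exists_lift (f := mark (mark (point₁ (n + 2)))) fun g N => by
      rw [val_mark, val_mark]
      refine val_point₁_mem _ _ fun h => ?_
      rw [Finset.card_insert_of_notMem (zero_notMem_map_succ _), Finset.card_map,
        Finset.card_insert_of_notMem (zero_notMem_map_succ _)] at h
      omega
  refine ⟨u, v, w, v', w', η, MarkedSystem.of_map
    (IsFractionRing.injective (_root_.R (n + 2)) (K (n + 2))) ?_, hu, hη⟩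
  rw [hu, hv, hw, hv', hw', hη]
  exact hs

end GenusSeries

namespace GenusSeries

/-- The double successor embedding of `Fin n`. -/
def succSucc (n : ℕ) : Fin n ↪o Fin (n + 2) :=
  (Fin.succOrderEmb n).trans (Fin.succOrderEmb (n + 1))

lemma map_succSucc {n : ℕ} (N : Finset (Fin n)) :
    (N.map (Fin.succEmb n)).map (Fin.succEmb (n + 1)) = N.map (succSucc n).toEmbedding := by
  rw [Finset.map_map]
  rfl

lemma restrict_restrict_point₂ (n : ℕ) :
    restrict (restrict (point₂ (n + 2))) = mapSeries (orderEmb (succSucc n)) (point₂ n) :=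
  ext_val fun g N => by
    rw [val_restrict, val_restrict, map_succSucc, val_mapSeries, val_point₂, val_point₂, map_mul,
      map_mul, orderEmb_varSum, orderEmb_emb (succSucc n) N fun k => Fnpt k g]

/-- The polynomial lift of the twice differentiated `n`-point series. -/
theorem exists_lift_point₂ (n : ℕ) : ∃ u : GenusSeries (Fin n) (_root_.R n),
    mapSeries (algebraMap _ (K n)) u = point₂ n ∧
    12 * (deg u - u) = 12 * (u * wt X u) + PowerSeries.X * wt X (wt X (wt X u)) ∧
    (∀ g, u.val g ∅ = 0) ∧ ∀ i, u.val 0 {i} = 1 := by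
  obtain ⟨u, hu⟩ := exists_lift (f := point₂ n) val_point₂_mem
  have hinj := IsFractionRing.injective (_root_.R n) (K n)
  refine ⟨u, hu, mapSeries_injective hinj ?_, fun g => hinj ?_, fun i => hinj ?_⟩
  · simpa only [map_add, map_sub, map_mul, mapSeries_wt, mapSeries_deg, mapSeries_X, map_ofNat,
      hu] using deg_point₂ n
  · rw [← val_mapSeries, hu, val_point₂_empty, map_zero]
  · rw [← val_mapSeries, hu, val_point₂_singleton, map_one]

lemma weight_one_coeff_zero {ι B : Type} [DecidableEq ι] [CommRing B] [Algebra ℚ B] {ω : ι → B}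
    {u : GenusSeries ι B}
    (h : 12 * (deg u - u) = 12 * (u * wt ω u) + PowerSeries.X * wt ω (wt ω (wt ω u))) :
    SetFun.weight (fun _ => 1) (PowerSeries.coeff 0 u) =
      PowerSeries.coeff 0 u + PowerSeries.coeff 0 u * SetFun.weight ω (PowerSeries.coeff 0 u) := by
  have e := congrArg (PowerSeries.coeff 0) h
  have h12 : (12 : PowerSeries (SetFun ι B)) = PowerSeries.C 12 := (map_ofNat _ 12).symm
  rw [h12, map_add, PowerSeries.coeff_C_mul, PowerSeries.coeff_C_mul, PowerSeries.coeff_zero_X_mul,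
    map_sub, coeff_deg, PowerSeries.coeff_mul,
    Finset.Nat.antidiagonal_zero, Finset.sum_singleton, coeff_wt, Nat.cast_zero, zero_mul, mul_zero,
    add_zero, add_zero] at e
  have hunit : IsUnit (12 : SetFun ι B) := by
    rw [← map_ofNat (algebraMap ℚ (SetFun ι B)) 12]
    exact (IsUnit.mk0 (12 : ℚ) (by norm_num)).map _
  linear_combination hunit.mul_left_cancel e

lemma eq_mapSeries_rename {n : ℕ} {u : GenusSeries (Fin n) (_root_.R (n + 2))}
    {u₀ : GenusSeries (Fin n) (_root_.R n)}
    (hu : mapSeries (algebraMap _ (K (n + 2))) u = restrict (restrict (point₂ (n + 2))))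
    (hu₀ : mapSeries (algebraMap _ (K n)) u₀ = point₂ n) :
    u = mapSeries (rename (succSucc n)).toRingHom u₀ := by
  refine mapSeries_injective (IsFractionRing.injective (_root_.R (n + 2)) (K (n + 2))) ?_
  rw [hu, restrict_restrict_point₂, ← hu₀]
  refine ext_val fun g N => ?_
  simp only [val_mapSeries, orderEmb_algebraMap]
  rfl

end GenusSeries

namespace GenusSeries

/-- Specialization of the first two variables to `Y` and `-Y`. -/
def pairEval (n : ℕ) : _root_.R (n + 2) →ₐ[ℚ] Polynomial (_root_.R n) :=
  aeval (Fin.cons Polynomial.X (Fin.cons (-Polynomial.X) fun i => Polynomial.C (X i)))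

lemma pairEval_X_zero (n : ℕ) : pairEval n (X 0) = Polynomial.X := by
  rw [pairEval, aeval_X, Fin.cons_zero]

lemma pairEval_X_one (n : ℕ) : pairEval n (X 1) = -Polynomial.X := by
  rw [pairEval, aeval_X, ← Fin.succ_zero_eq_one, Fin.cons_succ, Fin.cons_zero]

lemma pairEval_X_succ_succ {n : ℕ} (i : Fin n) :
    pairEval n (X i.succ.succ) = Polynomial.C (X i) := by
  rw [pairEval, aeval_X, Fin.cons_succ, Fin.cons_succ]

lemma pairEval_rename {n : ℕ} (p : _root_.R n) :
    pairEval n (rename (succSucc n) p) = Polynomial.C p := by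
  have h : (pairEval n).comp (rename (succSucc n)) =
      IsScalarTower.toAlgHom ℚ (_root_.R n) (Polynomial (_root_.R n)) := by
    refine MvPolynomial.algHom_ext fun i => ?_
    rw [AlgHom.comp_apply, rename_X]
    exact pairEval_X_succ_succ i
  exact DFunLike.congr_fun h p

lemma isTop_mapSeries_C {n : ℕ} (u : GenusSeries (Fin n) (_root_.R n)) (W : ℕ) :
    IsTop W 0 (mapSeries Polynomial.C u) (PowerSeries.C (PowerSeries.coeff 0 u)) := by
  intro g N _
  rw [val_mapSeries]
  cases g with
  | zero =>
    rw [val_C_zero]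
    exact ⟨by simp, by simp [val]⟩
  | succ g =>
    rw [val_C_succ]
    exact ⟨by simp, by rw [Polynomial.coeff_C, if_neg (by omega)]⟩

theorem exists_isTop_pair (n : ℕ) : ∃ η : GenusSeries (Fin n) (_root_.R (n + 2)),
    mapSeries (algebraMap _ (K (n + 2))) η = mark (mark (point₁ (n + 2))) ∧
    ∃ μ : GenusSeries (Fin n) (_root_.R n),
      (∀ W, IsTop W 0 (mapSeries (pairEval n).toRingHom η) μ) ∧
      ∀ (g : ℕ) (d : Fin n →₀ ℕ), 1 ≤ g → (∀ i, 1 ≤ d i) → ∑ i, (d i - 1) = g - 1 →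
        ∃ p : MvPolynomial (Fin n) ℚ, μ.val g univ = (∑ i, X i) * p ∧
          coeff d p = ((2 * g).ascFactorial n *
            ∏ i, (Nat.doubleFactorial (2 * d i - 1) : ℚ)⁻¹) / (4 ^ g * (2 * g * (2 * g + 1))) := by
  obtain ⟨u, v, w, v', w', η, hs, hu, hη⟩ := exists_markedSystem n
  obtain ⟨u₀, hu₀, heq, hempty, hone⟩ := exists_lift_point₂ n
  obtain rfl := eq_mapSeries_rename hu hu₀
  obtain ⟨m, ν, μ, hm, hm0, hn, hμ, hcoeff⟩ :=
    exists_topSeries (weight_one_coeff_zero heq) (u := PowerSeries.coeff 0 u₀) hone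
  rw [Fintype.card_fin] at hcoeff
  refine ⟨η, hη, μ, fun W => ?_, hcoeff⟩
  have hs' := hs.map (pairEval n).toRingHom
  have hC : mapSeries (pairEval n).toRingHom (mapSeries (rename (succSucc n)).toRingHom u₀) =
      mapSeries Polynomial.C u₀ :=
    ext_val fun g N => by
      simp only [val_mapSeries]
      exact pairEval_rename _
  have hω : (fun i : Fin n => (pairEval n).toRingHom (X i.succ.succ)) =
      fun i => Polynomial.C (X i) := funext pairEval_X_succ_succ
  have ha : (pairEval n).toRingHom (X 0) = Polynomial.X := pairEval_X_zero n
  have hb : (pairEval n).toRingHom (X 1) = -Polynomial.X := pairEval_X_one n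
  rw [hC, hω, ha, hb] at hs'
  have hneg : (PowerSeries.C (SetFun.const (-Polynomial.X)) :
      GenusSeries (Fin n) (Polynomial (_root_.R n))) = -spectral (Fin n) (_root_.R n) := by
    rw [map_neg, map_neg]
    rfl
  have hzero : (PowerSeries.C (SetFun.const (Polynomial.X + -Polynomial.X)) :
      GenusSeries (Fin n) (Polynomial (_root_.R n))) = 0 := by
    rw [add_neg_cancel, map_zero, map_zero]
  have h1 := hs'.wave'
  have h2 := hs'.shift'
  have h3 := hs'.pair
  rw [hneg] at h1 h2
  rw [hzero] at h3
  refine isTop_of_bilinear (v' := mapSeries (pairEval n).toRingHom v')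
    (isTop_mapSeries_C u₀) (fun g => ?_) (fun g => ?_) hs'.wave hs'.shift
    ?_ ?_ hs'.bot_left hs'.bot_right ?_ hm hm0 hn hμ W
  · rw [val_mapSeries, hempty, map_zero]
  · cases g with
    | zero => rw [val_C_zero]; exact hempty 0
    | succ g => rw [val_C_succ]
  · simp only [sub_eq_add_neg, ← neg_mul]
    exact h1
  · simp only [sub_eq_add_neg, ← neg_mul]
    exact h2
  · simpa only [zero_mul, mul_zero, add_zero] using h3

end GenusSeries

lemma bracket_eq_coeff {g n : ℕ} {d : Fin n → ℕ} (h : ¬(g = 0 ∧ n ≤ 2)) {P : _root_.R n}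
    (hP : algebraMap (_root_.R n) (K n) P = Fnpt n g) :
    bracket g d = coeff (Finsupp.equivFunOnFinite.symm d) P := by
  have hex : ∃ p : _root_.R n, algebraMap (_root_.R n) (K n) p = Fnpt n g := ⟨P, hP⟩
  rw [bracket, if_neg h, coeffK, dif_pos hex]
  congr 1
  exact IsFractionRing.injective (_root_.R n) (K n) (hex.choose_spec.trans hP.symm)

namespace GenusSeries

lemma pairEval_monomial {n : ℕ} (s : Fin (n + 2) →₀ ℕ) (c : ℚ) :
    pairEval n (monomial s c) = Polynomial.monomial (s 0 + s 1)
      (monomial (Finsupp.equivFunOnFinite.symm fun i : Fin n => s i.succ.succ)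
        ((-1) ^ s 1 * c)) := by
  have h : (∏ i : Fin n, Polynomial.C (X i) ^ s i.succ.succ : Polynomial (_root_.R n)) =
      Polynomial.C (monomial (Finsupp.equivFunOnFinite.symm fun i : Fin n => s i.succ.succ) 1) := by
    rw [monomial_eq, C_1, one_mul, Finsupp.prod_fintype _ _ fun _ => pow_zero _, map_prod]
    simp
  rw [pairEval, aeval_monomial, Finsupp.prod_fintype _ _ fun _ => pow_zero _, Fin.prod_univ_succ,
    Fin.prod_univ_succ]
  simp only [Fin.cons_zero, Fin.cons_succ]
  rw [h, Fin.succ_zero_eq_one, ← Polynomial.C_mul_X_pow_eq_monomial,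
    show monomial (Finsupp.equivFunOnFinite.symm fun i : Fin n => s i.succ.succ)
      ((-1) ^ s 1 * c) = (-1) ^ s 1 * C c *
        monomial (Finsupp.equivFunOnFinite.symm fun i : Fin n => s i.succ.succ) 1 by
      rw [mul_assoc, C_mul_monomial, mul_one, ← C_1, ← C_neg, ← C_pow, C_mul_monomial],
    neg_pow (Polynomial.X : Polynomial (_root_.R n)), pow_add, map_mul, map_mul, map_pow, map_neg, Polynomial.C_1,
    IsScalarTower.algebraMap_apply ℚ (_root_.R n)]
  change Polynomial.C (C c) * _ = _
  ring

lemma coeff_coeff_pairEval {n : ℕ} (P : _root_.R (n + 2)) (m : ℕ) (d : Fin n → ℕ) :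
    coeff (Finsupp.equivFunOnFinite.symm d) ((pairEval n P).coeff m) =
      ∑ j ∈ Finset.range (m + 1), (-1 : ℚ) ^ j *
        coeff (Finsupp.equivFunOnFinite.symm (Fin.cons (m - j) (Fin.cons j d))) P := by
  induction P using MvPolynomial.induction_on' with
  | add p q hp hq =>
    rw [map_add, Polynomial.coeff_add, coeff_add, hp, hq, ← Finset.sum_add_distrib]
    simp only [coeff_add, mul_add]
  | monomial s c =>
    rw [pairEval_monomial, Polynomial.coeff_monomial]
    simp only [coeff_monomial]
    have key : ∀ j ∈ Finset.range (m + 1),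
        s = Finsupp.equivFunOnFinite.symm (Fin.cons (m - j) (Fin.cons j d)) ↔
          j = s 1 ∧ s 0 + s 1 = m ∧ ∀ i : Fin n, s i.succ.succ = d i := by
      intro j hj
      have hj' := Finset.mem_range.1 hj
      rw [Equiv.eq_symm_apply, funext_iff, Fin.forall_fin_succ, Fin.forall_fin_succ]
      simp only [Finsupp.equivFunOnFinite_apply, Fin.cons_zero, Fin.cons_succ]
      rw [Fin.succ_zero_eq_one]
      constructor
      · rintro ⟨h1, h2, h3⟩
        exact ⟨h2.symm, by omega, h3⟩
      · rintro ⟨h1, h2, h3⟩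
        exact ⟨by omega, h1.symm, h3⟩
    by_cases h : s 0 + s 1 = m ∧ ∀ i : Fin n, s i.succ.succ = d i
    · have hmem : s 1 ∈ Finset.range (m + 1) := Finset.mem_range.2 (by omega)
      rw [Finset.sum_eq_single_of_mem (s 1) hmem fun j hj hne => by
        rw [if_neg fun e => hne ((key j hj).1 e).1, mul_zero], if_pos ((key _ hmem).2 ⟨rfl, h⟩),
        if_pos h.1, funext h.2, coeff_monomial, if_pos rfl]
    · rw [Finset.sum_eq_zero fun j hj => by rw [if_neg fun e => h ((key j hj).1 e).2, mul_zero]]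
      split_ifs with h0
      · rw [coeff_monomial, if_neg fun e => h ⟨h0, fun i => ?_⟩]
        exact DFunLike.congr_fun e i
      · rw [coeff_zero]

end GenusSeries

lemma ascFactorial_div_eq {g n : ℕ} (hg : 1 ≤ g) (hn : 1 ≤ n) (D : Fin n → ℚ) :
    (((2 * g).ascFactorial n : ℚ) * ∏ i, (D i)⁻¹) / (4 ^ g * (2 * g * (2 * g + 1))) =
      ((2 * g + n - 1).factorial : ℚ) / (4 ^ g * ((2 * g + 1).factorial : ℚ) * ∏ i, D i) := by
  obtain ⟨k, hk⟩ : ∃ k, 2 * g = k + 1 := ⟨2 * g - 1, by omega⟩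
  have h := Nat.factorial_mul_ascFactorial k n
  have hk' : (2 * g : ℚ) = k + 1 := by exact_mod_cast hk
  rw [hk', hk, show k + 1 + n - 1 = k + n by omega, ← h, Nat.factorial_succ, Nat.factorial_succ,
    Finset.prod_inv_distrib]
  have h0 : (k.factorial : ℚ) ≠ 0 := Nat.cast_ne_zero.2 k.factorial_ne_zero
  have h1 : (k : ℚ) + 1 ≠ 0 := by positivity
  have h2 : (k : ℚ) + 1 + 1 ≠ 0 := by positivity
  push_cast
  field_simp

namespace GenusSeries

lemma insert_zero_map_insert_zero_map_univ (n : ℕ) :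
    insert 0 ((insert 0 ((univ : Finset (Fin n)).map (Fin.succEmb n))).map
      (Fin.succEmb (n + 1))) = univ := by
  have h (k : ℕ) : insert 0 ((univ : Finset (Fin k)).map (Fin.succEmb k)) = univ := by
    rw [Fin.univ_succ, Finset.cons_eq_insert]
    rfl
  rw [h, h]

lemma pairEval_sum_X (n : ℕ) : pairEval n (∑ i, X i) = Polynomial.C (∑ i, X i) := by
  rw [map_sum, Fin.sum_univ_succ, Fin.sum_univ_succ]
  simp only [pairEval_X_zero, Fin.succ_zero_eq_one, pairEval_X_one, pairEval_X_succ_succ, map_sum]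
  ring

lemma sum_X_ne_zero {n : ℕ} (hn : 1 ≤ n) : (∑ i, X i : _root_.R n) ≠ 0 := fun h => by
  have := varSum_ne_zero (I := (univ : Finset (Fin n))) ⟨⟨0, hn⟩, mem_univ _⟩
  rw [varSum, h, map_zero] at this
  exact this rfl

/-- The leading coefficient of the specialized `(n + 2)`-point function. -/
theorem exists_coeff_pairEval {g n : ℕ} (hg : 1 ≤ g) (hn : 1 ≤ n) :
    ∃ P : _root_.R (n + 2), algebraMap _ (K (n + 2)) P = Fnpt (n + 2) g ∧
      ∀ d : Fin n →₀ ℕ, (∀ i, 1 ≤ d i) → ∑ i, (d i - 1) = g - 1 →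
        coeff d ((pairEval n P).coeff (2 * g)) = ((2 * g).ascFactorial n *
            ∏ i, (Nat.doubleFactorial (2 * d i - 1) : ℚ)⁻¹) / (4 ^ g * (2 * g * (2 * g + 1))) := by
  obtain ⟨P, hP⟩ := emb_Fnpt_mem (n := n + 2) g (N := univ) ⟨0, mem_univ _⟩ (by omega)
  rw [emb_univ fun k => Fnpt k g] at hP
  refine ⟨P, hP, fun d hd hs => ?_⟩
  obtain ⟨η, hη, μ, htop, hμ⟩ := exists_isTop_pair n
  obtain ⟨p, hp, hc⟩ := hμ g d hg hd hs
  have hval : η.val g univ = (∑ i, X i) * P := by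
    refine IsFractionRing.injective (_root_.R (n + 2)) (K (n + 2)) ?_
    rw [← val_mapSeries, hη, val_mark, val_mark, insert_zero_map_insert_zero_map_univ, val_point₁,
      emb_univ fun k => Fnpt k g, map_mul, hP, varSum]
  have e := (htop (n + 2 * g + 1) g univ (by rw [card_univ, Fintype.card_fin]; omega)).2
  rw [val_mapSeries, hval, hp] at e
  change (pairEval n _).coeff _ = _ at e
  rw [map_mul, pairEval_sum_X, Polynomial.coeff_C_mul] at e
  rw [show (pairEval n P).coeff (2 * g) = p from mul_left_cancel₀ (sum_X_ne_zero hn) e, hc]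

end GenusSeries

/-- Corollary 3.2 (ii): for `g ≥ 1`, `d_j ≥ 1` with `Σ (d_j − 1) = g − 1`,
`Σ_{j=0}^{2g} (−1)^j ⟨τ_{2g−j}τ_j Πτ_{d_i}⟩_g = (2g+n−1)!/(4^g(2g+1)! Π (2d_j−1)!!)`. -/
theorem corollary_3_2_ii (g n : ℕ) (hg : 1 ≤ g) (hn : 1 ≤ n) (d : Fin n → ℕ)
    (hd : ∀ j, 1 ≤ d j) (hsum : ∑ j, (d j - 1) = g - 1) :
    ∑ j ∈ Finset.range (2*g+1),
        (-1 : ℚ)^j * bracket g (Fin.cons (2*g-j) (Fin.cons j d))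
      = ((2*g+n-1).factorial : ℚ) /
          (4^g * ((2*g+1).factorial : ℚ) * ∏ j, (Nat.doubleFactorial (2*(d j)-1) : ℚ)) := by
  obtain ⟨P, hP, hc⟩ := GenusSeries.exists_coeff_pairEval hg hn
  rw [← ascFactorial_div_eq hg hn]
  refine Eq.trans ?_ (hc (Finsupp.equivFunOnFinite.symm d) hd hsum)
  rw [GenusSeries.coeff_coeff_pairEval]
  exact Finset.sum_congr rfl fun j _ => by rw [bracket_eq_coeff (by omega) hP]

end
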